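/- arXiv:1606.01586 — 2 statements merged into one kernel-verified Lean document; each statement's English description precedes it below -/
import Mathlib

section
/- For every constant ε₁ < 2/3 there exists a constant C > 0 such that the following holds for all n. Let g = (g_1,…,g_n) be nonnegative integers with even sum 2m and g_max = max_j g_j ≥ 1. Let X be a simple graph on vertex set {1,…,n} with degree sequence (x_1,…,x_n) and x_max = max_j x_j. Suppose Δ̂ ≤ ε₁ m, where Δ̂ = 2 + g_max( (3/2)g_max + x_max + 1 ). Let N(g,X) denote the number of simple graphs on {1,…,n} with degree sequence g having no edge in common with X. Then N(g,X) = ( (2m)! / ( m! · 2^m · ∏_{j=1}^n g_j! ) ) · exp( −λ − λ² − μ + E ), where λ = (1/(4m)) Σ_{j=1}^n g_j(g_j−1), μ = (1/(2m)) Σ_{{i,j}∈E(X)} g_i g_j, and |E| ≤ C·Δ̂²/m. -/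
attribute [local instance] Classical.propDecidable

namespace McKay

open Finset Equiv

section Switchings

variable {V : Type*}

/-- A perfect matching of `V`, encoded as a fixed-point-free involution. -/
def IsPerfectMatching (M : Perm V) : Prop :=
  (∀ v, M (M v) = v) ∧ ∀ v, M v ≠ v

/-- Conjugation by a transposition: it exchanges the partners of `b` and `c`. -/
noncomputable def switch (b c : V) (M : Perm V) : Perm V := swap b c * M * swap b c

theorem switch_switch (b c : V) (M : Perm V) : switch b c (switch b c M) = M := by
  ext v; simp [switch]

theorem IsPerfectMatching.switch {M : Perm V} (hM : IsPerfectMatching M) (b c : V) :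
    IsPerfectMatching (switch b c M) := by
  refine ⟨fun v => ?_, fun v h => ?_⟩
  · simp [McKay.switch, hM.1]
  · have h' : swap b c (M (swap b c v)) = v := h
    exact hM.2 (swap b c v) ((swap b c).injective (by simpa using h'))

theorem switch_apply_left {M : Perm V} {a b c : V} (hab : M a = b) (hne : a ≠ b) (hac : a ≠ c) :
    switch b c M a = c := by
  simp [switch, swap_apply_of_ne_of_ne hne hac, hab]

theorem switch_apply_of_ne {M : Perm V} (hM : IsPerfectMatching M) {b c x : V}
    (hb : x ≠ b) (hc : x ≠ c) (hMb : x ≠ M b) (hMc : x ≠ M c) : switch b c M x = M x := by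
  have h1 : M x ≠ b := fun h => hMb (by rw [← h, hM.1])
  have h2 : M x ≠ c := fun h => hMc (by rw [← h, hM.1])
  simp [switch, swap_apply_of_ne_of_ne hb hc, swap_apply_of_ne_of_ne h1 h2]

theorem switch_partner_eq {M : Perm V} (hM : IsPerfectMatching M) (b : V) :
    switch b (M b) M = M := by
  ext v
  by_cases h1 : v = b
  · subst h1; simp [switch, hM.1]
  by_cases h2 : v = M b
  · subst h2; simp [switch, hM.1]
  exact switch_apply_of_ne hM h1 h2 h2 (by rwa [hM.1])

theorem switch_apply_cases {M : Perm V} (hM : IsPerfectMatching M) {a c p : V} (hca : c ≠ a)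
    (hcb : c ≠ M a) :
    (p = a ∧ switch (M a) c M p = c) ∨ (p = c ∧ switch (M a) c M p = a) ∨
      (p = M a ∧ switch (M a) c M p = M c) ∨ (p = M c ∧ switch (M a) c M p = M a) ∨
      (p ≠ a ∧ p ≠ c ∧ p ≠ M a ∧ p ≠ M c ∧ switch (M a) c M p = M p) := by
  have hMa := hM.2 a
  have hMc := hM.2 c
  have e1 : switch (M a) c M a = c := switch_apply_left rfl hMa.symm hca.symm
  have hinv := (hM.switch (M a) c).1
  have e2 : switch (M a) c M c = a := by have := hinv a; rwa [e1] at this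
  have e3 : switch (M a) c M (M a) = M c := by
    have h1 : M c ≠ M a := fun h => hca (M.injective h)
    simp [switch, swap_apply_of_ne_of_ne h1 hMc]
  have e4 : switch (M a) c M (M c) = M a := by have := hinv (M a); rwa [e3] at this
  by_cases h1 : p = a
  · subst h1; exact Or.inl ⟨rfl, e1⟩
  by_cases h2 : p = c
  · subst h2; exact Or.inr (Or.inl ⟨rfl, e2⟩)
  by_cases h3 : p = M a
  · subst h3; exact Or.inr (Or.inr (Or.inl ⟨rfl, e3⟩))
  by_cases h4 : p = M c
  · subst h4; exact Or.inr (Or.inr (Or.inr (Or.inl ⟨rfl, e4⟩)))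
  exact Or.inr (Or.inr (Or.inr (Or.inr ⟨h1, h2, h3, h4,
    switch_apply_of_ne hM h3 h2 (by rwa [hM.1]) h4⟩)))

variable [Fintype V]

/-- A family of perfect matchings, all preserving `U`, in which for every vertex outside `U` all
but at most `B` switchings stay inside the family. -/
structure Switchable (A : Finset (Perm V)) (U : Finset V) (B : ℕ) : Prop where
  isPerfectMatching : ∀ M ∈ A, IsPerfectMatching M
  apply_mem : ∀ M ∈ A, ∀ u ∈ U, M u ∈ U
  card_le : ∀ M ∈ A, ∀ a ∉ U, #{c ∈ Uᶜ | switch (M a) c M ∉ A} ≤ B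

theorem Switchable.apply_notMem {A : Finset (Perm V)} {U : Finset V} {B : ℕ}
    (h : Switchable A U B) {M : Perm V} (hM : M ∈ A) {a : V} (ha : a ∉ U) : M a ∉ U := by
  intro h'
  have := h.apply_mem M hM _ h'
  rw [(h.isPerfectMatching M hM).1] at this
  exact ha this

theorem Switchable.force {A : Finset (Perm V)} {U : Finset V} {B : ℕ}
    (h : Switchable A U B) (a b : V) :
    Switchable {M ∈ A | M a = b} (insert a (insert b U)) B where
  isPerfectMatching M hM := h.isPerfectMatching M (mem_filter.1 hM).1
  apply_mem M hM u hu := by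
    replace hM := mem_filter.1 hM
    obtain ⟨hM, rfl⟩ := hM
    have := (h.isPerfectMatching M hM).1 a
    simp only [mem_insert] at hu ⊢
    rcases hu with rfl | rfl | hu
    · simp
    · simp [this]
    · simp [h.apply_mem M hM u hu]
  card_le M hM x hx := by
    replace hM := mem_filter.1 hM
    obtain ⟨hM, rfl⟩ := hM
    have hP := h.isPerfectMatching M hM
    simp only [mem_insert, not_or] at hx
    refine le_trans (card_le_card ?_) (h.card_le M hM x hx.2.2)
    intro c hc
    simp only [mem_filter, mem_compl, mem_insert, not_or, not_and] at hc ⊢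
    refine ⟨hc.1.2.2, fun hs => hc.2 hs ?_⟩
    refine switch_apply_of_ne hP ?_ ?_ ?_ ?_
    · rintro rfl; exact hx.2.1 (by rw [hP.1])
    · exact fun h => hc.1.1 h.symm
    · rw [hP.1]; exact fun h => hx.1 h.symm
    · rintro rfl; exact hc.1.2.1 (by rw [hP.1])

theorem Switchable.card_switch_pairs {A : Finset (Perm V)} {U : Finset V} {B : ℕ}
    (h : Switchable A U B) {a b : V} (ha : a ∉ U) (hab : a ≠ b) :
    #{x ∈ {M ∈ A | M a = b} ×ˢ (insert a (insert b U))ᶜ | switch b x.2 x.1 ∈ A} =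
      #{M ∈ A | M a ≠ b ∧ switch b (M a) M ∈ A} := by
  refine card_nbij' (fun x => switch b x.2 x.1) (fun M => (switch b (M a) M, M a)) ?_ ?_ ?_ ?_
  · rintro ⟨M, c⟩ hx
    simp only [mem_coe, mem_filter, mem_product, mem_compl, mem_insert, not_or] at hx ⊢
    obtain ⟨⟨⟨hM, hMa⟩, hca, hcb, hcU⟩, hs⟩ := hx
    rw [switch_apply_left hMa hab (Ne.symm hca), switch_switch]
    exact ⟨hs, hcb, hM⟩
  · intro M hM
    simp only [mem_coe, mem_filter, mem_product, mem_compl, mem_insert, not_or] at hM ⊢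
    obtain ⟨hM, hMa, hs⟩ := hM
    have hP := h.isPerfectMatching M hM
    refine ⟨⟨⟨hs, ?_⟩, hP.2 a, hMa, h.apply_notMem hM ha⟩, by rwa [switch_switch]⟩
    simp [switch, swap_apply_of_ne_of_ne hab (hP.2 a).symm]
  · rintro ⟨M, c⟩ hx
    simp only [mem_coe, mem_filter, mem_product, mem_compl, mem_insert, not_or] at hx ⊢
    obtain ⟨⟨⟨hM, hMa⟩, hca, hcb, hcU⟩, hs⟩ := hx
    rw [switch_apply_left hMa hab (Ne.symm hca), switch_switch]
  · intro M hM
    simp [switch_switch]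

theorem card_eq_sum_switch {A : Finset (Perm V)} {a b : V} (W : Finset V) :
    #{x ∈ {M ∈ A | M a = b} ×ˢ W | switch b x.2 x.1 ∈ A} =
      ∑ M ∈ A with M a = b, #{c ∈ W | switch b c M ∈ A} := by
  rw [card_filter, sum_product]
  exact sum_congr rfl fun M _ => (card_filter _ _).symm

theorem Switchable.card_force_mul_le {A : Finset (Perm V)} {U : Finset V} {B : ℕ}
    (h : Switchable A U B) {a : V} (b : V) (ha : a ∉ U) {K : ℝ}
    (hK : K ≤ Fintype.card V - 1 - #U - B) :
    (#{M ∈ A | M a = b} : ℝ) * K ≤ #A := by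
  by_cases hne : {M ∈ A | M a = b} = ∅
  · simp [hne]
  obtain ⟨M₀, hM₀⟩ := nonempty_iff_ne_empty.2 hne
  obtain ⟨hM₀, hM₀a⟩ := mem_filter.1 hM₀
  have hbU : b ∉ U := hM₀a ▸ h.apply_notMem hM₀ ha
  have hab : a ≠ b := fun e => (h.isPerfectMatching _ hM₀).2 a (hM₀a.trans e.symm)
  have key := h.card_switch_pairs ha hab
  rw [card_eq_sum_switch] at key
  have hW : (#(insert a (insert b U))ᶜ : ℝ) = Fintype.card V - 2 - #U := by
    have h1 : #(insert a (insert b U)) = #U + 2 := by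
      rw [card_insert_of_notMem (by simp [hab, ha]), card_insert_of_notMem hbU]
    have h2 := card_add_card_compl (insert a (insert b U))
    rw [h1] at h2
    have h3 : ((#U : ℝ) + 2 + #(insert a (insert b U))ᶜ) = Fintype.card V := by exact_mod_cast h2
    linarith
  have low : (#{M ∈ A | M a = b} : ℝ) * (K - 1) ≤
      ((∑ M ∈ A with M a = b, #{c ∈ (insert a (insert b U))ᶜ | switch b c M ∈ A} : ℕ) : ℝ) := by
    push_cast
    rw [← nsmul_eq_mul]
    refine card_nsmul_le_sum _ _ _ fun M hM => ?_
    obtain ⟨hM, hMa⟩ := mem_filter.1 hM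
    have h1 := h.card_le M hM a ha
    rw [hMa] at h1
    have h2 : #{c ∈ (insert a (insert b U))ᶜ | switch b c M ∉ A} ≤ B := by
      refine le_trans (card_le_card ?_) h1
      intro c hc
      simp only [mem_filter, mem_compl, mem_insert, not_or] at hc ⊢
      exact ⟨hc.1.2.2, hc.2⟩
    have h3 := card_filter_add_card_filter_not (s := (insert a (insert b U))ᶜ)
      (fun c => switch b c M ∈ A)
    have h4 : (#{c ∈ (insert a (insert b U))ᶜ | switch b c M ∈ A} : ℝ) +
        #{c ∈ (insert a (insert b U))ᶜ | switch b c M ∉ A} = #(insert a (insert b U))ᶜ := by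
      exact_mod_cast h3
    have h5 : (#{c ∈ (insert a (insert b U))ᶜ | switch b c M ∉ A} : ℝ) ≤ B := by exact_mod_cast h2
    linarith
  have hsub : #{M ∈ A | M a ≠ b ∧ switch b (M a) M ∈ A} ≤ #{M ∈ A | ¬ M a = b} :=
    card_le_card fun M hM => by
      simp only [mem_filter] at hM ⊢; exact ⟨hM.1, hM.2.1⟩
  have htot := card_filter_add_card_filter_not (s := A) (fun M => M a = b)
  rw [key] at low
  have e1 : (#{M ∈ A | M a ≠ b ∧ switch b (M a) M ∈ A} : ℝ) ≤ #{M ∈ A | ¬ M a = b} := by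
    exact_mod_cast hsub
  have e2 : (#{M ∈ A | M a = b} : ℝ) + #{M ∈ A | ¬ M a = b} = #A := by exact_mod_cast htot
  linarith

theorem Switchable.card_le_force_mul {A : Finset (Perm V)} {U : Finset V} {B : ℕ}
    (h : Switchable A U B) {a b : V} (ha : a ∉ U) (hab : a ≠ b) :
    #A ≤ #{M ∈ A | M a = b} * Fintype.card V +
      #{M ∈ A | M a ≠ b ∧ switch b (M a) M ∉ A} := by
  have key := h.card_switch_pairs ha hab
  have up : #{x ∈ {M ∈ A | M a = b} ×ˢ (insert a (insert b U))ᶜ | switch b x.2 x.1 ∈ A} ≤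
      #{M ∈ A | M a = b} * #(insert a (insert b U))ᶜ := by
    rw [← card_product]; exact card_filter_le _ _
  have hlt : #(insert a (insert b U))ᶜ + 1 ≤ Fintype.card V :=
    card_lt_univ_of_notMem (x := a) (by simp)
  have h1 := card_filter_add_card_filter_not (s := A) (fun M => M a = b)
  have h2 := card_filter_add_card_filter_not (s := {M ∈ A | ¬ M a = b})
    (fun M => switch b (M a) M ∈ A)
  rw [filter_filter, filter_filter] at h2
  have := Nat.mul_le_mul_left (#{M ∈ A | M a = b}) hlt
  simp only [ne_eq] at *
  nlinarith

theorem Switchable.card_force_two_mul_le {A : Finset (Perm V)} {U : Finset V} {B : ℕ}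
    (h : Switchable A U B) {a b c d : V} (ha : a ∉ U) (hb : b ∉ U) (hab : a ≠ b) (hcb : c ≠ b)
    {K : ℝ} (hK0 : 0 ≤ K) (hK : K ≤ Fintype.card V - 3 - #U - B) :
    (#{M ∈ A | M a = c ∧ M b = d} : ℝ) * K ^ 2 ≤ #A := by
  have h1 := h.card_force_mul_le c ha (K := K) (by linarith)
  have hU : (#(insert a (insert c U)) : ℝ) ≤ #U + 2 := by
    exact_mod_cast (card_insert_le _ _).trans (Nat.succ_le_succ (card_insert_le _ _))
  have h2 := (h.force a c).card_force_mul_le d (a := b) (K := K)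
    (by simp [hab.symm, hcb.symm, hb]) (by linarith)
  rw [filter_filter] at h2
  nlinarith

theorem Switchable.card_force_three_mul_le {A : Finset (Perm V)} {U : Finset V} {B : ℕ}
    (h : Switchable A U B) {a b c d x y : V} (ha : a ∉ U) (hb : b ∉ U) (hx : x ∉ U)
    (hab : a ≠ b) (hcb : c ≠ b) (hxa : x ≠ a) (hxb : x ≠ b) (hxc : x ≠ c) (hxd : x ≠ d)
    {K : ℝ} (hK0 : 0 ≤ K) (hK : K ≤ Fintype.card V - 5 - #U - B) :
    (#{M ∈ A | M a = c ∧ M b = d ∧ M x = y} : ℝ) * K ^ 3 ≤ #A := by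
  have h1 := h.card_force_mul_le c ha (K := K) (by linarith)
  have hU : (#(insert a (insert c U)) : ℝ) ≤ #U + 2 := by
    exact_mod_cast (card_insert_le _ _).trans (Nat.succ_le_succ (card_insert_le _ _))
  have h2 := (h.force a c).card_force_two_mul_le (a := b) (b := x) (c := d) (d := y)
    (by simp [hab.symm, hcb.symm, hb]) (by simp [hxa, hxc, hx]) hxb.symm hxd.symm hK0
    (by linarith)
  rw [filter_filter] at h2
  nlinarith

variable {ι : Type*}

/-- The perfect matchings containing no edge of `T₁` and no pair of edges of `T₂`. -/
noncomputable def avoiding (T₁ : Finset (V × V)) (T₂ : Finset ((V × V) × (V × V))) :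
    Finset (Perm V) :=
  {M | IsPerfectMatching M ∧ (∀ e ∈ T₁, M e.1 ≠ e.2) ∧
    ∀ f ∈ T₂, M f.1.1 = f.1.2 → M f.2.1 ≠ f.2.2}

/-- Forbidden edges `T₁` taken from a relation `Y` of degree at most `D`, together with forbidden
pairs `T₂` of edges that are parallel with respect to a map `κ` with fibres of size at most `G`. -/
structure Forbidden (κ : V → ι) (Y : V → V → Prop) (G D : ℕ) (T₁ : Finset (V × V))
    (T₂ : Finset ((V × V) × (V × V))) : Prop where
  symm : ∀ a b, Y a b → Y b a
  degree_le : ∀ a, #{c | Y a c} ≤ D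
  fiber_le : ∀ a, #{c | κ c = κ a} ≤ G
  single : ∀ e ∈ T₁, Y e.1 e.2
  parallel : ∀ f ∈ T₂, κ f.1.1 = κ f.2.1 ∧ κ f.1.2 = κ f.2.2 ∧ f.1.1 ≠ f.2.1 ∧ f.1.2 ≠ f.2.2 ∧
    κ f.1.1 ≠ κ f.1.2
  loopless : ∀ M ∈ avoiding T₁ T₂, ∀ p, κ (M p) ≠ κ p

variable {κ : V → ι} {Y : V → V → Prop} {G D : ℕ} {T₁ : Finset (V × V)}
  {T₂ : Finset ((V × V) × (V × V))}

/-- The ways in which a switching can leave `avoiding T₁ T₂`. -/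
theorem Forbidden.of_switch_notMem (h : Forbidden κ Y G D T₁ T₂) {M : Perm V}
    (hM : M ∈ avoiding T₁ T₂) {a c : V} (hca : c ≠ a) (hcb : c ≠ M a)
    (hs : switch (M a) c M ∉ avoiding T₁ T₂) :
    ((a, c) ∈ T₁ ∨ (c, a) ∈ T₁) ∨ Y (M a) (M c) ∨ κ (M a) = κ c ∨
    (∃ x, κ x = κ a ∧ κ (M x) = κ c ∧ ∃ f ∈ T₂,
      (s(f.1.1, f.1.2) = s(a, c) ∧ s(f.2.1, f.2.2) = s(x, M x)) ∨
      (s(f.2.1, f.2.2) = s(a, c) ∧ s(f.1.1, f.1.2) = s(x, M x))) ∨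
    (∃ x, x ≠ a ∧ x ≠ c ∧ x ≠ M a ∧ x ≠ M c ∧ κ x = κ (M a) ∧ κ (M x) = κ (M c)) := by
  have hl := h.loopless M hM
  have hM' := hM
  simp only [avoiding, mem_filter, mem_univ, true_and] at hM hs
  obtain ⟨hP, h1, h2⟩ := hM
  by_contra hcon
  push Not at hcon
  obtain ⟨⟨n1, n1'⟩, n2, n3, n4, n5⟩ := hcon
  refine hs ⟨hP.switch _ _, ?_, ?_⟩
  · rintro ⟨p, q⟩ he heq
    have hY := h.single _ he
    have := h1 _ he
    have hsy := h.symm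
    rcases switch_apply_cases hP (p := p) hca hcb with h | h | h | h | h <;> grind
  · rintro ⟨⟨p, p'⟩, ⟨q, q'⟩⟩ hf hp hq
    have hpar := h.parallel _ hf
    have h2f := h2 _ hf
    have inv := hP.1
    dsimp only at hp hq hpar h2f
    have hla := hl a
    have hlc := hl c
    have inj := M.injective
    have n5' : ∀ x, x ≠ a → x ≠ c → x ≠ M a → x ≠ M c → κ x = κ (M c) → κ (M x) ≠ κ (M a) := by
      intro x _ _ _ _ h1 h2
      exact n5 (M x) (by grind) (by grind) (by grind) (by grind) h2 (by rw [inv]; exact h1)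
    rcases switch_apply_cases hP (p := p) hca hcb with hp1 | hp1 | hp1 | hp1 | hp1 <;>
    rcases switch_apply_cases hP (p := q) hca hcb with hq1 | hq1 | hq1 | hq1 | hq1
    all_goals grind

theorem Forbidden.switchable (h : Forbidden κ Y G D T₁ T₂) {U : Finset V} {τ : V → V}
    (hτ : ∀ u ∈ U, τ u ∈ U) :
    Switchable {M ∈ avoiding T₁ T₂ | ∀ u ∈ U, M u = τ u} U (2 * (D + G * G)) where
  isPerfectMatching M hM := by
    simp only [avoiding, mem_filter] at hM; exact hM.1.2.1
  apply_mem M hM u hu := by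
    rw [(mem_filter.1 hM).2 u hu]; exact hτ u hu
  card_le M hM a ha := by
    obtain ⟨hMA, hMU⟩ := mem_filter.1 hM
    have hP : IsPerfectMatching M := by
      simp only [avoiding, mem_filter] at hMA; exact hMA.2.1
    have hMmem : ∀ x, x ∉ U → M x ∉ U := fun x hx hx' => hx <| by
      have := hτ _ hx'
      rwa [← hMU _ hx', hP.1] at this
    have hsub : ({c ∈ Uᶜ | switch (M a) c M ∉
        ({M ∈ avoiding T₁ T₂ | ∀ u ∈ U, M u = τ u} : Finset (Perm V))} : Finset V) ⊆
        (({c | Y a c} : Finset V) ∪ ({c | Y (M a) c} : Finset V).image M) ∪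
        (({x | κ x = κ a} : Finset V).biUnion (fun x => {c | κ c = κ (M x)}) ∪
          (({x | κ x = κ (M a)} : Finset V).biUnion
            (fun x => {c | κ c = κ (M x)})).image M) := by
      intro c hc
      simp only [mem_filter, mem_compl, not_and] at hc
      obtain ⟨hcU, hcs⟩ := hc
      have hnot : switch (M a) c M ∉ avoiding T₁ T₂ := fun hs => hcs hs fun u hu => by
        rw [switch_apply_of_ne hP, hMU u hu]
        · rintro rfl; exact hMmem a ha hu
        · rintro rfl; exact hcU hu
        · rw [hP.1]; rintro rfl; exact ha hu
        · rintro rfl; exact hMmem c hcU hu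
      have hca : c ≠ a := by
        rintro rfl
        refine hnot ?_
        have := switch_partner_eq hP (M c)
        rw [hP.1] at this
        rwa [this]
      have hcb : c ≠ M a := by
        rintro rfl
        refine hnot ?_
        rwa [switch, swap_self, ← Perm.one_def, one_mul, mul_one]
      simp only [mem_union, mem_filter, mem_univ, true_and, mem_biUnion, mem_image]
      have hsy := h.symm
      rcases h.of_switch_notMem hMA hca hcb hnot with
        (h1 | h1) | h1 | h1 | ⟨x, h1, h2, -⟩ | ⟨x, -, -, -, -, h1, h2⟩
      · exact Or.inl (Or.inl (h.single _ h1))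
      · exact Or.inl (Or.inl (hsy _ _ (h.single _ h1)))
      · exact Or.inl (Or.inr ⟨M c, h1, hP.1 c⟩)
      · exact Or.inr (Or.inl ⟨a, rfl, h1.symm⟩)
      · exact Or.inr (Or.inl ⟨x, h1, h2.symm⟩)
      · exact Or.inr (Or.inr ⟨M c, ⟨x, h1, h2.symm⟩, hP.1 c⟩)
    have hbi : ∀ a, #(({x | κ x = κ a} : Finset V).biUnion
        (fun x => ({c | κ c = κ (M x)} : Finset V))) ≤ G * G := fun a =>
      (card_biUnion_le_card_mul _ _ G fun x _ => h.fiber_le (M x)).trans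
        (Nat.mul_le_mul_right _ (h.fiber_le a))
    have b1 := h.degree_le a
    have b2 := (card_image_le (f := M)).trans (h.degree_le (M a))
    have b3 := hbi a
    have b4 := (card_image_le (f := M)).trans (hbi (M a))
    refine (card_le_card hsub).trans ?_
    refine (card_union_le _ _).trans ?_
    have c1 := card_union_le ({c | Y a c} : Finset V) (({c | Y (M a) c} : Finset V).image M)
    have c2 := card_union_le
      (({x | κ x = κ a} : Finset V).biUnion (fun x => ({c | κ c = κ (M x)} : Finset V)))
      ((({x | κ x = κ (M a)} : Finset V).biUnion
            (fun x => ({c | κ c = κ (M x)} : Finset V))).image M)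
    omega

theorem card_mul_le_of_cover {α β γ : Type*} {s : Finset α} {t : α → Finset β}
    {S : α → β → Finset γ} {R : Finset γ} (n : ℕ) {k r : ℝ} (hk : 0 ≤ k) (hr : 0 ≤ r)
    (ht : ∀ i ∈ s, #(t i) ≤ n) (hS : ∀ i ∈ s, ∀ j ∈ t i, (#(S i j) : ℝ) * k ≤ r)
    (hR : ∀ M ∈ R, ∃ i ∈ s, ∃ j ∈ t i, M ∈ S i j) : (#R : ℝ) * k ≤ #s * n * r := by
  have hsub : R ⊆ s.biUnion fun i => (t i).biUnion (S i) := fun M hM => by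
    simpa only [mem_biUnion] using hR M hM
  have h1 : #R ≤ ∑ i ∈ s, ∑ j ∈ t i, #(S i j) :=
    (card_le_card hsub).trans <| card_biUnion_le.trans <|
      sum_le_sum fun i _ => card_biUnion_le
  have h2 : (#R : ℝ) ≤ ∑ i ∈ s, ∑ j ∈ t i, (#(S i j) : ℝ) := by exact_mod_cast h1
  calc (#R : ℝ) * k ≤ (∑ i ∈ s, ∑ j ∈ t i, (#(S i j) : ℝ)) * k := by gcongr
    _ = ∑ i ∈ s, ∑ j ∈ t i, (#(S i j) : ℝ) * k := by simp only [sum_mul]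
    _ ≤ ∑ i ∈ s, ∑ j ∈ t i, r := sum_le_sum fun i hi => sum_le_sum fun j hj => hS i hi j hj
    _ ≤ ∑ i ∈ s, (n : ℝ) * r := sum_le_sum fun i hi => by
        rw [sum_const, nsmul_eq_mul]
        exact mul_le_mul_of_nonneg_right (by exact_mod_cast ht i hi) hr
    _ = #s * n * r := by rw [sum_const, nsmul_eq_mul, mul_assoc]

theorem Switchable.card_relation_mul_le {A : Finset (Perm V)} {U : Finset V} {B : ℕ}
    (h : Switchable A U B) (hY : ∀ a, #{c | Y a c} ≤ D) {a b : V} (ha : a ∉ U) (hb : b ∉ U)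
    (hab : a ≠ b) {K : ℝ} (hK0 : 0 ≤ K) (hK : K ≤ Fintype.card V - 3 - #U - B) :
    (#{M ∈ A | M a ≠ b ∧ Y (M a) (M b)} : ℝ) * K ^ 2 ≤ Fintype.card V * D * #A := by
  refine (card_mul_le_of_cover (s := ({c : V | c ≠ b} : Finset V))
    (t := fun c => ({d | Y c d} : Finset V))
    (S := fun c d => ({M ∈ A | M a = c ∧ M b = d} : Finset (Perm V))) D (k := K ^ 2) (r := #A)
    (by positivity) (by positivity) (fun c _ => hY c) (fun c hc d _ => ?_)
    (fun M hM => ?_)).trans ?_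
  · simp only [mem_filter, mem_univ, true_and] at hc
    exact h.card_force_two_mul_le ha hb hab hc hK0 hK
  · simp only [mem_filter] at hM
    exact ⟨M a, by simp [hM.2.1], M b, by simp [hM.2.2], by simp [hM.1]⟩
  · gcongr
    exact card_le_univ _

theorem Switchable.card_parallel_mul_le {A : Finset (Perm V)} {U : Finset V} {B : ℕ}
    (h : Switchable A U B) (hκ : ∀ a, #{c | κ c = κ a} ≤ G) (a b : V)
    {K : ℝ} (hK0 : 0 ≤ K) (hK : K ≤ Fintype.card V - 1 - #U - B) :
    (#{M ∈ A | ∃ x ∉ U, κ x = κ a ∧ κ (M x) = κ b} : ℝ) * K ≤ G * G * #A := by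
  refine (card_mul_le_of_cover (s := ({x : V | κ x = κ a ∧ x ∉ U} : Finset V))
    (t := fun _ => ({y | κ y = κ b} : Finset V))
    (S := fun x y => ({M ∈ A | M x = y} : Finset (Perm V))) G (k := K) (r := #A)
    hK0 (by positivity) (fun _ _ => hκ b) (fun x hx y _ => ?_)
    (fun M hM => ?_)).trans ?_
  · simp only [mem_filter, mem_univ, true_and] at hx
    exact h.card_force_mul_le y hx.2 hK
  · simp only [mem_filter] at hM
    obtain ⟨hM, x, hx, hx1, hx2⟩ := hM
    exact ⟨x, by simp [hx1, hx], M x, by simp [hx2], by simp [hM]⟩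
  · gcongr
    refine (card_le_card ?_).trans (hκ a)
    intro x; simp +contextual

theorem Switchable.card_parallel_partners_mul_le {A : Finset (Perm V)} {U : Finset V} {B : ℕ}
    (h : Switchable A U B) (hκ : ∀ a, #{c | κ c = κ a} ≤ G) {a b : V} (ha : a ∉ U) (hb : b ∉ U)
    (hab : a ≠ b) {K : ℝ} (hK0 : 0 ≤ K) (hK : K ≤ Fintype.card V - 5 - #U - B) :
    (#{M ∈ A | M a ≠ b ∧ ∃ x ∉ U, x ≠ a ∧ x ≠ b ∧ x ≠ M a ∧ x ≠ M b ∧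
      κ x = κ (M a) ∧ κ (M x) = κ (M b)} : ℝ) * K ^ 3 ≤
      Fintype.card V * Fintype.card V * (G * G) * #A := by
  refine (card_mul_le_of_cover
    (s := ({p : V × V | p.1 ∉ U ∧ p.1 ≠ a ∧ p.1 ≠ b} : Finset (V × V)))
    (t := fun p => ({c | κ c = κ p.1 ∧ c ≠ b ∧ p.1 ≠ c} : Finset V) ×ˢ
        ({d | κ d = κ p.2 ∧ p.1 ≠ d} : Finset V))
    (S := fun p q => ({M ∈ A | M a = q.1 ∧ M b = q.2 ∧ M p.1 = p.2} : Finset (Perm V)))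
    (G * G) (k := K ^ 3) (r := #A)
    (by positivity) (by positivity) (fun p _ => ?_) (fun p hp q hq => ?_)
    (fun M hM => ?_)).trans ?_
  · rw [card_product]
    refine Nat.mul_le_mul ((card_le_card ?_).trans (hκ p.1)) ((card_le_card ?_).trans (hκ p.2))
    · intro x; simp +contextual
    · intro x; simp +contextual
  · simp only [mem_filter, mem_product, mem_univ, true_and] at hp hq
    exact h.card_force_three_mul_le ha hb hp.1 hab hq.1.2.1 hp.2.1 hp.2.2 hq.1.2.2 hq.2.2 hK0 hK
  · simp only [mem_filter] at hM
    obtain ⟨hM, hMab, x, hx, hxa, hxb, hxMa, hxMb, hx1, hx2⟩ := hM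
    exact ⟨(x, M x), by simp [hx, hxa, hxb], (M a, M b),
      by simp [hx1, hx2, hMab, hxMa, hxMb], by simp [hM]⟩
  · push_cast
    gcongr
    have := card_le_univ ({p : V × V | p.1 ∉ U ∧ p.1 ≠ a ∧ p.1 ≠ b} : Finset (V × V))
    rw [Fintype.card_prod] at this
    exact_mod_cast this

theorem Switchable.card_forced_parallel_mul_le {A : Finset (Perm V)} {U : Finset V} {B : ℕ}
    (h : Switchable A U B) (hκ : ∀ a, #{c | κ c = κ a} ≤ G) (τ : V → V) {a b : V} (ha : a ∉ U)
    (hb : b ∉ U) (hab : a ≠ b) {K : ℝ} (hK0 : 0 ≤ K) (hK : K ≤ Fintype.card V - 3 - #U - B) :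
    (#{M ∈ A | M a ≠ b ∧ ∃ x ∈ U, κ x = κ (M a) ∧ κ (τ x) = κ (M b)} : ℝ) * K ^ 2 ≤
      #U * (G * G) * #A := by
  have := card_mul_le_of_cover
    (R := ({M ∈ A | M a ≠ b ∧ ∃ x ∈ U, κ x = κ (M a) ∧ κ (τ x) = κ (M b)} : Finset (Perm V)))
    (s := U)
    (t := fun x => ({c | κ c = κ x ∧ c ≠ b} : Finset V) ×ˢ ({d | κ d = κ (τ x)} : Finset V))
    (S := fun _ q => ({M ∈ A | M a = q.1 ∧ M b = q.2} : Finset (Perm V)))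
    (G * G) (k := K ^ 2) (r := #A) (by positivity) (by positivity) (fun x _ => ?_)
    (fun x _ q hq => ?_) (fun M hM => ?_)
  · exact_mod_cast this
  · rw [card_product]
    refine Nat.mul_le_mul ((card_le_card ?_).trans (hκ x)) (hκ (τ x))
    intro x; simp +contextual
  · simp only [mem_filter, mem_product, mem_univ, true_and] at hq
    exact h.card_force_two_mul_le ha hb hab hq.1.2 hK0 hK
  · simp only [mem_filter] at hM
    obtain ⟨hM, hMab, x, hx, hx1, hx2⟩ := hM
    exact ⟨x, hx, (M a, M b), by simp [hx1, hx2, hMab], by simp [hM]⟩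

/-- Up to the error term, prescribing one more edge costs a factor `|V|`. -/
theorem Forbidden.card_le_force_mul (h : Forbidden κ Y G D T₁ T₂) {U : Finset V} {τ : V → V}
    (hτ : ∀ u ∈ U, τ u ∈ U) {A : Finset (Perm V)}
    (hA : A = {M ∈ avoiding T₁ T₂ | ∀ u ∈ U, M u = τ u}) {a b : V} (ha : a ∉ U) (hb : b ∉ U)
    (hab : a ≠ b) (h1 : (a, b) ∉ T₁) (h1' : (b, a) ∉ T₁)
    (h2 : ∀ f ∈ T₂, ∀ u ∈ U, ¬ (s(f.1.1, f.1.2) = s(a, b) ∧ s(f.2.1, f.2.2) = s(u, τ u)) ∧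
      ¬ (s(f.2.1, f.2.2) = s(a, b) ∧ s(f.1.1, f.1.2) = s(u, τ u)))
    {K : ℝ} (hK0 : 0 < K) (hK : K ≤ Fintype.card V - 5 - #U - (2 * (D + G * G) : ℕ)) :
    (#A : ℝ) ≤ #{M ∈ A | M a = b} * Fintype.card V +
      (Fintype.card V * D / K ^ 2 + G * G / K + Fintype.card V * Fintype.card V * (G * G) / K ^ 3 +
        #U * (G * G) / K ^ 2) * #A := by
  have hsw : Switchable A U (2 * (D + G * G)) := hA ▸ h.switchable hτ
  have low := hsw.card_le_force_mul ha hab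
  have hAM : ∀ M ∈ A, M ∈ avoiding T₁ T₂ ∧ ∀ u ∈ U, M u = τ u := fun M hM => by
    rw [hA] at hM; exact mem_filter.1 hM
  set R₁ : Finset (Perm V) := {M ∈ A | M a ≠ b ∧ Y (M a) (M b)} with hR₁
  set R₂ : Finset (Perm V) := {M ∈ A | ∃ x ∉ U, κ x = κ a ∧ κ (M x) = κ b} with hR₂
  set R₃ : Finset (Perm V) := {M ∈ A | M a ≠ b ∧ ∃ x ∉ U, x ≠ a ∧ x ≠ b ∧ x ≠ M a ∧ x ≠ M b ∧
    κ x = κ (M a) ∧ κ (M x) = κ (M b)} with hR₃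
  set R₄ : Finset (Perm V) := {M ∈ A | M a ≠ b ∧ ∃ x ∈ U, κ x = κ (M a) ∧ κ (τ x) = κ (M b)}
    with hR₄
  have hsub : ({M ∈ A | M a ≠ b ∧ switch b (M a) M ∉ A} : Finset (Perm V)) ⊆
      (R₁ ∪ R₂) ∪ (R₃ ∪ R₄) := by
    intro M hM
    obtain ⟨hM, hMab, hs⟩ := mem_filter.1 hM
    obtain ⟨hMA, hMU⟩ := hAM M hM
    have hP := hsw.isPerfectMatching M hM
    have hns : switch (M a) b M ∉ avoiding T₁ T₂ := fun hs' => hs <| by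
      have e : switch b (M a) M = switch (M a) b M := by simp [switch, swap_comm]
      rw [e, hA, mem_filter]
      refine ⟨hs', fun u hu => ?_⟩
      rw [switch_apply_of_ne hP, hMU u hu]
      · rintro rfl; exact hsw.apply_notMem hM ha hu
      · rintro rfl; exact hb hu
      · rw [hP.1]; rintro rfl; exact ha hu
      · rintro rfl; exact hsw.apply_notMem hM hb hu
    simp only [mem_union, R₁, R₂, R₃, R₄, mem_filter]
    rcases h.of_switch_notMem hMA hab.symm hMab.symm hns with
      (hc | hc) | hc | hc | ⟨x, hx1, hx2, f, hf, hc⟩ | ⟨x, hxa, hxb, hxMa, hxMb, hx1, hx2⟩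
    · exact absurd hc h1
    · exact absurd hc h1'
    · exact Or.inl (Or.inl ⟨hM, hMab, hc⟩)
    · exact Or.inl (Or.inr ⟨hM, a, ha, rfl, hc⟩)
    · refine Or.inl (Or.inr ⟨hM, x, fun hxU => ?_, hx1, hx2⟩)
      have := h2 f hf x hxU
      rw [hMU x hxU] at hc
      tauto
    · by_cases hxU : x ∈ U
      · exact Or.inr (Or.inr ⟨hM, hMab, x, hxU, hx1, by rwa [← hMU x hxU]⟩)
      · exact Or.inr (Or.inl ⟨hM, hMab, x, hxU, hxa, hxb, hxMa, hxMb, hx1, hx2⟩)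
  have b1 := hsw.card_relation_mul_le h.degree_le ha hb hab hK0.le (by linarith)
  have b2 := hsw.card_parallel_mul_le h.fiber_le a b hK0.le (by linarith)
  have b3 := hsw.card_parallel_partners_mul_le h.fiber_le ha hb hab hK0.le hK
  have b4 := hsw.card_forced_parallel_mul_le h.fiber_le τ ha hb hab hK0.le (by linarith)
  have hcard : #{M ∈ A | M a ≠ b ∧ switch b (M a) M ∉ A} ≤ #R₁ + #R₂ + (#R₃ + #R₄) :=
    (card_le_card hsub).trans <| (card_union_le _ _).trans <|
      add_le_add (card_union_le _ _) (card_union_le _ _)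
  have hlow : (#A : ℝ) ≤ #{M ∈ A | M a = b} * Fintype.card V + (#R₁ + #R₂ + (#R₃ + #R₄)) := by
    exact_mod_cast low.trans (Nat.add_le_add_left hcard _)
  refine hlow.trans ?_
  rw [add_mul, add_mul, add_mul, div_mul_eq_mul_div, div_mul_eq_mul_div, div_mul_eq_mul_div,
    div_mul_eq_mul_div]
  rw [← le_div_iff₀ (by positivity)] at b1 b2 b3 b4
  linarith

theorem Forbidden.card_force_bounds (h : Forbidden κ Y G D T₁ T₂) {U : Finset V} {τ : V → V}
    (hτ : ∀ u ∈ U, τ u ∈ U) {A : Finset (Perm V)}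
    (hA : A = {M ∈ avoiding T₁ T₂ | ∀ u ∈ U, M u = τ u}) {a b : V} (ha : a ∉ U) (hb : b ∉ U)
    (hab : a ≠ b) (h1 : (a, b) ∉ T₁) (h1' : (b, a) ∉ T₁)
    (h2 : ∀ f ∈ T₂, ∀ u ∈ U, ¬ (s(f.1.1, f.1.2) = s(a, b) ∧ s(f.2.1, f.2.2) = s(u, τ u)) ∧
      ¬ (s(f.2.1, f.2.2) = s(a, b) ∧ s(f.1.1, f.1.2) = s(u, τ u)))
    (hU : #U ≤ 2) {N Δ : ℝ} (hN : N = Fintype.card V)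
    (hΔ : 7 + 2 * ((D : ℝ) + G * G) ≤ 2 * Δ) (hΔN : 3 * Δ ≤ N) :
    (#A : ℝ) * (1 - 57 * (Δ / N)) ≤ #{M ∈ A | M a = b} * N ∧
      #{M ∈ A | M a = b} * N ≤ (#A : ℝ) * (1 + 6 * (Δ / N)) := by
  have hD : (0 : ℝ) ≤ D := by positivity
  have hG : (0 : ℝ) ≤ G * G := by positivity
  have hN0 : 1 ≤ N := by linarith
  have hΔ0 : 0 ≤ Δ := by linarith
  have hDΔ : (D : ℝ) ≤ Δ := by linarith
  have hGΔ : (G * G : ℝ) ≤ Δ := by linarith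
  have hK3 : N / 3 ≤ N - 2 * Δ := by linarith
  have hK0 : 0 < N - 2 * Δ := by linarith
  have hU' : (#U : ℝ) ≤ 2 := by exact_mod_cast hU
  have hA0 : (0 : ℝ) ≤ #A := by positivity
  have hK : N - 2 * Δ ≤ Fintype.card V - 5 - #U - (2 * (D + G * G) : ℕ) := by
    push_cast
    linarith
  constructor
  · have := h.card_le_force_mul hτ hA ha hb hab h1 h1' h2 hK0 hK
    rw [← hN] at this
    have e : N * D / (N - 2 * Δ) ^ 2 + G * G / (N - 2 * Δ) + N * N * (G * G) / (N - 2 * Δ) ^ 3 +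
        #U * (G * G) / (N - 2 * Δ) ^ 2 ≤ 57 * (Δ / N) := by
      have e1 : N * D / (N - 2 * Δ) ^ 2 ≤ N * Δ / (N / 3) ^ 2 := by gcongr
      have e2 : (G * G : ℝ) / (N - 2 * Δ) ≤ Δ / (N / 3) := by gcongr
      have e3 : N * N * (G * G) / (N - 2 * Δ) ^ 3 ≤ N * N * Δ / (N / 3) ^ 3 := by
        gcongr
      have e4 : #U * (G * G) / (N - 2 * Δ) ^ 2 ≤ 2 * Δ / (N / 3) ^ 2 := by gcongr
      have e5 : 2 * Δ / (N / 3) ^ 2 ≤ 18 * (Δ / N) := by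
        rw [show 2 * Δ / (N / 3) ^ 2 = 18 * (Δ / N) / N by field_simp; ring]
        exact div_le_self (by positivity) hN0
      have e6 : N * Δ / (N / 3) ^ 2 = 9 * (Δ / N) := by field_simp; ring
      have e7 : Δ / (N / 3) = 3 * (Δ / N) := by field_simp
      have e8 : N * N * Δ / (N / 3) ^ 3 = 27 * (Δ / N) := by field_simp; ring
      linarith
    nlinarith [mul_le_mul_of_nonneg_right e hA0]
  · have hsw : Switchable A U (2 * (D + G * G)) := hA ▸ h.switchable hτ
    have := hsw.card_force_mul_le b ha (K := N - 2 * Δ) (by linarith)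
    rw [← le_div_iff₀ hK0] at this
    have e : N / (N - 2 * Δ) ≤ 1 + 6 * (Δ / N) := by
      rw [div_le_iff₀ hK0]
      have : (1 + 6 * (Δ / N)) * (N - 2 * Δ) = N + 4 * Δ - 12 * (Δ * (Δ / N)) := by
        field_simp; ring
      rw [this]
      have h3 : Δ / N ≤ 1 / 3 := by rw [div_le_iff₀ (by linarith)]; linarith
      nlinarith
    calc (#{M ∈ A | M a = b} : ℝ) * N ≤ #A / (N - 2 * Δ) * N := by gcongr
      _ = #A * (N / (N - 2 * Δ)) := by ring
      _ ≤ _ := by gcongr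

theorem abs_log_one_sub_add_le {p : ℝ} (h0 : 0 ≤ p) (h1 : p ≤ 1 / 2) :
    |Real.log (1 - p) + p| ≤ 2 * p ^ 2 := by
  have h := Real.abs_log_sub_add_sum_range_le (x := p) (by rw [abs_of_nonneg h0]; linarith) 1
  simp only [abs_of_nonneg h0] at h
  norm_num at h
  rw [add_comm]
  refine h.trans ?_
  rw [div_le_iff₀ (by linarith)]
  nlinarith [sq_nonneg p]

/-- If every successive restriction removes a fraction close to `q`, the logarithm of the number
of survivors decreases by about `q` each time. -/
theorem abs_log_sub_log_add_le {α : Type*} (F : Finset α) (f : Finset α → ℝ) {q η r : ℝ}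
    (hr : r ≤ 1 / 2) (h0 : 0 < f ∅)
    (hstep : ∀ T ⊆ F, ∀ e ∈ F, e ∉ T → 0 < f T →
      ∃ p, f (insert e T) = f T * (1 - p) ∧ |p - q| ≤ η ∧ 0 ≤ p ∧ p ≤ r) :
    0 < f F ∧ |Real.log (f F) - Real.log (f ∅) + #F * q| ≤ #F * (η + 2 * r ^ 2) := by
  refine Finset.induction_on' (motive := fun T => 0 < f T ∧
    |Real.log (f T) - Real.log (f ∅) + #T * q| ≤ #T * (η + 2 * r ^ 2)) F ⟨h0, by simp⟩ ?_
  rintro e T he hT heT ⟨hpos, ih⟩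
  obtain ⟨p, hp, hpq, hp0, hpr⟩ := hstep T hT e he heT hpos
  have h1 : 0 < 1 - p := by linarith
  refine ⟨by rw [hp]; positivity, ?_⟩
  have h2 := abs_log_one_sub_add_le hp0 (hpr.trans hr)
  have h3 : 2 * p ^ 2 ≤ 2 * r ^ 2 := by gcongr
  rw [hp, Real.log_mul hpos.ne' h1.ne', card_insert_of_notMem heT]
  push_cast
  rw [abs_le] at *
  constructor <;> linarith

theorem avoiding_insert_left (T₁ : Finset (V × V)) (T₂ : Finset ((V × V) × (V × V))) (e : V × V)
    [DecidableEq (V × V)] :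
    avoiding (insert e T₁) T₂ = {M ∈ avoiding T₁ T₂ | ¬ M e.1 = e.2} := by
  ext M
  simp only [avoiding, mem_filter, mem_univ, true_and, mem_insert, forall_eq_or_imp]
  tauto

theorem avoiding_insert_right (T₁ : Finset (V × V)) (T₂ : Finset ((V × V) × (V × V)))
    (f : (V × V) × (V × V)) [DecidableEq ((V × V) × (V × V))] :
    avoiding T₁ (insert f T₂) =
      {M ∈ avoiding T₁ T₂ | ¬ (M f.1.1 = f.1.2 ∧ M f.2.1 = f.2.2)} := by
  ext M
  simp only [avoiding, mem_filter, mem_univ, true_and, mem_insert, forall_eq_or_imp]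
  tauto

theorem card_filter_not_eq {α : Type*} {A : Finset α} (P : α → Prop) (hA : (0 : ℝ) < #A) :
    (#{M ∈ A | ¬ P M} : ℝ) = #A * (1 - #{M ∈ A | P M} / #A) := by
  have := card_filter_add_card_filter_not (s := A) P
  have h' : (#{M ∈ A | P M} : ℝ) + #{M ∈ A | ¬ P M} = #A := by exact_mod_cast this
  field_simp
  linarith

theorem log_card_avoiding_edges (hsymm : ∀ a b, Y a b → Y b a) (hY : ∀ a, #{c | Y a c} ≤ D)
    (F : Finset (V × V)) (hF : ∀ e ∈ F, Y e.1 e.2 ∧ e.1 ≠ e.2 ∧ (e.2, e.1) ∉ F)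
    {N Δ : ℝ} (hN : N = Fintype.card V) (hΔ : 9 + 2 * (D : ℝ) ≤ 2 * Δ) (hΔN : 3 * Δ ≤ N)
    (h0 : (0 : ℝ) < #(avoiding (V := V) ∅ ∅)) :
    (0 : ℝ) < #(avoiding F ∅) ∧
      |Real.log #(avoiding F ∅) - Real.log #(avoiding (V := V) ∅ ∅) + #F * (1 / N)| ≤
        #F * (57 * (Δ / N) / N + 2 * (3 / N) ^ 2) := by
  have hD : (0 : ℝ) ≤ D := by positivity
  have hN0 : 0 < N := by linarith
  refine abs_log_sub_log_add_le F (fun T => (#(avoiding T ∅) : ℝ)) ?_ h0 ?_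
  · rw [div_le_iff₀ hN0]; linarith
  intro T hT e he heT hpos
  have hfor : Forbidden (id : V → V) Y 1 D T ∅ :=
    { symm := hsymm
      degree_le := hY
      fiber_le := fun a => card_le_one.2 (by simp +contextual)
      single := fun e he => (hF e (hT he)).1
      parallel := by simp
      loopless := fun M hM p => by
        simp only [avoiding, mem_filter] at hM; exact hM.2.1.2 p }
  obtain ⟨lo, up⟩ := hfor.card_force_bounds (U := ∅) (τ := id) (A := avoiding T ∅) (a := e.1)
    (b := e.2) (by simp) (by simp) (by simp) (by simp) (hF e he).2.1 heT
    (fun h => (hF e he).2.2 (hT h)) (by simp) (by simp) hN (by push_cast; linarith) hΔN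
  refine ⟨#{M ∈ avoiding T ∅ | M e.1 = e.2} / #(avoiding T ∅), ?_, ?_, by positivity, ?_⟩
  · rw [avoiding_insert_left]
    exact card_filter_not_eq _ hpos
  · set x : ℝ := ((#{M ∈ avoiding T ∅ | M e.1 = e.2} : ℕ) : ℝ)
    set y : ℝ := ((#(avoiding T ∅) : ℕ) : ℝ)
    have e1 : x / y - 1 / N = (x * N / y - 1) / N := by field_simp
    rw [e1, abs_div, abs_of_pos hN0]
    gcongr
    have hd : 0 ≤ Δ / N := div_nonneg (by linarith) hN0.le
    rw [abs_le]
    constructor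
    · have : 1 - 57 * (Δ / N) ≤ x * N / y := by rw [le_div_iff₀ hpos]; linarith
      linarith
    · have : x * N / y ≤ 1 + 6 * (Δ / N) := by rw [div_le_iff₀ hpos]; linarith
      linarith
  · rw [div_le_div_iff₀ hpos hN0]
    refine up.trans ?_
    rw [mul_comm]
    gcongr
    have : Δ / N ≤ 1 / 3 := by rw [div_le_iff₀ hN0]; linarith
    linarith

theorem two_step_ratio_bounds {x w y N δ : ℝ} (hy : 0 < y) (hx : 0 ≤ x)
    (hN0 : 10 < N) (hd : 0 ≤ δ) (hd' : δ ≤ 1 / 3) (lo : y * (1 - 57 * δ) ≤ w * N)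
    (up : w * N ≤ y * (1 + 6 * δ)) (lo' : w * (1 - 57 * δ) ≤ x * N)
    (up' : x * N ≤ w * (1 + 6 * δ)) :
    |x / y - 1 / N ^ 2| ≤ 114 * δ / N ^ 2 ∧ x / y ≤ 9 / N ^ 2 := by
  have up2 : x * N ^ 2 ≤ y * (1 + 6 * δ) ^ 2 := by
    calc x * N ^ 2 = (x * N) * N := by ring
      _ ≤ (w * (1 + 6 * δ)) * N := by gcongr
      _ = (w * N) * (1 + 6 * δ) := by ring
      _ ≤ (y * (1 + 6 * δ)) * (1 + 6 * δ) := by gcongr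
      _ = _ := by ring
  constructor
  · have e1 : x / y - 1 / N ^ 2 = (x * N ^ 2 / y - 1) / N ^ 2 := by field_simp
    rw [e1, abs_div, abs_of_pos (show 0 < N ^ 2 by positivity)]
    gcongr
    rw [abs_le]
    constructor
    · have : 1 - 114 * δ ≤ x * N ^ 2 / y := by
        by_cases hs : 57 * δ ≤ 1
        · rw [le_div_iff₀ hy]
          calc (1 - 114 * δ) * y ≤ (1 - 57 * δ) ^ 2 * y := by
                gcongr; nlinarith
            _ = y * (1 - 57 * δ) * (1 - 57 * δ) := by ring
            _ ≤ w * N * (1 - 57 * δ) := by gcongr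
            _ = w * (1 - 57 * δ) * N := by ring
            _ ≤ x * N * N := by gcongr
            _ = _ := by ring
        · have : 0 ≤ x * N ^ 2 / y := by positivity
          linarith
      linarith
    · have : x * N ^ 2 / y ≤ (1 + 6 * δ) ^ 2 := by rw [div_le_iff₀ hy]; linarith
      nlinarith
  · rw [div_le_div_iff₀ hy (by positivity)]
    refine up2.trans ?_
    rw [mul_comm]
    gcongr
    nlinarith

theorem log_card_avoiding_pairs (F : Finset ((V × V) × (V × V)))
    (h : ∀ T ⊆ F, Forbidden κ Y G D T₁ T)
    (hF : ∀ f ∈ F, (f.1.1, f.1.2) ∉ T₁ ∧ (f.1.2, f.1.1) ∉ T₁ ∧ (f.2.1, f.2.2) ∉ T₁ ∧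
      (f.2.2, f.2.1) ∉ T₁)
    (hF' : ∀ f ∈ F, ∀ f' ∈ F,
      ¬ (s(f'.1.1, f'.1.2) = s(f.2.1, f.2.2) ∧ s(f'.2.1, f'.2.2) = s(f.1.1, f.1.2)) ∧
      (s(f'.2.1, f'.2.2) = s(f.2.1, f.2.2) ∧ s(f'.1.1, f'.1.2) = s(f.1.1, f.1.2) → f' = f))
    {N Δ : ℝ} (hN : N = Fintype.card V)
    (hΔ : 7 + 2 * ((D : ℝ) + G * G) ≤ 2 * Δ) (hΔN : 3 * Δ ≤ N)
    (h0 : (0 : ℝ) < #(avoiding T₁ ∅)) :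
    (0 : ℝ) < #(avoiding T₁ F) ∧
      |Real.log #(avoiding T₁ F) - Real.log #(avoiding T₁ ∅) + #F * (1 / N ^ 2)| ≤
        #F * (114 * (Δ / N) / N ^ 2 + 2 * (9 / N ^ 2) ^ 2) := by
  have hD : (0 : ℝ) ≤ D := by positivity
  have hG : (0 : ℝ) ≤ G * G := by positivity
  have hN0 : 10 < N := by linarith
  refine abs_log_sub_log_add_le F (fun T => (#(avoiding T₁ T) : ℝ)) ?_ h0 ?_
  · rw [div_le_iff₀ (by positivity)]; nlinarith
  rintro T hT ⟨⟨s, t⟩, ⟨a, b⟩⟩ he heT hpos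
  obtain ⟨p1, p2, p3, p4, p5⟩ := (h F subset_rfl).parallel _ he
  obtain ⟨q1, q2, q3, q4⟩ := hF _ he
  have hF'' := hF' _ he
  dsimp only at p1 p2 p3 p4 p5 q1 q2 q3 q4 hF''
  have hst : s ≠ t := fun e => p5 (by rw [e])
  have hab : a ≠ b := fun e => p5 (by rw [p1, p2, e])
  have hat : a ≠ t := fun e => p5 (by rw [p1, e])
  have hbs : b ≠ s := fun e => p5 (by rw [p2, e])
  obtain ⟨lo, up⟩ := (h T hT).card_force_bounds (U := ∅) (τ := id) (A := avoiding T₁ T) (a := s)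
    (b := t) (by simp) (by simp) (by simp) (by simp) hst q1 q2 (by simp) (by simp) hN hΔ hΔN
  obtain ⟨lo', up'⟩ := (h T hT).card_force_bounds (U := {s, t}) (τ := swap s t)
    (A := {M ∈ avoiding T₁ T | M s = t}) (a := a) (b := b) (by simp) (by
      ext M
      simp only [mem_filter, mem_insert, mem_singleton, forall_eq_or_imp, forall_eq,
        swap_apply_left, swap_apply_right]
      refine ⟨fun hM => ⟨hM.1, hM.2, ?_⟩, fun hM => ⟨hM.1, hM.2.1⟩⟩
      have hP := hM.1
      simp only [avoiding, mem_filter] at hP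
      rw [← hM.2, hP.2.1.1])
    (by simp [p3.symm, hat]) (by simp [p4.symm, hbs]) hab q3 q4 (by
      intro f hf u hu
      have hu' : s(u, swap s t u) = s(s, t) := by
        simp only [mem_insert, mem_singleton] at hu
        rcases hu with rfl | rfl
        · simp
        · simp [Sym2.eq_swap]
      rw [hu']
      refine ⟨(hF'' f (hT hf)).1, fun hc => heT ?_⟩
      rw [← (hF'' f (hT hf)).2 hc]
      exact hf) card_le_two hN hΔ hΔN
  rw [filter_filter] at lo' up'
  obtain ⟨r1, r2⟩ := two_step_ratio_bounds hpos (Nat.cast_nonneg _) hN0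
    (div_nonneg (by linarith) (by linarith))
    (by rw [div_le_iff₀ (by linarith)]; linarith) lo up lo' up'
  refine ⟨#{M ∈ avoiding T₁ T | M s = t ∧ M a = b} / #(avoiding T₁ T), ?_, r1, by positivity, r2⟩
  · rw [avoiding_insert_right]
    convert card_filter_not_eq (fun M : Perm V => M s = t ∧ M a = b) hpos

theorem isPerfectMatching_iff_cycleType {m : ℕ} (hm : Fintype.card V = 2 * m) (M : Perm V) :
    IsPerfectMatching M ↔ M.cycleType = Multiset.replicate m 2 := by
  have hpow : M ^ 2 = 1 ↔ ∀ v, M (M v) = v := by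
    rw [Perm.ext_iff]; simp [pow_two]
  have hsupp : M.support = univ ↔ ∀ v, M v ≠ v := by
    simp [Finset.ext_iff]
  rw [IsPerfectMatching, ← hpow, ← hsupp]
  constructor
  · rintro ⟨h1, h2⟩
    have h3 := Perm.cycleType_of_pow_prime_eq_one (p := 2) h1
    have h4 := M.sum_cycleType
    rw [h2, card_univ, hm, h3, Multiset.sum_replicate, smul_eq_mul] at h4
    rw [h3]
    congr 1
    omega
  · intro h
    have h4 := M.sum_cycleType
    rw [h, Multiset.sum_replicate, smul_eq_mul] at h4
    exact ⟨(Perm.pow_prime_eq_one_iff (p := 2)).2 (by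
        rw [h]; exact fun c => Multiset.eq_of_mem_replicate),
      card_eq_iff_eq_univ _ |>.1 (by omega)⟩

/-- The number of perfect matchings on `2 * m` points. -/
theorem card_avoiding_empty {m : ℕ} (hm : Fintype.card V = 2 * m) :
    (#(avoiding (V := V) ∅ ∅) : ℝ) = (2 * m).factorial / (m.factorial * 2 ^ m) := by
  have h : avoiding (V := V) ∅ ∅ =
      ({M | M.cycleType = Multiset.replicate m 2} : Finset (Perm V)) := by
    ext M; simp [avoiding, isPerfectMatching_iff_cycleType hm]
  have h2 := Perm.card_of_cycleType_mul_eq V (Multiset.replicate m 2)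
  rw [if_pos ⟨by simp [hm, mul_comm], by simp +contextual [Multiset.mem_replicate]⟩] at h2
  rw [eq_div_iff (by positivity), h]
  rw [hm] at h2
  have h3 : ∏ n ∈ (Multiset.replicate m 2).toFinset, ((Multiset.replicate m 2).count n).factorial =
      m.factorial := by
    rcases Nat.eq_zero_or_pos m with rfl | hm
    · simp
    · rw [Multiset.toFinset_replicate, if_neg hm.ne']; simp
  rw [h3] at h2
  simp only [Multiset.sum_replicate, smul_eq_mul, Multiset.prod_replicate, mul_comm m 2,
    Nat.sub_self, Nat.factorial_zero, one_mul] at h2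
  rw [← h2]
  push_cast
  rw [mul_comm (m.factorial : ℝ)]

end Switchings

section Graph

variable {n : ℕ} {g : Fin n → ℕ} {X : SimpleGraph (Fin n)}

/-- A matching of the points `⟨j, k⟩` that projects to a simple graph edge-disjoint from `X`. -/
structure IsSimple (X : SimpleGraph (Fin n)) (M : Perm (Σ j, Fin (g j))) : Prop where
  isPerfectMatching : IsPerfectMatching M
  ne : ∀ p, p.1 ≠ (M p).1
  not_adj : ∀ p, ¬ X.Adj p.1 (M p).1
  eq_of_parallel : ∀ p q, p.1 = q.1 → (M p).1 = (M q).1 → p = q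

/-- The graph onto which a matching projects. -/
def projection (M : Perm (Σ j, Fin (g j))) : SimpleGraph (Fin n) :=
  SimpleGraph.fromRel fun i j => ∃ p, p.1 = i ∧ (M p).1 = j

theorem IsSimple.projection_adj {M : Perm (Σ j, Fin (g j))} (hM : IsSimple X M) {i j : Fin n} :
    (projection M).Adj i j ↔ ∃ k, (M ⟨i, k⟩).1 = j := by
  rw [projection, SimpleGraph.fromRel_adj]
  constructor
  · rintro ⟨-, ⟨⟨i, k⟩, rfl, h⟩ | ⟨p, rfl, h⟩⟩
    · exact ⟨k, h⟩
    · subst h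
      exact ⟨(M p).2, by rw [Sigma.eta, hM.isPerfectMatching.1]⟩
  · rintro ⟨k, rfl⟩
    exact ⟨hM.ne ⟨i, k⟩, Or.inl ⟨_, rfl, rfl⟩⟩

/-- The labelling of the neighbours of `j` by the points over `j`. -/
noncomputable def IsSimple.labelling {M : Perm (Σ j, Fin (g j))} (hM : IsSimple X M)
    {H : SimpleGraph (Fin n)} (hH : projection M = H) (j : Fin n) :
    Fin (g j) ≃ H.neighborSet j :=
  Equiv.ofBijective (fun k => ⟨(M ⟨j, k⟩).1, by
    rw [SimpleGraph.mem_neighborSet, ← hH, hM.projection_adj]; exact ⟨k, rfl⟩⟩) <| by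
    constructor
    · intro k l h
      have := hM.eq_of_parallel ⟨j, k⟩ ⟨j, l⟩ rfl (congrArg Subtype.val h)
      simpa using this
    · rintro ⟨i, hi⟩
      rw [SimpleGraph.mem_neighborSet, ← hH, hM.projection_adj] at hi
      obtain ⟨k, hk⟩ := hi
      exact ⟨k, Subtype.ext hk⟩

/-- The matching determined by a labelling of the neighbours of every vertex. -/
def partner {H : SimpleGraph (Fin n)} (φ : ∀ j, Fin (g j) ≃ H.neighborSet j)
    (p : Σ j, Fin (g j)) : Σ j, Fin (g j) :=
  ⟨φ p.1 p.2, (φ (φ p.1 p.2)).symm ⟨p.1, (φ p.1 p.2).2.symm⟩⟩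

theorem partner_eq_iff {H : SimpleGraph (Fin n)} (φ : ∀ j, Fin (g j) ≃ H.neighborSet j)
    (p q : Σ j, Fin (g j)) :
    partner φ p = q ↔ (φ p.1 p.2 : Fin n) = q.1 ∧ (φ q.1 q.2 : Fin n) = p.1 := by
  constructor
  · rintro rfl
    exact ⟨rfl, congrArg Subtype.val ((φ (φ p.1 p.2)).apply_symm_apply ⟨p.1, _⟩)⟩
  · obtain ⟨i, l⟩ := q
    rintro ⟨h1, h2⟩
    dsimp only at h1 h2
    subst h1
    simp only [partner, Sigma.mk.injEq, heq_eq_eq, true_and]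
    rw [symm_apply_eq]
    exact Subtype.ext h2.symm

theorem partner_involutive {H : SimpleGraph (Fin n)} (φ : ∀ j, Fin (g j) ≃ H.neighborSet j) :
    Function.Involutive (partner φ) := fun p => by
  rw [partner_eq_iff, and_comm]
  exact (partner_eq_iff φ p _).1 rfl

theorem isSimple_partner {H : SimpleGraph (Fin n)} (hHX : Disjoint H X)
    (φ : ∀ j, Fin (g j) ≃ H.neighborSet j) :
    IsSimple X (partner_involutive φ).toPerm := by
  have hadj : ∀ p, H.Adj p.1 (partner φ p).1 := fun p => (φ p.1 p.2).2
  refine ⟨⟨partner_involutive φ, fun p h => ?_⟩, fun p => (hadj p).ne, fun p h => ?_, ?_⟩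
  · exact (hadj p).ne (congrArg Sigma.fst h).symm
  · exact (SimpleGraph.disjoint_left.1 hHX _ _ (hadj p)) h
  · rintro ⟨i, k⟩ ⟨j, l⟩ h1 h2
    dsimp only at h1
    subst h1
    have : k = l := (φ i).injective (Subtype.ext h2)
    rw [this]

theorem projection_partner {H : SimpleGraph (Fin n)} (hHX : Disjoint H X)
    (φ : ∀ j, Fin (g j) ≃ H.neighborSet j) : projection (partner_involutive φ).toPerm = H := by
  ext i j
  rw [(isSimple_partner hHX φ).projection_adj]
  constructor
  · rintro ⟨k, rfl⟩
    exact (φ i k).2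
  · intro h
    exact ⟨(φ i).symm ⟨j, h⟩, by simp [partner]⟩

theorem card_projection_eq {H : SimpleGraph (Fin n)} (hdeg : ∀ j, H.degree j = g j)
    (hHX : Disjoint H X) :
    #{M : Perm (Σ j, Fin (g j)) | IsSimple X M ∧ projection M = H} = ∏ j, (g j).factorial := by
  have e : {M : Perm (Σ j, Fin (g j)) // IsSimple X M ∧ projection M = H} ≃
      ∀ j, Fin (g j) ≃ H.neighborSet j :=
    Equiv.ofBijective (fun M => M.2.1.labelling M.2.2) <| by
      constructor
      · rintro ⟨M, hM, hMH⟩ ⟨M', hM', hMH'⟩ h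
        have h' : ∀ p, (M p).1 = (M' p).1 := fun p =>
          congrArg Subtype.val (DFunLike.congr_fun (congrFun h p.1) p.2)
        refine Subtype.ext (Equiv.ext fun p => ?_)
        refine hM.eq_of_parallel _ _ (h' p) ?_
        rw [hM.isPerfectMatching.1, h', hM'.isPerfectMatching.1]
      · intro φ
        refine ⟨⟨(partner_involutive φ).toPerm, isSimple_partner hHX φ,
          projection_partner hHX φ⟩, ?_⟩
        funext j
        ext k
        rfl
  rw [← Fintype.card_subtype, Fintype.card_congr e, Fintype.card_pi]
  refine prod_congr rfl fun j _ => ?_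
  rw [Fintype.card_equiv ((Fintype.equivFinOfCardEq
    ((SimpleGraph.card_neighborSet_eq_degree H j).trans (hdeg j))).symm), Fintype.card_fin]

/-- Each graph with degree sequence `g` is the projection of `∏ j, g j !` simple matchings. -/
theorem card_isSimple (g : Fin n → ℕ) (X : SimpleGraph (Fin n)) :
    #{M : Perm (Σ j, Fin (g j)) | IsSimple X M} =
      (Finset.univ.filter (fun H : SimpleGraph (Fin n) =>
        (∀ j, H.degree j = g j) ∧ Disjoint H X)).card * ∏ j, (g j).factorial := by
  rw [card_eq_sum_card_fiberwise (f := projection)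
    (t := Finset.univ.filter (fun H : SimpleGraph (Fin n) =>
        (∀ j, H.degree j = g j) ∧ Disjoint H X)), ← smul_eq_mul, ← sum_const]
  · refine sum_congr rfl fun H hH => ?_
    simp only [mem_filter, mem_univ, true_and] at hH
    rw [filter_filter]
    exact card_projection_eq hH.1 hH.2
  · intro M hM
    simp only [coe_filter, mem_univ, true_and, Set.mem_ofPred_eq] at hM ⊢
    refine ⟨fun j => ?_, SimpleGraph.disjoint_left.2 fun i j h => ?_⟩
    · rw [← SimpleGraph.card_neighborSet_eq_degree, ← Fintype.card_congr (hM.labelling rfl j),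
        Fintype.card_fin]
    · rw [hM.projection_adj] at h
      obtain ⟨k, rfl⟩ := h
      exact hM.not_adj ⟨i, k⟩

end Graph

section Defects

variable {n : ℕ} (g : Fin n → ℕ) (X : SimpleGraph (Fin n))

/-- Edges that are loops or that project to an edge of `X`. -/
noncomputable def badEdges : Finset ((Σ j, Fin (g j)) × (Σ j, Fin (g j))) :=
  {e | (e.1.1 = e.2.1 ∧ (e.1.2 : ℕ) < e.2.2) ∨ (e.1.1 < e.2.1 ∧ X.Adj e.1.1 e.2.1)}

/-- Pairs of parallel edges that are not bad on their own. -/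
noncomputable def badPairs : Finset (((Σ j, Fin (g j)) × (Σ j, Fin (g j))) ×
    ((Σ j, Fin (g j)) × (Σ j, Fin (g j)))) :=
  {f | (f.1.1.1 = f.2.1.1 ∧ (f.1.1.2 : ℕ) < f.2.1.2) ∧ (f.1.2.1 = f.2.2.1 ∧ f.1.2 ≠ f.2.2) ∧
    f.1.1.1 < f.1.2.1 ∧ ¬ X.Adj f.1.1.1 f.1.2.1}

/-- The relation underlying `badEdges`. -/
def IsBad (p q : Σ j, Fin (g j)) : Prop := p ≠ q ∧ (p.1 = q.1 ∨ X.Adj p.1 q.1)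

variable {g X}

theorem sigma_eq_of_val_eq {p q : Σ j, Fin (g j)} (h1 : p.1 = q.1) (h2 : (p.2 : ℕ) = q.2) :
    p = q := by
  obtain ⟨i, k⟩ := p
  obtain ⟨j, l⟩ := q
  dsimp only at h1
  subst h1
  exact congrArg _ (Fin.ext h2)

theorem fst_ne_and_not_adj_of_avoids {M : Perm (Σ j, Fin (g j))} (hM : IsPerfectMatching M)
    (h : ∀ e ∈ badEdges g X, M e.1 ≠ e.2) (p : Σ j, Fin (g j)) :
    p.1 ≠ (M p).1 ∧ ¬ X.Adj p.1 (M p).1 := by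
  simp only [badEdges, mem_filter, mem_univ, true_and, Prod.forall] at h
  constructor
  · intro hp
    rcases lt_trichotomy (p.2 : ℕ) (M p).2 with h1 | h1 | h1
    · exact h p (M p) (Or.inl ⟨hp, h1⟩) rfl
    · exact hM.2 p (sigma_eq_of_val_eq hp h1).symm
    · exact h (M p) p (Or.inl ⟨hp.symm, h1⟩) (hM.1 p)
  · intro hp
    rcases lt_trichotomy p.1 (M p).1 with h1 | h1 | h1
    · exact h p (M p) (Or.inr ⟨h1, hp⟩) rfl
    · exact hp.ne h1
    · exact h (M p) p (Or.inr ⟨h1, hp.symm⟩) (hM.1 p)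

theorem avoiding_badEdges_badPairs :
    avoiding (badEdges g X) (badPairs g X) =
      ({M | IsSimple X M} : Finset (Perm (Σ j, Fin (g j)))) := by
  ext M
  simp only [avoiding, mem_filter, mem_univ, true_and]
  constructor
  · rintro ⟨hM, h1, h2⟩
    have hne := fst_ne_and_not_adj_of_avoids hM h1
    have key : ∀ p q : Σ j, Fin (g j), p.1 = q.1 → (M p).1 = (M q).1 → (p.2 : ℕ) < q.2 →
        p.1 < (M p).1 → False := fun p q h3 h4 h5 h6 => by
      refine h2 ((p, M p), (q, M q)) ?_ rfl rfl
      simp only [badPairs, mem_filter, mem_univ, true_and]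
      refine ⟨⟨h3, h5⟩, ⟨h4, fun h => ?_⟩, h6, (hne p).2⟩
      rw [M.injective h] at h5
      exact h5.false
    have key' : ∀ p q : Σ j, Fin (g j), p.1 = q.1 → (M p).1 = (M q).1 → p.1 < (M p).1 →
        p = q := fun p q h3 h4 h5 => by
      rcases lt_trichotomy (p.2 : ℕ) q.2 with h6 | h6 | h6
      · exact (key p q h3 h4 h6 h5).elim
      · exact sigma_eq_of_val_eq h3 h6
      · exact (key q p h3.symm h4.symm h6 (by rwa [← h3, ← h4])).elim
    refine ⟨hM, fun p => (hne p).1, fun p => (hne p).2, fun p q h3 h4 => ?_⟩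
    rcases lt_or_gt_of_ne (hne p).1 with h5 | h5
    · exact key' p q h3 h4 h5
    · exact M.injective (key' (M p) (M q) h4 (by rw [hM.1, hM.1, h3]) (by rwa [hM.1]))
  · intro hM
    refine ⟨hM.isPerfectMatching, ?_, ?_⟩
    · rintro ⟨p, q⟩ he hp
      simp only [badEdges, mem_filter, mem_univ, true_and] at he hp
      subst hp
      rcases he with he | he
      · exact hM.ne _ he.1
      · exact hM.not_adj _ he.2
    · rintro ⟨⟨p, p'⟩, ⟨q, q'⟩⟩ hf hp hq
      simp only [badPairs, mem_filter, mem_univ, true_and] at hf hp hq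
      subst hp hq
      have := hM.eq_of_parallel p q hf.1.1 hf.2.1.1
      subst this
      exact hf.1.2.false

theorem card_fst_eq (i : Fin n) : #{c : Σ j, Fin (g j) | c.1 = i} = g i := by
  rw [← Fintype.card_subtype, Fintype.card_congr (Equiv.sigmaSubtype i), Fintype.card_fin]

theorem card_isBad_le {G x : ℕ} (hG : ∀ j, g j ≤ G) (hx : ∀ j, X.degree j ≤ x)
    (a : Σ j, Fin (g j)) : #{c | IsBad g X a c} ≤ (G - 1) + G * x := by
  have hsub : ({c | IsBad g X a c} : Finset (Σ j, Fin (g j))) ⊆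
      ({c | c.1 = a.1} : Finset (Σ j, Fin (g j))).erase a ∪
        (X.neighborFinset a.1).biUnion fun j => {c | c.1 = j} := by
    intro c hc
    replace hc := (mem_filter.1 hc).2
    simp only [mem_union, mem_erase, mem_filter, mem_univ, true_and, mem_biUnion,
      SimpleGraph.mem_neighborFinset]
    rcases hc with ⟨h1, h2 | h2⟩
    · exact Or.inl ⟨h1.symm, h2.symm⟩
    · exact Or.inr ⟨c.1, h2, rfl⟩
  refine (card_le_card hsub).trans ((card_union_le _ _).trans (add_le_add ?_ ?_))
  · rw [card_erase_of_mem (by simp), card_fst_eq]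
    exact Nat.sub_le_sub_right (hG _) 1
  · refine (card_biUnion_le_card_mul _ _ G fun j _ => (card_fst_eq j).trans_le (hG j)).trans ?_
    rw [SimpleGraph.card_neighborFinset_eq_degree, mul_comm]
    exact Nat.mul_le_mul_left _ (hx _)

theorem isBad_of_mem_badEdges {e : (Σ j, Fin (g j)) × (Σ j, Fin (g j))}
    (he : e ∈ badEdges g X) : IsBad g X e.1 e.2 ∧ e.1 ≠ e.2 ∧ (e.2, e.1) ∉ badEdges g X := by
  obtain ⟨p, q⟩ := e
  simp only [badEdges, mem_filter, mem_univ, true_and] at he ⊢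
  have hpq : p ≠ q := by
    rintro rfl
    rcases he with he | he
    · exact he.2.false
    · exact he.1.false
  refine ⟨⟨hpq, he.imp And.left And.right⟩, hpq, ?_⟩
  rcases he with he | he
  · rintro (h | h)
    · exact he.2.asymm h.2
    · exact h.1.ne he.1.symm
  · rintro (h | h)
    · exact he.1.ne h.1.symm
    · exact he.1.asymm h.1

theorem isBad_symm (a b : Σ j, Fin (g j)) (h : IsBad g X a b) : IsBad g X b a :=
  ⟨h.1.symm, h.2.imp Eq.symm fun h => h.symm⟩

theorem forbidden_badPairs {G x : ℕ} (hG : ∀ j, g j ≤ G) (hx : ∀ j, X.degree j ≤ x)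
    {T : Finset (((Σ j, Fin (g j)) × (Σ j, Fin (g j))) × ((Σ j, Fin (g j)) × (Σ j, Fin (g j))))}
    (hT : T ⊆ badPairs g X) :
    Forbidden Sigma.fst (IsBad g X) G ((G - 1) + G * x) (badEdges g X) T where
  symm := isBad_symm
  degree_le := card_isBad_le hG hx
  fiber_le a := by convert (card_fst_eq a.1).trans_le (hG _)
  single e he := (isBad_of_mem_badEdges he).1
  parallel f hf := by
    have := hT hf
    simp only [badPairs, mem_filter, mem_univ, true_and] at this
    obtain ⟨⟨h1, h2⟩, ⟨h3, h4⟩, h5, -⟩ := this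
    refine ⟨h1, h3, fun h => ?_, h4, h5.ne⟩
    rw [h] at h2
    exact h2.false
  loopless M hM p := by
    simp only [avoiding, mem_filter, mem_univ, true_and] at hM
    exact (fst_ne_and_not_adj_of_avoids hM.1 hM.2.1 p).1.symm

theorem eq_of_sym2_eq_of_fst_lt {a a' b b' : Σ j, Fin (g j)} (ha : a.1 < a'.1) (hb : b.1 < b'.1)
    (h : s(a, a') = s(b, b')) : a = b ∧ a' = b' := by
  rcases Sym2.eq_iff.1 h with h | ⟨rfl, rfl⟩
  · exact h
  · exact (ha.asymm hb).elim

theorem notMem_badEdges_of_mem_badPairs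
    {f : ((Σ j, Fin (g j)) × (Σ j, Fin (g j))) × ((Σ j, Fin (g j)) × (Σ j, Fin (g j)))}
    (hf : f ∈ badPairs g X) : (f.1.1, f.1.2) ∉ badEdges g X ∧ (f.1.2, f.1.1) ∉ badEdges g X ∧
      (f.2.1, f.2.2) ∉ badEdges g X ∧ (f.2.2, f.2.1) ∉ badEdges g X := by
  simp only [badPairs, mem_filter, mem_univ, true_and] at hf
  obtain ⟨⟨h1, -⟩, ⟨h2, -⟩, h3, h4⟩ := hf
  have aux : ∀ p q : Σ j, Fin (g j), p.1 < q.1 → ¬ X.Adj p.1 q.1 →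
      (p, q) ∉ badEdges g X ∧ (q, p) ∉ badEdges g X := fun p q hpq hX => by
    simp only [badEdges, mem_filter, mem_univ, true_and]
    exact ⟨fun h => h.elim (fun h => hpq.ne h.1) fun h => hX h.2,
      fun h => h.elim (fun h => hpq.ne h.1.symm) fun h => hX h.2.symm⟩
  have := aux _ _ h3 h4
  rw [h1, h2] at h3 h4
  exact ⟨this.1, this.2, aux _ _ h3 h4⟩

theorem badPairs_unique
    {f f' : ((Σ j, Fin (g j)) × (Σ j, Fin (g j))) × ((Σ j, Fin (g j)) × (Σ j, Fin (g j)))}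
    (hf : f ∈ badPairs g X) (hf' : f' ∈ badPairs g X) :
    ¬ (s(f'.1.1, f'.1.2) = s(f.2.1, f.2.2) ∧ s(f'.2.1, f'.2.2) = s(f.1.1, f.1.2)) ∧
      (s(f'.2.1, f'.2.2) = s(f.2.1, f.2.2) ∧ s(f'.1.1, f'.1.2) = s(f.1.1, f.1.2) → f' = f) := by
  obtain ⟨⟨p, p'⟩, ⟨q, q'⟩⟩ := f
  obtain ⟨⟨r, r'⟩, ⟨t, t'⟩⟩ := f'
  simp only [badPairs, mem_filter, mem_univ, true_and] at hf hf'
  obtain ⟨⟨h1, h2⟩, ⟨h3, h4⟩, h5, -⟩ := hf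
  obtain ⟨⟨k1, k2⟩, ⟨k3, k4⟩, k5, -⟩ := hf'
  have h5' : q.1 < q'.1 := by rwa [← h1, ← h3]
  have k5' : t.1 < t'.1 := by rwa [← k1, ← k3]
  dsimp only
  constructor
  · rintro ⟨e1, e2⟩
    obtain ⟨rfl, -⟩ := eq_of_sym2_eq_of_fst_lt k5 h5' e1
    obtain ⟨rfl, -⟩ := eq_of_sym2_eq_of_fst_lt k5' h5 e2
    exact h2.asymm k2
  · rintro ⟨e1, e2⟩
    obtain ⟨rfl, rfl⟩ := eq_of_sym2_eq_of_fst_lt k5 h5 e2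
    obtain ⟨rfl, rfl⟩ := eq_of_sym2_eq_of_fst_lt k5' h5' e1
    rfl

theorem card_badEdges_le {G x : ℕ} (hG : ∀ j, g j ≤ G) (hx : ∀ j, X.degree j ≤ x) :
    #(badEdges g X) ≤ Fintype.card (Σ j, Fin (g j)) * ((G - 1) + G * x) := by
  have hsub : badEdges g X ⊆ (univ : Finset (Σ j, Fin (g j))).biUnion fun p =>
      ({q | IsBad g X p q} : Finset (Σ j, Fin (g j))).image (Prod.mk p) := by
    intro e he
    simp only [mem_biUnion, mem_univ, true_and, mem_image, mem_filter]
    exact ⟨e.1, e.2, (isBad_of_mem_badEdges he).1, rfl⟩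
  exact (card_le_card hsub).trans <| card_biUnion_le_card_mul _ _ _ fun p _ =>
    card_image_le.trans (card_isBad_le hG hx p)

end Defects

section Counting

variable {n : ℕ} {g : Fin n → ℕ} {X : SimpleGraph (Fin n)}

theorem sum_fin_ite_ne (a : ℕ) :
    ∑ k : Fin a, ∑ l : Fin a, (if k ≠ l then (1 : ℝ) else 0) = a * (a - 1) := by
  have h : ∀ k l : Fin a, (if k ≠ l then (1 : ℝ) else 0) = 1 - if k = l then 1 else 0 := by
    intro k l; split_ifs <;> simp_all
  simp only [h, sum_sub_distrib, sum_ite_eq, mem_univ, if_true]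
  simp
  ring

theorem sum_fin_ite_lt (a : ℕ) :
    ∑ k : Fin a, ∑ l : Fin a, (if (k : ℕ) < l then (1 : ℝ) else 0) = a * (a - 1) / 2 := by
  have h1 : ∑ k : Fin a, ∑ l : Fin a, (if k ≠ l then (1 : ℝ) else 0) =
      ∑ k : Fin a, ∑ l : Fin a, (if (k : ℕ) < l then (1 : ℝ) else 0) +
      ∑ k : Fin a, ∑ l : Fin a, (if (l : ℕ) < k then (1 : ℝ) else 0) := by
    simp only [← sum_add_distrib]
    refine sum_congr rfl fun k _ => sum_congr rfl fun l _ => ?_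
    rcases lt_trichotomy k l with h | rfl | h
    · simp [h.ne, h, h.le]
    · simp
    · simp [h.ne', h, h.le]
  rw [sum_comm (f := fun k l : Fin a => if (l : ℕ) < k then (1 : ℝ) else 0), sum_fin_ite_ne] at h1
  linarith

theorem sum_sigma_fin (f : (Σ j, Fin (g j)) → ℝ) : ∑ p, f p = ∑ j, ∑ k : Fin (g j), f ⟨j, k⟩ :=
  Fintype.sum_sigma f

theorem sum_ite_fst_eq (i : Fin n) (P : (Σ j, Fin (g j)) → Prop) [DecidablePred P] :
    ∑ q : Σ j, Fin (g j), (if i = q.1 ∧ P q then (1 : ℝ) else 0) =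
      ∑ l : Fin (g i), if P ⟨i, l⟩ then (1 : ℝ) else 0 := by
  rw [sum_sigma_fin, sum_eq_single i]
  · simp
  · intro j _ hj
    simp [hj.symm]
  · simp

theorem card_badEdges : (#(badEdges g X) : ℝ) = ∑ i, (g i : ℝ) * (g i - 1) / 2 +
    ∑ i, ∑ j, if i < j ∧ X.Adj i j then (g i : ℝ) * g j else 0 := by
  have h : ∀ p q : Σ j, Fin (g j), (if (p.1 = q.1 ∧ (p.2 : ℕ) < q.2) ∨ (p.1 < q.1 ∧ X.Adj p.1 q.1)
      then (1 : ℝ) else 0) = (if p.1 = q.1 ∧ (p.2 : ℕ) < q.2 then (1 : ℝ) else 0) +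
      if p.1 < q.1 ∧ X.Adj p.1 q.1 then (1 : ℝ) else 0 := fun p q => by
    by_cases h : p.1 = q.1
    · simp [h]
    · simp [h]
  have h' : ∀ i, ∑ q : Σ j, Fin (g j), (if i < q.1 ∧ X.Adj i q.1 then (1 : ℝ) else 0) =
      ∑ j, if i < j ∧ X.Adj i j then (g j : ℝ) else 0 := fun i => by
    rw [sum_sigma_fin]
    refine sum_congr rfl fun j _ => ?_
    by_cases h : i < j ∧ X.Adj i j
    · simp [h]
    · simp only [h, if_false, sum_const_zero]
  rw [badEdges, card_filter]
  push_cast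
  rw [Fintype.sum_prod_type]
  simp only [h, sum_add_distrib]
  congr 1
  · rw [sum_sigma_fin]
    refine sum_congr rfl fun i _ => ?_
    rw [← sum_fin_ite_lt]
    exact sum_congr rfl fun k _ => sum_ite_fst_eq i fun q => (k : ℕ) < q.2
  · rw [sum_sigma_fin]
    refine sum_congr rfl fun i _ => (sum_congr rfl fun k _ => h' i).trans ?_
    rw [sum_const, card_univ, Fintype.card_fin, nsmul_eq_mul, mul_sum]
    refine sum_congr rfl fun j _ => ?_
    split_ifs <;> simp

theorem card_badPairs : (#(badPairs g X) : ℝ) = ∑ i, ∑ j, if i < j ∧ ¬ X.Adj i j then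
    (g i : ℝ) * (g i - 1) / 2 * (g j * (g j - 1)) else 0 := by
  rw [badPairs, card_filter]
  push_cast
  simp only [Fintype.sum_prod_type]
  have h : ∀ p p' q q' : Σ j, Fin (g j),
      (if (p.1 = q.1 ∧ (p.2 : ℕ) < q.2) ∧ (p'.1 = q'.1 ∧ p' ≠ q') ∧ p.1 < p'.1 ∧ ¬ X.Adj p.1 p'.1
        then (1 : ℝ) else 0) = (if p.1 < p'.1 ∧ ¬ X.Adj p.1 p'.1 then (1 : ℝ) else 0) *
        ((if p.1 = q.1 ∧ (p.2 : ℕ) < q.2 then (1 : ℝ) else 0) *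
          if p'.1 = q'.1 ∧ p' ≠ q' then (1 : ℝ) else 0) := fun p p' q q' => by
    by_cases h1 : p.1 = q.1 ∧ (p.2 : ℕ) < q.2
    · by_cases h2 : p'.1 = q'.1 ∧ p' ≠ q'
      · rw [if_pos h1, if_pos h2, mul_one, mul_one]
        exact if_congr ⟨fun h => h.2.2, fun h => ⟨h1, h2, h⟩⟩ rfl rfl
      · rw [if_neg h2, if_neg fun h => h2 h.2.1, mul_zero, mul_zero]
    · rw [if_neg h1, if_neg fun h => h1 h.1, zero_mul, mul_zero]
  have h1 : ∀ i, ∑ k : Fin (g i), ∑ q : Σ j, Fin (g j),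
      (if i = q.1 ∧ (k : ℕ) < q.2 then (1 : ℝ) else 0) = g i * (g i - 1) / 2 := fun i => by
    rw [← sum_fin_ite_lt]
    exact sum_congr rfl fun k _ => sum_ite_fst_eq i fun q => (k : ℕ) < q.2
  have h2 : ∀ i, ∑ k : Fin (g i), ∑ q : Σ j, Fin (g j),
      (if i = q.1 ∧ (⟨i, k⟩ : Σ j, Fin (g j)) ≠ q then (1 : ℝ) else 0) = g i * (g i - 1) :=
    fun i => by
      rw [← sum_fin_ite_ne]
      refine sum_congr rfl fun k _ => (sum_ite_fst_eq i fun q => ⟨i, k⟩ ≠ q).trans ?_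
      simp
  have key : ∀ {a b : ℕ} (c : ℝ) (A : Fin a → ℝ) (B : Fin b → ℝ),
      ∑ k, ∑ l, c * (A k * B l) = c * ((∑ k, A k) * ∑ l, B l) := fun c A B => by
    rw [sum_mul_sum, mul_sum]
    simp only [mul_sum]
  simp only [h, ← mul_sum, ← sum_mul]
  rw [sum_sigma_fin]
  refine sum_congr rfl fun i _ => ?_
  rw [sum_congr rfl fun k _ => sum_sigma_fin _, sum_comm]
  refine sum_congr rfl fun j _ => ?_
  refine (key (if i < j ∧ ¬ X.Adj i j then (1 : ℝ) else 0)
    (fun k => ∑ q : Σ j, Fin (g j), if i = q.1 ∧ (k : ℕ) < q.2 then (1 : ℝ) else 0)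
    (fun l => ∑ q : Σ j, Fin (g j),
      if j = q.1 ∧ (⟨j, l⟩ : Σ j, Fin (g j)) ≠ q then (1 : ℝ) else 0)).trans ?_
  rw [h1 i, h2 j]
  simp only [ite_mul, one_mul, zero_mul]

theorem sum_edgeFinset_eq (f : Fin n → Fin n → ℝ) (hf : ∀ i j, f i j = f j i) :
    ∑ e ∈ X.edgeFinset, Sym2.lift ⟨f, hf⟩ e = ∑ i, ∑ j, if i < j ∧ X.Adj i j then f i j else 0 := by
  rw [← Fintype.sum_prod_type' (f := fun i j => if i < j ∧ X.Adj i j then f i j else 0),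
    ← sum_filter]
  symm
  refine sum_nbij (fun p => s(p.1, p.2)) ?_ ?_ ?_ ?_
  · rintro ⟨i, j⟩ h
    simpa using (mem_filter.1 h).2.2
  · rintro ⟨i, j⟩ h ⟨k, l⟩ h' e
    have a1 := (mem_filter.1 (mem_coe.1 h)).2.1
    have a2 := (mem_filter.1 (mem_coe.1 h')).2.1
    dsimp only at a1 a2 e
    rcases Sym2.eq_iff.1 e with ⟨rfl, rfl⟩ | ⟨rfl, rfl⟩
    · rfl
    · exact (a1.asymm a2).elim
  · intro e he
    induction e using Sym2.ind with
    | _ i j =>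
      have he' : X.Adj i j := by simpa using he
      rcases lt_or_gt_of_ne he'.ne with h | h
      · exact ⟨(i, j), by simp [h, he'], rfl⟩
      · exact ⟨(j, i), by simp [h, he'.symm], Sym2.eq_swap⟩
  · rintro ⟨i, j⟩ -
    simp

theorem two_mul_sum_lt (R : Fin n → Fin n → Prop) [∀ i j, Decidable (R i j)]
    (hR : ∀ i j, R i j → R j i)
    (f : Fin n → Fin n → ℝ) (hf : ∀ i j, f i j = f j i) :
    2 * ∑ i, ∑ j, (if i < j ∧ R i j then f i j else 0) =
      ∑ i, ∑ j, if i ≠ j ∧ R i j then f i j else 0 := by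
  rw [two_mul]
  nth_rw 2 [sum_comm]
  simp only [← sum_add_distrib]
  refine sum_congr rfl fun i _ => sum_congr rfl fun j _ => ?_
  have hiff : R i j ↔ R j i := ⟨hR i j, hR j i⟩
  rcases lt_trichotomy i j with h | rfl | h
  · simp [h, h.ne, h.not_gt]
  · simp
  · simp [h, h.ne', h.not_gt, hiff, hf i j]

theorem card_badPairs_bounds {G x : ℕ} (hG : ∀ j, g j ≤ G) (hx : ∀ j, X.degree j ≤ x) {W : ℝ}
    (hW : W = ∑ i, (g i : ℝ) * (g i - 1)) {N : ℝ} (hN : N = ∑ i, (g i : ℝ)) :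
    4 * (#(badPairs g X) : ℝ) ≤ W ^ 2 ∧
      W ^ 2 - 4 * #(badPairs g X) ≤ G ^ 3 * (1 + x) * N ∧ 0 ≤ W ∧ W ≤ G * N := by
  set w : Fin n → ℝ := fun i => (g i : ℝ) * (g i - 1) with hw
  have hG' : ∀ i, (g i : ℝ) ≤ G := fun i => by exact_mod_cast hG i
  have hg0 : ∀ i, (0 : ℝ) ≤ g i := fun i => Nat.cast_nonneg _
  have hw0 : ∀ i, 0 ≤ w i := fun i => by
    rcases Nat.eq_zero_or_pos (g i) with h | h
    · simp [hw, h]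
    · have : (1 : ℝ) ≤ g i := by exact_mod_cast h
      exact mul_nonneg (hg0 i) (by linarith)
  have hw1 : ∀ i, w i ≤ G * g i := fun i => by
    have := hG' i
    have := hg0 i
    simp only [hw]; nlinarith
  have hw2 : ∀ i, w i ≤ G ^ 2 := fun i => (hw1 i).trans (by rw [pow_two]; gcongr; exact hG i)
  have hcard : 4 * (#(badPairs g X) : ℝ) =
      ∑ i, ∑ j, if i ≠ j ∧ ¬ X.Adj i j then w i * w j else 0 := by
    rw [← two_mul_sum_lt (fun i j => ¬ X.Adj i j) (fun i j h h' => h h'.symm)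
      (fun i j => w i * w j)
      (fun i j => mul_comm _ _), card_badPairs]
    rw [show (4 : ℝ) = 2 * 2 by norm_num, mul_assoc]
    congr 1
    simp only [mul_sum]
    refine sum_congr rfl fun i _ => sum_congr rfl fun j _ => ?_
    split_ifs
    · simp only [hw]; ring
    · simp
  have hsq : W ^ 2 = ∑ i, ∑ j, w i * w j := by
    rw [hW, pow_two, sum_mul_sum]
  refine ⟨?_, ?_, ?_, ?_⟩
  · rw [hcard, hsq]
    refine sum_le_sum fun i _ => sum_le_sum fun j _ => ?_
    split_ifs
    · rfl
    · exact mul_nonneg (hw0 i) (hw0 j)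
  · rw [hcard, hsq, ← sum_sub_distrib, hN, mul_sum]
    refine sum_le_sum fun i _ => ?_
    rw [← sum_sub_distrib]
    calc ∑ j, (w i * w j - if i ≠ j ∧ ¬ X.Adj i j then w i * w j else 0)
        ≤ ∑ j, ((if i = j then (G : ℝ) * g i * G ^ 2 else 0) +
            if X.Adj i j then (G : ℝ) * g i * G ^ 2 else 0) := by
          refine sum_le_sum fun j _ => ?_
          have hb : w i * w j ≤ G * g i * G ^ 2 :=
            mul_le_mul (hw1 i) (hw2 j) (hw0 j) (mul_nonneg (Nat.cast_nonneg _) (hg0 i))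
          have hb0 := mul_nonneg (hw0 i) (hw0 j)
          by_cases h1 : i = j
          · by_cases h2 : X.Adj i j
            · exact (h2.ne h1).elim
            · simpa [h1] using h1 ▸ hb
          · by_cases h2 : X.Adj i j
            · simpa [h1, h2] using hb
            · simp [h1, h2]
      _ = (G : ℝ) * g i * G ^ 2 * (1 + X.degree i) := by
          rw [sum_add_distrib, sum_ite_eq, if_pos (mem_univ _), ← sum_filter, sum_const,
            ← SimpleGraph.card_neighborFinset_eq_degree, SimpleGraph.neighborFinset_eq_filter,
            nsmul_eq_mul]
          ring
      _ ≤ (G : ℝ) * g i * G ^ 2 * (1 + x) := by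
          gcongr
          exact hx i
      _ = _ := by ring
  · rw [hW]; exact sum_nonneg fun i _ => hw0 i
  · rw [hW, hN, mul_sum]; exact sum_le_sum fun i _ => hw1 i

end Counting

theorem edges_error_le {k N Δ : ℝ} (hN : 0 < N) (hΔ : 1 ≤ Δ) (hk : k ≤ N * Δ) :
    k * (57 * (Δ / N) / N + 2 * (3 / N) ^ 2) ≤ 75 * (Δ ^ 2 / N) := by
  calc k * (57 * (Δ / N) / N + 2 * (3 / N) ^ 2)
      ≤ N * Δ * (57 * (Δ / N) / N + 2 * (3 / N) ^ 2) := by gcongr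
    _ = Δ * (57 * Δ + 18) / N := by field_simp; ring
    _ ≤ 75 * Δ ^ 2 / N := div_le_div_of_nonneg_right (by nlinarith) hN.le
    _ = _ := by ring

theorem pairs_error_le {k N Δ : ℝ} (hN : 1 ≤ N) (hΔ : 1 ≤ Δ) (hk : k ≤ N ^ 2 * Δ) :
    k * (114 * (Δ / N) / N ^ 2 + 2 * (9 / N ^ 2) ^ 2) ≤ 276 * (Δ ^ 2 / N) := by
  calc k * (114 * (Δ / N) / N ^ 2 + 2 * (9 / N ^ 2) ^ 2)
      ≤ N ^ 2 * Δ * (114 * (Δ / N) / N ^ 2 + 2 * (9 / N ^ 2) ^ 2) := by gcongr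
    _ = Δ * (114 * Δ + 162 / N) / N := by field_simp; ring
    _ ≤ Δ * (114 * Δ + 162) / N := by
        gcongr
        exact div_le_self (by norm_num) hN
    _ ≤ 276 * Δ ^ 2 / N := div_le_div_of_nonneg_right (by nlinarith) (by linarith)
    _ = _ := by ring

theorem pairs_mean_error_le {W K N Δ c : ℝ} (hN : 0 < N) (hc : c ≤ Δ ^ 2)
    (hK : 0 ≤ W ^ 2 - 4 * K) (hK' : W ^ 2 - 4 * K ≤ 4 * (c * N)) :
    |(W / (2 * N)) ^ 2 - K * (1 / N ^ 2)| ≤ Δ ^ 2 / N := by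
  have h1 : (W / (2 * N)) ^ 2 - K * (1 / N ^ 2) = (W ^ 2 - 4 * K) / (4 * N ^ 2) := by
    field_simp; ring
  rw [h1, abs_of_nonneg (div_nonneg hK (by positivity))]
  calc (W ^ 2 - 4 * K) / (4 * N ^ 2) ≤ 4 * (Δ ^ 2 * N) / (4 * N ^ 2) := by
        gcongr
        exact hK'.trans (by gcongr)
    _ = Δ ^ 2 / N := by field_simp

theorem delta_bounds {G x Δ : ℝ} (hG : 1 ≤ G) (hx : 0 ≤ x)
    (hΔ : Δ = 2 + G * ((3 / 2) * G + x + 1)) :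
    1 ≤ Δ ∧ 9 + 2 * (G - 1 + G * x) ≤ 2 * Δ ∧
      7 + 2 * (G - 1 + G * x + G * G) ≤ 2 * Δ ∧ G - 1 + G * x ≤ Δ ∧ G ^ 2 ≤ Δ ∧
      G ^ 3 * (1 + x) ≤ Δ ^ 2 := by
  have hGx : 0 ≤ G * x := by positivity
  have hGG : 1 ≤ G * G := by nlinarith
  have hΔ' : Δ = 2 + (3 / 2) * (G * G) + G * x + G := by rw [hΔ]; ring
  have h0 : 1 ≤ Δ := by linarith
  have h1 : G * G ≤ Δ := by linarith
  have h2 : G * (1 + x) ≤ Δ := by linarith [mul_add G 1 x]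
  refine ⟨h0, by linarith, by linarith, by linarith, by linarith [sq G], ?_⟩
  calc G ^ 3 * (1 + x) = (G * G) * (G * (1 + x)) := by ring
    _ ≤ Δ * Δ := by gcongr
    _ = Δ ^ 2 := by ring

variable {n : ℕ} {g : Fin n → ℕ} {X : SimpleGraph (Fin n)}

theorem log_card_isSimple_bounds {G x : ℕ} (hG : ∀ j, g j ≤ G) (hG1 : 1 ≤ G)
    (hx : ∀ j, X.degree j ≤ x) {N Δ W : ℝ} (hN : N = ∑ j, (g j : ℝ))
    (hΔ : Δ = 2 + G * ((3 / 2) * G + x + 1)) (hΔN : 3 * Δ ≤ N)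
    (hW : W = ∑ i, (g i : ℝ) * (g i - 1))
    (h0 : (0 : ℝ) < #(avoiding (V := Σ j, Fin (g j)) ∅ ∅)) :
    (0 : ℝ) < #{M : Perm (Σ j, Fin (g j)) | IsSimple X M} ∧
    |Real.log #{M : Perm (Σ j, Fin (g j)) | IsSimple X M} -
        Real.log #(avoiding (V := Σ j, Fin (g j)) ∅ ∅) +
        (#(badEdges g X) / N + (W / (2 * N)) ^ 2)| ≤ 352 * (Δ ^ 2 / N) := by
  obtain ⟨hΔ1, hΔe, hΔp, hDΔ, hGΔ, hGxΔ⟩ :=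
    delta_bounds (by exact_mod_cast hG1) (Nat.cast_nonneg x) hΔ
  have hV : N = Fintype.card (Σ j, Fin (g j)) := by simp [hN]
  have hD : (((G - 1) + G * x : ℕ) : ℝ) = G - 1 + G * x := by
    push_cast [Nat.cast_sub hG1]; ring
  have hN1 : 1 ≤ N := by linarith
  have hN0 : 0 < N := by linarith
  obtain ⟨p1, b1⟩ := log_card_avoiding_edges isBad_symm (card_isBad_le hG hx) (badEdges g X)
    (fun e he => isBad_of_mem_badEdges he) hV (Δ := Δ) (by rwa [hD]) hΔN h0
  obtain ⟨p2, b2⟩ := log_card_avoiding_pairs (badPairs g X)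
    (fun T hT => forbidden_badPairs hG hx hT) (fun f hf => notMem_badEdges_of_mem_badPairs hf)
    (fun f hf f' hf' => badPairs_unique hf hf') hV (Δ := Δ) (by rwa [hD]) hΔN p1
  rw [avoiding_badEdges_badPairs] at p2 b2
  refine ⟨p2, ?_⟩
  obtain ⟨c1, c2, c3, c4⟩ := card_badPairs_bounds (X := X) hG hx hW hN
  have d1 : (#(badEdges g X) : ℝ) ≤ N * Δ := by
    have h1 : (#(badEdges g X) : ℝ) ≤ N * ((G - 1) + G * x : ℕ) := by
      rw [hV]; exact_mod_cast card_badEdges_le hG hx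
    rw [hD] at h1
    exact h1.trans (by gcongr)
  have d2 : (#(badPairs g X) : ℝ) ≤ N ^ 2 * Δ := by
    have h1 : (#(badPairs g X) : ℝ) ≤ W ^ 2 := by
      linarith [show (0 : ℝ) ≤ #(badPairs g X) from Nat.cast_nonneg _]
    calc (#(badPairs g X) : ℝ) ≤ (G * N) ^ 2 := h1.trans (by gcongr)
      _ = N ^ 2 * G ^ 2 := by ring
      _ ≤ N ^ 2 * Δ := by gcongr
  have e1 := b1.trans (edges_error_le hN0 hΔ1 d1)
  have e2 := b2.trans (pairs_error_le hN1 hΔ1 d2)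
  have e3 := pairs_mean_error_le (K := #(badPairs g X)) hN0 hGxΔ (by linarith)
    (c2.trans (le_mul_of_one_le_left (by positivity) (by norm_num)))
  have e4 : (#(badEdges g X) : ℝ) * (1 / N) = #(badEdges g X) / N := by ring
  rw [e4] at e1
  rw [abs_le] at e1 e2 e3 ⊢
  constructor <;> linarith

end McKay

theorem mckay_edge_disjoint_count :
    ∀ ε₁ : ℝ, ε₁ < 2 / 3 →
    ∃ C : ℝ, 0 < C ∧ ∀ n : ℕ, ∀ g : Fin n → ℕ, ∀ X : SimpleGraph (Fin n),
      Even (∑ j, g j) →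
      1 ≤ Finset.univ.sup g →
      ∀ m : ℕ, ∀ gmax xmax Δ lam μ : ℝ,
      m = (∑ j, g j) / 2 →
      gmax = (Finset.univ.sup g : ℕ) →
      xmax = (Finset.univ.sup (fun j => X.degree j) : ℕ) →
      Δ = 2 + gmax * ((3 / 2) * gmax + xmax + 1) →
      lam = (∑ j, (g j : ℝ) * ((g j : ℝ) - 1)) / (4 * m) →
      μ = (∑ e ∈ X.edgeFinset,
            Sym2.lift ⟨fun i j => (g i : ℝ) * (g j : ℝ), fun i j => by ring⟩ e) / (2 * m) →
      Δ ≤ ε₁ * m →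
      ∃ E : ℝ,
        |E| ≤ C * Δ ^ 2 / m ∧
        ((Finset.univ.filter (fun H : SimpleGraph (Fin n) =>
            (∀ j, H.degree j = g j) ∧ Disjoint H X)).card : ℝ)
          = ((Nat.factorial (2 * m) : ℝ) /
              ((Nat.factorial m : ℝ) * 2 ^ m * ∏ j, (Nat.factorial (g j) : ℝ))) *
            Real.exp (-lam - lam ^ 2 - μ + E) := by
  intro ε₁ hε
  refine ⟨176, by norm_num, ?_⟩
  intro n g X heven hg1 m gmax xmax Δ lam μ hm hgmax hxmax hΔ hlam hμ hΔm
  have hsum : ∑ j, g j = 2 * m := by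
    rw [hm, Nat.mul_div_cancel' heven.two_dvd]
  have hsum' : ((2 * m : ℕ) : ℝ) = ∑ j, (g j : ℝ) := by
    rw [← hsum]; push_cast; rfl
  have hcardV : Fintype.card (Σ j, Fin (g j)) = 2 * m := by simp [hsum]
  have hall := McKay.card_avoiding_empty hcardV
  have hall0 : (0 : ℝ) < (McKay.avoiding (V := Σ j, Fin (g j)) ∅ ∅).card := by
    rw [hall]; positivity
  have hΔ2 : 2 ≤ Δ := by rw [hΔ, hgmax, hxmax]; linarith [show (0 : ℝ) ≤
    (Finset.univ.sup g : ℕ) * ((3 / 2) * (Finset.univ.sup g : ℕ) +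
      (Finset.univ.sup (fun j => X.degree j) : ℕ) + 1) by positivity]
  have hΔN : 3 * Δ ≤ ((2 * m : ℕ) : ℝ) := by
    push_cast
    nlinarith [show (0 : ℝ) ≤ m from Nat.cast_nonneg _]
  have hm0 : (0 : ℝ) < m := by push_cast at hΔN; linarith
  subst hgmax hxmax
  obtain ⟨hpos, hbound⟩ := McKay.log_card_isSimple_bounds (X := X) (g := g)
    (fun j => Finset.le_sup (Finset.mem_univ j)) hg1
    (fun j => Finset.le_sup (f := fun j => X.degree j) (Finset.mem_univ j)) hsum' hΔ hΔN rfl hall0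
  have hmain : lam + μ = (McKay.badEdges g X).card / ((2 * m : ℕ) : ℝ) := by
    rw [McKay.card_badEdges, hlam, hμ, McKay.sum_edgeFinset_eq, ← Finset.sum_div]
    push_cast
    field_simp
    ring
  have hlam' : lam = (∑ j, (g j : ℝ) * ((g j : ℝ) - 1)) / (2 * ((2 * m : ℕ) : ℝ)) := by
    rw [hlam]; push_cast; ring
  rw [← hmain, ← hlam'] at hbound
  refine ⟨_, hbound.trans_eq (by push_cast; field_simp; norm_num), ?_⟩
  have hcount := McKay.card_isSimple g X
  have hprod : (0 : ℝ) < ∏ j, (Nat.factorial (g j) : ℝ) :=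
    Finset.prod_pos fun j _ => by positivity
  rw [← div_div, ← hall, div_mul_eq_mul_div, eq_div_iff hprod.ne']
  rw [show ∀ a b : ℝ, -lam - lam ^ 2 - μ + (a - b + (lam + μ + lam ^ 2)) = a - b by intros; ring,
    Real.exp_sub, Real.exp_log hpos, Real.exp_log hall0, mul_div_cancel₀ _ hall0.ne', hcount]
  push_cast
  rfl
end

section
/- There exist absolute constants C > 0 and N_0 such that the following holds for all n ≥ N_0. Let (d_1,…,d_n) be positive integers with even sum such that d_max^4 ≤ (d−2)n, let x = (x_1,…,x_n) be a suitable degree sequence, and let T be a tree on {1,…,n} with degree sequence x. Then the probability P(d,T) that a uniformly random graph in Γ_d contains T as a subgraph satisfies P(d,T) = ( (dn/2)_{n−1} · 2^{n−1} / (dn)_{2n−2} ) · ( ∏_{j=1}^n (d_j)_{x_j} ) · exp( λ₀ + λ₀² − λ(x) − λ(x)² − μ(T) + E ), where |E| ≤ C·d_max^4/((d−2)n). -/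
attribute [local instance] Classical.propDecidable

namespace TreeProb

open Equiv Finset

section Switching

variable {P V : Type*}

/-- A pairing of `P`, encoded as a fixed-point-free involution. -/
def IsPairing (σ : Perm P) : Prop := (∀ p, σ (σ p) = p) ∧ ∀ p, σ p ≠ p

/-- The pairing `σ` contains every pair listed in `A`. -/
def Hits (σ : Perm P) (A : List (P × P)) : Prop := ∀ x ∈ A, σ x.1 = x.2

/-- The points occurring in the pairs of `A`. -/
noncomputable def pts (A : List (P × P)) : Finset P :=
  (A.map Prod.fst).toFinset ∪ (A.map Prod.snd).toFinset

/-- The pair `p, q` projects to a loop or to an edge of `X`. -/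
def Illegal (π : P → V) (X : SimpleGraph V) (p q : P) : Prop :=
  π p = π q ∨ X.Adj (π p) (π q)

def IsSingle (π : P → V) (X : SimpleGraph V) (e : List (P × P)) : Prop :=
  ∃ p q, e = [(p, q)] ∧ p ≠ q ∧ Illegal π X p q

def IsDouble (π : P → V) (X : SimpleGraph V) (e : List (P × P)) : Prop :=
  ∃ p q p' q', e = [(p, q), (p', q')] ∧ p ≠ p' ∧ q ≠ q' ∧ π p = π p' ∧ π q = π q' ∧
    ¬ Illegal π X p q

/-- Admissible families of forbidden events: double edges may only be forbidden once loops are. -/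
def Admissible (π : P → V) (X : SimpleGraph V) (F : Finset (List (P × P))) : Prop :=
  (∀ e ∈ F, IsSingle π X e ∨ IsDouble π X e) ∧
  ((∀ e ∈ F, IsSingle π X e) ∨ ∀ p q, p ≠ q → π p = π q → [(p, q)] ∈ F ∨ [(q, p)] ∈ F)

/-- The switching that exchanges the partners of `q` and `b`. -/
noncomputable def switch (σ : Perm P) (q b : P) : Perm P := swap q b * σ * swap q b

lemma mem_pts {A : List (P × P)} {p : P} : p ∈ pts A ↔ ∃ x ∈ A, x.1 = p ∨ x.2 = p := by
  simp only [pts, mem_union, List.mem_toFinset, List.mem_map]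
  grind

lemma card_pts_le (A : List (P × P)) : #(pts A) ≤ 2 * A.length := by
  have h1 := List.toFinset_card_le (A.map Prod.fst)
  have h2 := List.toFinset_card_le (A.map Prod.snd)
  have h3 := card_union_le (A.map Prod.fst).toFinset (A.map Prod.snd).toFinset
  simp only [List.length_map] at h1 h2
  unfold pts
  omega

lemma pts_cons (p q : P) (A : List (P × P)) : pts ((p, q) :: A) = insert p (insert q (pts A)) := by
  ext z
  simp only [mem_pts, mem_insert, List.mem_cons, or_and_right, exists_or, exists_eq_left,
    or_assoc, eq_comm (a := z)]

lemma pts_nil : pts ([] : List (P × P)) = ∅ := by simp [pts]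

lemma hits_cons {σ : Perm P} {p q : P} {A : List (P × P)} :
    Hits σ ((p, q) :: A) ↔ σ p = q ∧ Hits σ A := by
  simp [Hits]

lemma illegal_comm {π : P → V} {X : SimpleGraph V} {p q : P} :
    Illegal π X p q ↔ Illegal π X q p := by
  simp [Illegal, X.adj_comm, eq_comm]

lemma switch_apply (σ : Perm P) (q b z : P) :
    switch σ q b z = swap q b (σ (swap q b z)) := rfl

lemma switch_switch (σ : Perm P) (q b : P) : switch (switch σ q b) q b = σ := by
  ext z; simp [switch_apply]

lemma IsPairing.switch {σ : Perm P} (h : IsPairing σ) (q b : P) : IsPairing (switch σ q b) := by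
  refine ⟨fun p => by simp [switch_apply, h.1], fun p hp => ?_⟩
  rw [switch_apply] at hp
  exact h.2 (swap q b p) (by simpa using congrArg (swap q b) hp)

lemma Hits.mem_pts_iff {σ : Perm P} (hσ : IsPairing σ) {A : List (P × P)} (hA : Hits σ A) (p : P) :
    σ p ∈ pts A ↔ p ∈ pts A := by
  simp only [mem_pts]
  constructor
  · rintro ⟨x, hx, h⟩
    have := hA x hx
    refine ⟨x, hx, ?_⟩
    have := hσ.1 p
    have := hσ.1 x.1
    grind
  · rintro ⟨x, hx, h⟩
    have := hA x hx
    refine ⟨x, hx, ?_⟩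
    have := hσ.1 x.1
    grind

variable [Fintype P]

/-- Pairings that contain no event of `F` and contain every pair of `A`. -/
noncomputable def pairings (F : Finset (List (P × P))) (A : List (P × P)) : Finset (Perm P) :=
  univ.filter fun σ => IsPairing σ ∧ (∀ e ∈ F, ¬ Hits σ e) ∧ Hits σ A

lemma mem_pairings {F : Finset (List (P × P))} {A : List (P × P)} {σ : Perm P} :
    σ ∈ pairings F A ↔ IsPairing σ ∧ (∀ e ∈ F, ¬ Hits σ e) ∧ Hits σ A := by
  simp [pairings]

/-- Points whose vertex equals, or is adjacent in `X` or in the pairing to, the vertex `u`. -/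
noncomputable def near (π : P → V) (X : SimpleGraph V) (σ : Perm P) (u : V) : Finset P :=
  univ.filter fun b => π b = u ∨ X.Adj u (π b) ∨ ∃ z, π z = u ∧ π (σ z) = π b

/-- Switching away from `p`–`q` towards a point `b` far from everything stays admissible. -/
lemma switch_mem_pairings {π : P → V} {X : SimpleGraph V} {F : Finset (List (P × P))}
    (hF : Admissible π X F) {A : List (P × P)} {p q b : P}
    (hpA : p ∉ pts A) (hqA : q ∉ pts A) {σ : Perm P} (hσ : σ ∈ pairings F ((p, q) :: A))
    (hbp : b ∉ near π X σ (π p)) (hbq : σ b ∉ near π X σ (π q)) (hbA : b ∉ pts A) :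
    switch σ q b ∈ pairings F A ∧ switch σ q b p = b := by
  rw [mem_pairings, hits_cons] at hσ
  obtain ⟨hpair, hav, hpq, hA⟩ := hσ
  simp only [near, mem_filter, mem_univ, true_and, not_or, not_exists, not_and] at hbp hbq
  obtain ⟨a, ha⟩ : ∃ a, a = σ b := ⟨_, rfl⟩
  rw [← ha] at hbq
  have hab : σ a = b := by rw [ha, hpair.1]
  have hqp : σ q = p := by rw [← hpq, hpair.1]
  have npq : p ≠ q := by rintro rfl; exact hpair.2 _ hpq
  have nab : a ≠ b := by rintro rfl; exact hpair.2 _ hab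
  have nbp : b ≠ p := by rintro rfl; exact hbp.1 rfl
  have nbq : b ≠ q := by rintro rfl; exact hbp.2.2 p rfl (by rw [hpq])
  have naq : a ≠ q := by rintro rfl; exact hbq.1 rfl
  have nap : a ≠ p := by rintro rfl; exact hbq.2.2 q rfl (by rw [hqp])
  have haA : a ∉ pts A := by rw [ha, hA.mem_pts_iff hpair]; exact hbA
  have tp : switch σ q b p = b := by
    rw [switch_apply, swap_apply_of_ne_of_ne npq nbp.symm, hpq, swap_apply_left]
  have tq : switch σ q b q = a := by
    rw [switch_apply, swap_apply_left, ← ha, swap_apply_of_ne_of_ne naq nab]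
  have ta : switch σ q b a = q := by
    rw [switch_apply, swap_apply_of_ne_of_ne naq nab, hab, swap_apply_right]
  have tb : switch σ q b b = p := by
    rw [switch_apply, swap_apply_right, hqp, swap_apply_of_ne_of_ne npq nbp.symm]
  have tz : ∀ z, z ≠ p → z ≠ q → z ≠ a → z ≠ b → switch σ q b z = σ z := by
    intro z h1 h2 h3 h4
    rw [switch_apply, swap_apply_of_ne_of_ne h2 h4, swap_apply_of_ne_of_ne]
    · intro h; apply h1; rw [← hqp, ← h, hpair.1]
    · intro h; apply h3; rw [ha, ← h, hpair.1]
  have c : ∀ z z', switch σ q b z = z' → (z = p ∧ z' = b) ∨ (z = q ∧ z' = a) ∨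
      (z = a ∧ z' = q) ∨ (z = b ∧ z' = p) ∨ σ z = z' := by
    intro z z' h
    by_cases h1 : z = p
    · subst h1; left; exact ⟨rfl, by rw [← h, tp]⟩
    by_cases h2 : z = q
    · subst h2; right; left; exact ⟨rfl, by rw [← h, tq]⟩
    by_cases h3 : z = a
    · subst h3; right; right; left; exact ⟨rfl, by rw [← h, ta]⟩
    by_cases h4 : z = b
    · subst h4; right; right; right; left; exact ⟨rfl, by rw [← h, tb]⟩
    · right; right; right; right; rw [← h, tz z h1 h2 h3 h4]
  refine ⟨mem_pairings.2 ⟨hpair.switch q b, ?_, ?_⟩, tp⟩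
  · intro e he hit
    have hse := hav e he
    rcases hF.1 e he with ⟨x, y, rfl, hxy, hill⟩ | ⟨x, y, x', y', rfl, hx, hy, hpx, hpy, hill⟩
    · simp only [Hits, List.mem_singleton, forall_eq] at hit hse
      have := X.adj_comm (π a) (π q)
      have := X.adj_comm (π p) (π b)
      have f1 := hbp.1
      have f2 := hbp.2.1
      have f3 := hbq.1
      have f4 := hbq.2.1
      unfold Illegal at hill
      clear hF hav he tp tq ta tb tz hA hbA haA hpA hqA hbp hbq
      rcases c _ _ hit with h | h | h | h | h <;> grind
    · have hloop : ∀ p q, p ≠ q → π p = π q → [(p, q)] ∈ F ∨ [(q, p)] ∈ F := by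
        rcases hF.2 with h | h
        · obtain ⟨_, _, h, _⟩ := h _ he
          simp at h
        · exact h
      have npiq : π p ≠ π q := by
        intro h
        rcases hloop p q npq h with h | h
        · exact hav _ h (by simp [Hits, hpq])
        · exact hav _ h (by simp [Hits, hqp])
      have hit1 := hit (x, y) (by simp)
      have hit2 := hit (x', y') (by simp)
      simp only [Hits, List.mem_cons, List.not_mem_nil, or_false, forall_eq_or_imp, forall_eq]
        at hse
      have e1 : ∀ z z', σ z = z' → π z = π p → π z' ≠ π b := by
        intro z z' h h'; rw [← h]; exact hbp.2.2 z h'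
      have e2 : ∀ z z', σ z = z' → π z = π q → π z' ≠ π a := by
        intro z z' h h'; rw [← h]; exact hbq.2.2 z h'
      have e3 : ∀ z z', σ z = z' → σ z' = z := by
        intro z z' h; rw [← h, hpair.1]
      have f1 := hbp.1
      have f2 := hbq.1
      clear hF hav hit he hloop tp tq ta tb tz hA hbA haA hpA hqA hbp hbq hill
      rcases c _ _ hit1 with h | h | h | h | h <;> rcases c _ _ hit2 with h' | h' | h' | h' | h' <;>
        grind
  · intro x hx
    have h1 : x.1 ∈ pts A := mem_pts.2 ⟨x, hx, Or.inl rfl⟩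
    rw [tz, hA x hx] <;> rintro h <;> simp_all

/-- Membership of the switched pairing when `p`–`q` is being created. -/
lemma switch_mem_pairings_cons {π : P → V} {X : SimpleGraph V} {F : Finset (List (P × P))}
    (hF : Admissible π X F) {A : List (P × P)}
    {p q : P} (hpq : p ≠ q) (hpA : p ∉ pts A) (hqA : q ∉ pts A)
    (hAπ : ∀ x ∈ A, π x.1 = π p ∧ π x.2 = π q)
    (hnew : ∀ f ∈ F, ∃ x ∈ f, x ∉ (p, q) :: A ∧ x.swap ∉ (p, q) :: A)
    {σ : Perm P} (hσ : σ ∈ pairings F A)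
    (h₁ : ¬ Illegal π X (σ q) (σ p))
    (h₂ : ∀ z, z ∉ pts A → z ≠ p → z ≠ q → σ z ≠ p → σ z ≠ q →
      ¬ (π z = π (σ q) ∧ π (σ z) = π (σ p)))
    (h₃ : ∀ z, z ∉ pts A → ¬ (π z = π p ∧ π (σ z) = π q)) :
    switch σ q (σ p) ∈ pairings F ((p, q) :: A) := by
  rw [mem_pairings] at hσ
  obtain ⟨hpair, hav, hA⟩ := hσ
  obtain ⟨a, ha⟩ : ∃ a, a = σ q := ⟨_, rfl⟩
  obtain ⟨b, hb⟩ : ∃ b, b = σ p := ⟨_, rfl⟩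
  rw [← ha, ← hb] at h₁ h₂
  rw [← hb]
  have hbσ : σ b = p := by rw [hb, hpair.1]
  have haσ : σ a = q := by rw [ha, hpair.1]
  have nbp : b ≠ p := by rintro rfl; exact hpair.2 _ hb.symm
  have naq : a ≠ q := by rintro rfl; exact hpair.2 _ ha.symm
  have nbq : b ≠ q := by
    rintro rfl; exact h₃ p hpA ⟨rfl, by rw [hb]⟩
  have nap : a ≠ p := by
    rintro rfl; exact h₃ a hpA ⟨rfl, by rw [haσ]⟩
  have nab : a ≠ b := by
    rintro rfl; apply hpq; rw [← hbσ, haσ]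
  have haA : a ∉ pts A := by rw [ha, hA.mem_pts_iff hpair]; exact hqA
  have hbA : b ∉ pts A := by rw [hb, hA.mem_pts_iff hpair]; exact hpA
  have tp : switch σ q b p = q := by
    rw [switch_apply, swap_apply_of_ne_of_ne hpq nbp.symm, ← hb, swap_apply_right]
  have tq : switch σ q b q = p := by
    rw [switch_apply, swap_apply_left, hbσ, swap_apply_of_ne_of_ne hpq nbp.symm]
  have ta : switch σ q b a = b := by
    rw [switch_apply, swap_apply_of_ne_of_ne naq nab, haσ, swap_apply_left]
  have tb : switch σ q b b = a := by
    rw [switch_apply, swap_apply_right, ← ha, swap_apply_of_ne_of_ne naq nab]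
  have tz : ∀ z, z ≠ p → z ≠ q → z ≠ a → z ≠ b → switch σ q b z = σ z := by
    intro z h1 h2 h3 h4
    rw [switch_apply, swap_apply_of_ne_of_ne h2 h4, swap_apply_of_ne_of_ne]
    · intro h; apply h3; rw [ha, ← h, hpair.1]
    · intro h; apply h1; rw [← hbσ, ← h, hpair.1]
  have c : ∀ z z', switch σ q b z = z' → (z = p ∧ z' = q) ∨ (z = q ∧ z' = p) ∨
      (z = a ∧ z' = b) ∨ (z = b ∧ z' = a) ∨
      (σ z = z' ∧ z ≠ p ∧ z ≠ q ∧ z ≠ a ∧ z ≠ b) := by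
    intro z z' h
    by_cases h1 : z = p
    · subst h1; left; exact ⟨rfl, by rw [← h, tp]⟩
    by_cases h2 : z = q
    · subst h2; right; left; exact ⟨rfl, by rw [← h, tq]⟩
    by_cases h3 : z = a
    · subst h3; right; right; left; exact ⟨rfl, by rw [← h, ta]⟩
    by_cases h4 : z = b
    · subst h4; right; right; right; left; exact ⟨rfl, by rw [← h, tb]⟩
    · right; right; right; right; exact ⟨by rw [← h, tz z h1 h2 h3 h4], h1, h2, h3, h4⟩
  refine mem_pairings.2 ⟨hpair.switch q b, ?_, hits_cons.2 ⟨tp, ?_⟩⟩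
  · intro e he hit
    have hse := hav e he
    obtain ⟨w, hwe, hw1, hw2⟩ := hnew e he
    rw [List.mem_cons, not_or] at hw1 hw2
    rcases hF.1 e he with ⟨x, y, rfl, hxy, hill⟩ | ⟨x, y, x', y', rfl, hx, hy, hpx, hpy, hill⟩
    · simp only [Hits, List.mem_singleton, forall_eq] at hit hse hwe
      have hill' := illegal_comm.1 hill
      subst hwe
      rcases c _ _ hit with h | h | h | h | h <;> grind
    · have hloop : ∀ p q, p ≠ q → π p = π q → [(p, q)] ∈ F ∨ [(q, p)] ∈ F := by
        rcases hF.2 with h | h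
        · obtain ⟨_, _, h, _⟩ := h _ he
          simp at h
        · exact h
      have npib : π p ≠ π b := by
        intro h
        rcases hloop p b nbp.symm h with h | h
        · exact hav _ h (by simp [Hits, hb])
        · exact hav _ h (by simp [Hits, hbσ])
      have hit1 := hit (x, y) (by simp)
      have hit2 := hit (x', y') (by simp)
      simp only [Hits, List.mem_cons, List.not_mem_nil, or_false, forall_eq_or_imp, forall_eq]
        at hse
      simp only [List.mem_cons, List.not_mem_nil, or_false] at hwe
      have e0 : π b ≠ π q := fun h => h₃ p hpA ⟨rfl, by rw [← hb, h]⟩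
      -- a pair of `A` over the vertices of `a` and `b` is impossible
      have hAab : ∀ z z', ((z, z') ∈ A ∨ (z', z) ∈ A) → ¬ (π z = π a ∧ π z' = π b) := by
        rintro z z' (h | h) ⟨k1, k2⟩
        · have := hAπ _ h; exact e0 (k2.symm.trans this.2)
        · have := hAπ _ h; exact npib (this.1.symm.trans k2)
      have hmemA : ∀ z, z ∈ pts A → (z, σ z) ∈ A ∨ (σ z, z) ∈ A := by
        intro z hz
        obtain ⟨⟨x₁, x₂⟩, hx, hz⟩ := mem_pts.1 hz
        have h1 : σ x₁ = x₂ := hA _ hx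
        have h2 := hpair.1 x₁
        rcases hz with hz | hz <;> dsimp only at hz <;> subst hz
        · left; rw [h1]; exact hx
        · right; rw [← h1, h2, h1]; exact hx
      have e3 : ∀ z z', σ z = z' → σ z' = z := by
        intro z z' h; rw [← h, hpair.1]
      have g3 : ∀ z z', σ z = z' → (z, z') ∉ A → (z', z) ∉ A → ¬ (π z = π p ∧ π z' = π q) := by
        rintro z z' rfl h1 h2
        exact h₃ z (fun h => by rcases hmemA z h with h | h <;> contradiction)
      have g2 : ∀ z z', σ z = z' → z ≠ p → z ≠ q → z' ≠ p → z' ≠ q →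
          ¬ (π z = π a ∧ π z' = π b) := by
        rintro z z' rfl h1 h2 h3 h4
        by_cases hz : z ∈ pts A
        · exact hAab _ _ (hmemA z hz)
        · exact h₂ z hz h1 h2 h3 h4
      have hill1 : π x ≠ π y := fun h => hill (Or.inl h)
      have hw3 : w.swap = (w.2, w.1) := rfl
      have hinj : ∀ z z', σ z = σ z' → z = z' := fun z z' h => σ.injective h
      clear hF hav hit he hloop tp tq ta tb tz hA hbA haA hpA hqA hill h₁ h₂ h₃ hmemA hAab hAπ hnew
      rcases c _ _ hit1 with h | h | h | h | h <;> rcases c _ _ hit2 with h' | h' | h' | h' | h' <;>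
        grind
  · intro x hx
    have h1 : x.1 ∈ pts A := mem_pts.2 ⟨x, hx, Or.inl rfl⟩
    rw [tz, hA x hx] <;> rintro h <;> simp_all

variable [Fintype V]

lemma card_near_le {π : P → V} {X : SimpleGraph V} {Δ : ℕ}
    (hΔ : ∀ v, #(univ.filter fun p => π p = v) + X.degree v ≤ Δ) (σ : Perm P) (u : V) :
    #(near π X σ u) ≤ (Δ + 1) * Δ := by
  let W : Finset V := insert u (X.neighborFinset u ∪ (univ.filter fun p => π p = u).image (π ∘ σ))
  have hW : #W ≤ Δ + 1 := by
    refine (card_insert_le _ _).trans ?_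
    have h1 := card_union_le (X.neighborFinset u) ((univ.filter fun p => π p = u).image (π ∘ σ))
    have h2 := card_image_le (s := univ.filter fun p => π p = u) (f := π ∘ σ)
    have h3 := hΔ u
    rw [X.card_neighborFinset_eq_degree] at h1
    omega
  have hsub : near π X σ u ⊆ W.biUnion fun w => univ.filter fun p => π p = w := by
    intro b hb
    simp only [near, mem_filter, mem_univ, true_and] at hb
    simp only [W, mem_biUnion, mem_insert, mem_union, SimpleGraph.mem_neighborFinset, mem_image,
      mem_filter, mem_univ, true_and, Function.comp]
    exact ⟨π b, by grind, rfl⟩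
  refine (card_le_card hsub).trans ((card_biUnion_le_card_mul _ _ Δ fun w _ => ?_).trans ?_)
  · have := hΔ w; omega
  · exact Nat.mul_le_mul_right _ hW

end Switching

section Counting

variable {P V : Type*} [Fintype P] [Fintype V]

/-- The standing size assumptions: total degree at most `Δ`, and many points compared to `Δ ^ 2`. -/
structure Sparse (π : P → V) (X : SimpleGraph V) (Δ : ℕ) : Prop where
  deg : ∀ v, #(univ.filter fun p => π p = v) + X.degree v ≤ Δ
  three : 3 ≤ Δ
  nine : 9 * Δ ^ 2 ≤ Fintype.card P

variable {π : P → V} {X : SimpleGraph V} {Δ : ℕ} {F : Finset (List (P × P))}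

lemma card_pairings_cons_mul_le (hS : Sparse π X Δ) (hF : Admissible π X F) {A : List (P × P)}
    {p q : P} (hpA : p ∉ pts A) (hqA : q ∉ pts A) (hA : A.length ≤ 3) :
    (#(pairings F ((p, q) :: A)) : ℝ) * (Fintype.card P - 4 * Δ ^ 2) ≤ #(pairings F A) := by
  let good : Perm P → Finset P := fun σ =>
    univ \ (near π X σ (π p) ∪ (near π X σ (π q)).image σ.symm ∪ pts A)
  have hgood : ∀ σ, Fintype.card P - 4 * Δ ^ 2 ≤ #(good σ) := by
    intro σ
    have h1 := card_near_le hS.deg σ (π p)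
    have h2 := card_near_le hS.deg σ (π q)
    have h3 := card_image_le (s := near π X σ (π q)) (f := σ.symm)
    have h4 := card_pts_le A
    have h5 := card_union_le (near π X σ (π p) ∪ (near π X σ (π q)).image σ.symm) (pts A)
    have h6 := card_union_le (near π X σ (π p)) ((near π X σ (π q)).image σ.symm)
    have h7 := le_card_sdiff (near π X σ (π p) ∪ (near π X σ (π q)).image σ.symm ∪ pts A) univ
    rw [card_univ] at h7
    have h8 : 2 * ((Δ + 1) * Δ) + 6 ≤ 4 * Δ ^ 2 := by
      have := hS.three
      nlinarith
    have : #(near π X σ (π p) ∪ (near π X σ (π q)).image σ.symm ∪ pts A) ≤ 4 * Δ ^ 2 := by omega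
    exact (Nat.sub_le_sub_left this _).trans h7
  have hspec : ∀ σ ∈ pairings F ((p, q) :: A), ∀ b ∈ good σ,
      switch σ q b ∈ pairings F A ∧ switch σ q b p = b := by
    intro σ hσ b hb
    simp only [good, mem_sdiff, mem_univ, true_and, mem_union, not_or, mem_image, not_exists,
      not_and] at hb
    refine switch_mem_pairings hF hpA hqA hσ hb.1.1 (fun h => ?_) hb.2
    exact hb.1.2 _ h (by simp)
  have hcard : #((pairings F ((p, q) :: A)).sigma good) ≤ #(pairings F A) := by
    refine card_le_card_of_injOn (fun x => switch x.1 q x.2) ?_ ?_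
    · rintro ⟨σ, b⟩ h
      rw [coe_sigma, Set.mem_sigma_iff] at h
      exact (hspec σ h.1 b h.2).1
    · rintro ⟨σ, b⟩ h ⟨σ', b'⟩ h' heq
      rw [coe_sigma, Set.mem_sigma_iff] at h h'
      dsimp only at heq
      have hb : b = b' := by
        rw [← (hspec σ h.1 b h.2).2, ← (hspec σ' h'.1 b' h'.2).2, heq]
      subst hb
      have : σ = σ' := by rw [← switch_switch σ q b, heq, switch_switch]
      rw [this]
  rw [card_sigma] at hcard
  have h1 := (Finset.card_nsmul_le_sum (pairings F ((p, q) :: A)) (fun σ => #(good σ)) _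
    fun σ _ => hgood σ).trans hcard
  have h2 : 4 * Δ ^ 2 ≤ Fintype.card P := by have := hS.nine; omega
  rw [smul_eq_mul] at h1
  have h3 : ((#(pairings F ((p, q) :: A)) * (Fintype.card P - 4 * Δ ^ 2) : ℕ) : ℝ) ≤
    #(pairings F A) := by exact_mod_cast h1
  rw [Nat.cast_mul, Nat.cast_sub h2] at h3
  push_cast at h3
  exact h3

lemma Sparse.card_pos (hS : Sparse π X Δ) : 81 ≤ (Fintype.card P : ℝ) := by
  have h1 := hS.three
  have h2 := hS.nine
  have : 81 ≤ Fintype.card P := by nlinarith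
  exact_mod_cast this

lemma Sparse.sq_le (hS : Sparse π X Δ) : 9 * (Δ : ℝ) ^ 2 ≤ Fintype.card P := by
  exact_mod_cast hS.nine

lemma card_pairings_cons_le (hS : Sparse π X Δ) (hF : Admissible π X F) {A : List (P × P)}
    {p q : P} (hpA : p ∉ pts A) (hqA : q ∉ pts A) (hA : A.length ≤ 3) :
    (#(pairings F ((p, q) :: A)) : ℝ) ≤ 2 / Fintype.card P * #(pairings F A) := by
  have h := card_pairings_cons_mul_le hS hF hpA hqA hA
  have h1 := hS.card_pos
  have h2 := hS.sq_le
  rw [div_mul_eq_mul_div, le_div_iff₀ (by linarith)]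
  have h3 : (0 : ℝ) ≤ #(pairings F ((p, q) :: A)) := Nat.cast_nonneg _
  nlinarith

lemma card_le_card_mul_of_cover {α ι : Type*} [DecidableEq α] {S : Finset α} (I : Finset ι) (f : ι → Finset α)
    {c : ℝ} (hS : S ⊆ I.biUnion f) (hf : ∀ i ∈ I, (#(f i) : ℝ) ≤ c) : (#S : ℝ) ≤ #I * c := by
  have h1 : #S ≤ ∑ i ∈ I, #(f i) := (card_le_card hS).trans card_biUnion_le
  have h2 : (#S : ℝ) ≤ ∑ i ∈ I, (#(f i) : ℝ) := by exact_mod_cast h1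
  refine h2.trans ((sum_le_sum hf).trans ?_)
  rw [sum_const, nsmul_eq_mul]

lemma card_illegal_le (hS : Sparse π X Δ) (I : Finset (P × P))
    (hI : ∀ x ∈ I, Illegal π X x.1 x.2) : #I ≤ Fintype.card P * (2 * Δ ^ 2) := by
  have hsub : I ⊆ (univ : Finset P).biUnion fun a => (near π X 1 (π a)).image fun b => (a, b) := by
    rintro ⟨a, b⟩ h
    have := hI _ h
    simp only [mem_biUnion, mem_univ, true_and, mem_image, near, mem_filter]
    refine ⟨a, b, ?_, rfl⟩
    rcases this with h | h
    · exact Or.inl h.symm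
    · exact Or.inr (Or.inl h)
  refine (card_le_card hsub).trans (card_biUnion_le_card_mul _ _ _ fun a _ => ?_)
  refine card_image_le.trans ((card_near_le hS.deg 1 (π a)).trans ?_)
  have := hS.three
  nlinarith

lemma card_fiber_le (hS : Sparse π X Δ) (v : V) : #(univ.filter fun p => π p = v) ≤ Δ :=
  (Nat.le_add_right _ _).trans (hS.deg v)

lemma le_card_pairings_cons (hS : Sparse π X Δ) (hF : Admissible π X F) {A : List (P × P)}
    {p q : P} (hpq : p ≠ q) (hpA : p ∉ pts A) (hqA : q ∉ pts A) (hA : A.length ≤ 1)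
    (hAπ : ∀ x ∈ A, π x.1 = π p ∧ π x.2 = π q)
    (hnew : ∀ f ∈ F, ∃ x ∈ f, x ∉ (p, q) :: A ∧ x.swap ∉ (p, q) :: A) :
    (1 - 18 * ((Δ : ℝ) ^ 2 / Fintype.card P)) * #(pairings F A) ≤
      Fintype.card P * #(pairings F ((p, q) :: A)) := by
  have hM := hS.card_pos
  set M : ℝ := (Fintype.card P : ℝ) with hMdef
  set B : ℝ := (#(pairings F A) : ℝ) with hB
  let valid := (pairings F A).filter fun σ => switch σ q (σ p) ∈ pairings F ((p, q) :: A)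
  have hvalid : (#valid : ℝ) ≤ M * #(pairings F ((p, q) :: A)) := by
    have : #valid ≤ #((univ : Finset P) ×ˢ pairings F ((p, q) :: A)) := by
      refine card_le_card_of_injOn (fun σ => (σ p, switch σ q (σ p))) ?_ ?_
      · intro σ h
        simp only [valid, coe_filter, Set.mem_ofPred_eq] at h
        simp [h.2]
      · intro σ _ σ' _ heq
        simp only [Prod.mk.injEq] at heq
        rw [← switch_switch σ q (σ p), heq.2, heq.1, switch_switch]
    rw [card_product, card_univ] at this
    rw [hMdef]
    exact_mod_cast this
  let I₁ : Finset (P × P) := univ.filter fun x => Illegal π X x.1 x.2 ∧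
    x.1 ∉ pts A ∧ x.2 ∉ pts A ∧ x.1 ≠ p ∧ x.1 ≠ x.2 ∧ x.2 ≠ q
  let I₂ : Finset ((P × P) × (P × P)) := univ.filter fun x => (π x.2.1 = π x.1.1 ∧
    π x.2.2 = π x.1.2) ∧ x.1.1 ∉ pts A ∧ x.1.2 ∉ pts A ∧ x.1.1 ≠ p ∧ x.1.1 ≠ x.1.2 ∧ x.1.2 ≠ q ∧
    x.2.1 ∉ pts ((q, x.1.1) :: (p, x.1.2) :: A) ∧ x.2.2 ∉ pts ((q, x.1.1) :: (p, x.1.2) :: A)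
  let I₃ : Finset (P × P) := univ.filter fun x => (π x.1 = π p ∧ π x.2 = π q) ∧
    x.1 ∉ pts A ∧ x.2 ∉ pts A
  let f₁ : P × P → Finset (Perm P) := fun x => pairings F ((q, x.1) :: (p, x.2) :: A)
  let f₂ : (P × P) × (P × P) → Finset (Perm P) := fun x =>
    pairings F ((x.2.1, x.2.2) :: (q, x.1.1) :: (p, x.1.2) :: A)
  let f₃ : P × P → Finset (Perm P) := fun x => pairings F ((x.1, x.2) :: A)
  have hB0 : 0 ≤ B := Nat.cast_nonneg _
  have hb₁ : ∀ a b, a ∉ pts A → b ∉ pts A → a ≠ p → a ≠ b → b ≠ q →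
      (#(pairings F ((q, a) :: (p, b) :: A)) : ℝ) ≤ (2 / M) ^ 2 * B := by
    intro a b ha hb hap hab hbq
    have h1 := card_pairings_cons_le hS hF hpA hb (by omega)
    have h2 := card_pairings_cons_le hS hF (A := (p, b) :: A) (p := q) (q := a)
      (by rw [pts_cons]; simp [hqA, hpq.symm, hbq.symm])
      (by rw [pts_cons]; simp [ha, hap, hab]) (by simp; omega)
    rw [← hMdef] at h1 h2
    calc _ ≤ _ := h2
      _ ≤ 2 / M * (2 / M * B) := by gcongr
      _ = _ := by ring
  have hc₁ : (#I₁ : ℝ) ≤ M * (2 * Δ ^ 2) := by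
    rw [hMdef]
    exact_mod_cast card_illegal_le hS I₁ fun x hx => (mem_filter.1 hx).2.1
  have hc₂ : (#I₂ : ℝ) ≤ M ^ 2 * Δ ^ 2 := by
    have hsub : I₂ ⊆ (univ : Finset (P × P)).biUnion fun x =>
        ((univ.filter fun z => π z = π x.1) ×ˢ (univ.filter fun z => π z = π x.2)).image
          fun y => (x, y) := by
      rintro ⟨x, y⟩ h
      simp only [I₂, mem_filter, mem_univ, true_and] at h
      simp only [mem_biUnion, mem_univ, true_and, mem_image, mem_product, mem_filter]
      exact ⟨x, y, h.1, rfl⟩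
    have : #I₂ ≤ (Fintype.card P) ^ 2 * Δ ^ 2 := by
      refine (card_le_card hsub).trans ((card_biUnion_le_card_mul _ _ (Δ ^ 2) fun x _ => ?_).trans ?_)
      · refine card_image_le.trans ?_
        rw [card_product, sq]
        exact Nat.mul_le_mul (card_fiber_le hS _) (card_fiber_le hS _)
      · rw [card_univ, Fintype.card_prod, ← sq]
    rw [hMdef]
    exact_mod_cast this
  have hc₃ : (#I₃ : ℝ) ≤ Δ ^ 2 := by
    have hsub : I₃ ⊆ (univ.filter fun z => π z = π p) ×ˢ (univ.filter fun z => π z = π q) := by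
      rintro ⟨x, y⟩ h
      simp only [I₃, mem_filter, mem_univ, true_and] at h
      simpa using h.1
    have := card_le_card hsub
    rw [card_product] at this
    have := this.trans (Nat.mul_le_mul (card_fiber_le hS _) (card_fiber_le hS _))
    rw [sq]
    exact_mod_cast this
  have hu₁ := card_le_card_mul_of_cover I₁ f₁ (Subset.refl (I₁.biUnion f₁)) (c := (2 / M) ^ 2 * B) (by
    rintro ⟨a, b⟩ h
    simp only [I₁, mem_filter, mem_univ, true_and] at h
    exact hb₁ a b h.2.1 h.2.2.1 h.2.2.2.1 h.2.2.2.2.1 h.2.2.2.2.2)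
  have hu₂ := card_le_card_mul_of_cover I₂ f₂ (Subset.refl (I₂.biUnion f₂)) (c := (2 / M) ^ 3 * B) (by
    rintro ⟨⟨a, b⟩, ⟨z, w⟩⟩ h
    simp only [I₂, mem_filter, mem_univ, true_and] at h
    have h1 := hb₁ a b h.2.1 h.2.2.1 h.2.2.2.1 h.2.2.2.2.1 h.2.2.2.2.2.1
    have h2 := card_pairings_cons_le hS hF h.2.2.2.2.2.2.1 h.2.2.2.2.2.2.2 (by simp; omega)
    rw [← hMdef] at h2
    calc _ ≤ _ := h2
      _ ≤ 2 / M * ((2 / M) ^ 2 * B) := by gcongr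
      _ = _ := by ring)
  have hu₃ := card_le_card_mul_of_cover I₃ f₃ (Subset.refl (I₃.biUnion f₃)) (c := 2 / M * B) (by
    rintro ⟨z, w⟩ h
    simp only [I₃, mem_filter, mem_univ, true_and] at h
    exact card_pairings_cons_le hS hF h.2.1 h.2.2 (by omega))
  have hcover : pairings F A ⊆ valid ∪ I₁.biUnion f₁ ∪ I₂.biUnion f₂ ∪ I₃.biUnion f₃ := by
    intro σ hσ
    have hσ' := mem_pairings.1 hσ
    obtain ⟨hpair, hav, hit⟩ := hσ'
    simp only [mem_union]
    by_cases h3 : ∃ z, z ∉ pts A ∧ π z = π p ∧ π (σ z) = π q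
    · right
      obtain ⟨z, hz, h⟩ := h3
      refine mem_biUnion.2 ⟨(z, σ z), ?_, ?_⟩
      · simp only [I₃, mem_filter, mem_univ, true_and]
        exact ⟨h, hz, by rwa [hit.mem_pts_iff hpair]⟩
      · exact mem_pairings.2 ⟨hpair, hav, hits_cons.2 ⟨rfl, hit⟩⟩
    have hpq' : σ p ≠ q := fun h => h3 ⟨p, hpA, rfl, by rw [h]⟩
    have hqp' : σ q ≠ p := fun h => hpq' (by rw [← h, hpair.1])
    have hsp : σ p ∉ pts A := by rwa [hit.mem_pts_iff hpair]
    have hsq : σ q ∉ pts A := by rwa [hit.mem_pts_iff hpair]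
    have hne : σ q ≠ σ p := fun h => hpq (σ.injective h).symm
    by_cases h1 : Illegal π X (σ q) (σ p)
    · left; left; right
      refine mem_biUnion.2 ⟨(σ q, σ p), ?_, ?_⟩
      · simp only [I₁, mem_filter, mem_univ, true_and]
        exact ⟨h1, hsq, hsp, hqp', hne, hpq'⟩
      · exact mem_pairings.2 ⟨hpair, hav, hits_cons.2 ⟨rfl, hits_cons.2 ⟨rfl, hit⟩⟩⟩
    by_cases h2 : ∃ z, z ∉ pts A ∧ z ≠ p ∧ z ≠ q ∧ σ z ≠ p ∧ σ z ≠ q ∧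
      (π z = π (σ q) ∧ π (σ z) = π (σ p))
    · left; right
      obtain ⟨z, hz, hzp, hzq, hsz, hsz', h⟩ := h2
      have hzA : z ∉ pts ((q, σ q) :: (p, σ p) :: A) := by
        simp only [pts_cons, mem_insert, not_or]
        refine ⟨hzq, ?_, hzp, ?_, hz⟩
        · intro h; apply hsz'; rw [h, hpair.1]
        · intro h; apply hsz; rw [h, hpair.1]
      refine mem_biUnion.2 ⟨((σ q, σ p), (z, σ z)), ?_, ?_⟩
      · simp only [I₂, mem_filter, mem_univ, true_and]
        refine ⟨h, hsq, hsp, hqp', hne, hpq', hzA, ?_⟩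
        rw [Hits.mem_pts_iff hpair (hits_cons.2 ⟨rfl, hits_cons.2 ⟨rfl, hit⟩⟩)]
        exact hzA
      · exact mem_pairings.2 ⟨hpair, hav,
          hits_cons.2 ⟨rfl, hits_cons.2 ⟨rfl, hits_cons.2 ⟨rfl, hit⟩⟩⟩⟩
    left; left; left
    refine mem_filter.2 ⟨hσ, switch_mem_pairings_cons hF hpq hpA hqA hAπ hnew hσ h1 ?_ ?_⟩
    · intro z k1 k2 k3 k4 k5 k6
      exact h2 ⟨z, k1, k2, k3, k4, k5, k6⟩
    · intro z k1 k2
      exact h3 ⟨z, k1, k2⟩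
  have htot : B ≤ #valid + #(I₁.biUnion f₁) + #(I₂.biUnion f₂) + #(I₃.biUnion f₃) := by
    have h1 := card_le_card hcover
    have h2 := card_union_le (valid ∪ I₁.biUnion f₁ ∪ I₂.biUnion f₂) (I₃.biUnion f₃)
    have h3 := card_union_le (valid ∪ I₁.biUnion f₁) (I₂.biUnion f₂)
    have h4 := card_union_le valid (I₁.biUnion f₁)
    rw [hB]
    exact_mod_cast (by omega)
  have k₁ : (#I₁ : ℝ) * ((2 / M) ^ 2 * B) ≤ M * (2 * Δ ^ 2) * ((2 / M) ^ 2 * B) := by gcongr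
  have k₂ : (#I₂ : ℝ) * ((2 / M) ^ 3 * B) ≤ M ^ 2 * Δ ^ 2 * ((2 / M) ^ 3 * B) := by gcongr
  have k₃ : (#I₃ : ℝ) * (2 / M * B) ≤ Δ ^ 2 * (2 / M * B) := by gcongr
  have hMpos : 0 < M := by linarith
  have e₁ : M * (2 * Δ ^ 2) * ((2 / M) ^ 2 * B) = 8 * ((Δ : ℝ) ^ 2 / M) * B := by
    field_simp; ring
  have e₂ : M ^ 2 * Δ ^ 2 * ((2 / M) ^ 3 * B) = 8 * ((Δ : ℝ) ^ 2 / M) * B := by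
    field_simp; ring
  have e₃ : Δ ^ 2 * (2 / M * B) = 2 * ((Δ : ℝ) ^ 2 / M) * B := by
    field_simp
  rw [e₁] at k₁
  rw [e₂] at k₂
  rw [e₃] at k₃
  generalize (Δ : ℝ) ^ 2 / M = t at *
  rw [sub_mul, one_mul]
  linarith

end Counting

section Product

variable {P V : Type*} [Fintype P] [Fintype V]
variable {π : P → V} {X : SimpleGraph V} {Δ : ℕ} {F : Finset (List (P × P))}

lemma card_pairings_single_bounds (hS : Sparse π X Δ) (hF : Admissible π X F) {p q : P}
    (hpq : p ≠ q) (hnew : ∀ f ∈ F, ∃ x ∈ f, x ∉ [(p, q)] ∧ x.swap ∉ [(p, q)]) :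
    |(#(pairings F [(p, q)]) : ℝ) - (1 / Fintype.card P) * #(pairings F [])| ≤
      40 * ((Δ : ℝ) ^ 2 / Fintype.card P) * ((1 / Fintype.card P) * #(pairings F [])) := by
  have hu := card_pairings_cons_mul_le hS hF (A := []) (p := p) (q := q) (by simp [pts_nil])
    (by simp [pts_nil]) (by simp)
  have hl := le_card_pairings_cons hS hF (A := []) hpq (by simp [pts_nil])
    (by simp [pts_nil]) (by simp) (by simp) hnew
  have hM := hS.card_pos
  have hd := hS.sq_le
  set M : ℝ := (Fintype.card P : ℝ)
  have hMpos : 0 < M := by linarith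
  obtain ⟨t, ht⟩ : ∃ t, t = (Δ : ℝ) ^ 2 / M := ⟨_, rfl⟩
  have htM : (Δ : ℝ) ^ 2 = t * M := by rw [ht]; field_simp
  have ht0 : 0 ≤ t := by rw [ht]; positivity
  have ht9 : 9 * t ≤ 1 := by
    rw [htM] at hd; nlinarith
  rw [htM] at hu
  rw [← ht] at hl ⊢
  have hN : (0 : ℝ) ≤ #(pairings F [(p, q)]) := Nat.cast_nonneg _
  have hB : (0 : ℝ) ≤ #(pairings F []) := Nat.cast_nonneg _
  generalize (#(pairings F [(p, q)]) : ℝ) = N at *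
  generalize (#(pairings F []) : ℝ) = B at *
  obtain ⟨y, hy⟩ : ∃ y, y = M * N := ⟨_, rfl⟩
  have hNy : N = (1 / M) * y := by rw [hy]; field_simp
  have hy0 : 0 ≤ y := by rw [hy]; positivity
  have hu' : y * (1 - 4 * t) ≤ B := by
    calc y * (1 - 4 * t) = N * (M - 4 * (t * M)) := by rw [hy]; ring
      _ ≤ B := hu
  have hl' : (1 - 18 * t) * B ≤ y := by rw [hy]; exact hl
  have hup : y ≤ B + 8 * t * B := by nlinarith [mul_nonneg ht0 hB, mul_nonneg ht0 hy0]
  rw [hNy, ← mul_sub, abs_mul, abs_of_pos (by positivity : 0 < 1 / M)]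
  rw [show 40 * t * (1 / M * B) = 1 / M * (40 * t * B) by ring]
  have : |y - B| ≤ 40 * t * B := by
    rw [abs_le]
    constructor <;> nlinarith [mul_nonneg ht0 hB]
  gcongr

lemma card_pairings_double_bounds (hS : Sparse π X Δ) (hF : Admissible π X F) {p q p' q' : P}
    (hpp' : p ≠ p') (hqq' : q ≠ q') (hp : π p = π p') (hq : π q = π q') (hpq : π p ≠ π q)
    (hnew : ∀ f ∈ F, ∃ x ∈ f, x ∉ [(p, q), (p', q')] ∧ x.swap ∉ [(p, q), (p', q')]) :
    |(#(pairings F [(p, q), (p', q')]) : ℝ) - (1 / Fintype.card P) ^ 2 * #(pairings F [])| ≤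
      40 * ((Δ : ℝ) ^ 2 / Fintype.card P) * ((1 / Fintype.card P) ^ 2 * #(pairings F [])) := by
  have n1 : p ≠ q' := by rintro rfl; exact hpq hq.symm
  have n2 : q ≠ p' := by rintro rfl; exact hpq hp
  have n3 : p ≠ q := by rintro rfl; exact hpq rfl
  have n4 : p' ≠ q' := by rintro rfl; exact hpq (hp.trans hq.symm)
  have hu₁ := card_pairings_cons_mul_le hS hF (A := []) (p := p') (q := q') (by simp [pts_nil])
    (by simp [pts_nil]) (by simp)
  have hl₁ := le_card_pairings_cons hS hF (A := []) n4 (by simp [pts_nil])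
    (by simp [pts_nil]) (by simp) (by simp) (by
      intro f hf
      obtain ⟨x, hx, h1, h2⟩ := hnew f hf
      refine ⟨x, hx, ?_, ?_⟩ <;> simp_all)
  have hu₂ := card_pairings_cons_mul_le hS hF (A := [(p', q')]) (p := p) (q := q)
    (by simp [pts_cons, pts_nil, hpp', n1]) (by simp [pts_cons, pts_nil, n2, hqq']) (by simp)
  have hl₂ := le_card_pairings_cons hS hF (A := [(p', q')]) n3
    (by simp [pts_cons, pts_nil, hpp', n1]) (by simp [pts_cons, pts_nil, n2, hqq'])
    (by simp) (by simp [hp, hq]) hnew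
  have hM := hS.card_pos
  have hd := hS.sq_le
  set M : ℝ := (Fintype.card P : ℝ)
  have hMpos : 0 < M := by linarith
  obtain ⟨t, ht⟩ : ∃ t, t = (Δ : ℝ) ^ 2 / M := ⟨_, rfl⟩
  have htM : (Δ : ℝ) ^ 2 = t * M := by rw [ht]; field_simp
  have ht0 : 0 ≤ t := by rw [ht]; positivity
  have ht9 : 9 * t ≤ 1 := by
    rw [htM] at hd; nlinarith
  rw [htM] at hu₁ hu₂
  rw [← ht] at hl₁ hl₂ ⊢
  have hN : (0 : ℝ) ≤ #(pairings F [(p, q), (p', q')]) := Nat.cast_nonneg _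
  have hN' : (0 : ℝ) ≤ #(pairings F [(p', q')]) := Nat.cast_nonneg _
  have hB : (0 : ℝ) ≤ #(pairings F []) := Nat.cast_nonneg _
  generalize (#(pairings F [(p, q), (p', q')]) : ℝ) = N at *
  generalize (#(pairings F [(p', q')]) : ℝ) = N' at *
  generalize (#(pairings F []) : ℝ) = B at *
  obtain ⟨y, hy⟩ : ∃ y, y = M * N' := ⟨_, rfl⟩
  obtain ⟨z, hz⟩ : ∃ z, z = M * (M * N) := ⟨_, rfl⟩
  have hNz : N = (1 / M) ^ 2 * z := by rw [hz]; field_simp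
  have hy0 : 0 ≤ y := by rw [hy]; positivity
  have hz0 : 0 ≤ z := by rw [hz]; positivity
  have u₁ : y * (1 - 4 * t) ≤ B := by
    calc y * (1 - 4 * t) = N' * (M - 4 * (t * M)) := by rw [hy]; ring
      _ ≤ B := hu₁
  have u₂ : z * (1 - 4 * t) ≤ y := by
    calc z * (1 - 4 * t) = M * (N * (M - 4 * (t * M))) := by rw [hz]; ring
      _ ≤ y := by rw [hy]; gcongr
  have l₁ : (1 - 18 * t) * B ≤ y := by rw [hy]; exact hl₁
  have l₂ : (1 - 18 * t) * y ≤ z := by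
    calc (1 - 18 * t) * y = M * ((1 - 18 * t) * N') := by rw [hy]; ring
      _ ≤ z := by rw [hz]; gcongr
  have hyB : y ≤ B + 8 * t * B := by nlinarith [mul_nonneg ht0 hB, mul_nonneg ht0 hy0]
  have hzy : z ≤ y + 8 * t * y := by nlinarith [mul_nonneg ht0 hz0, mul_nonneg ht0 hy0]
  have htB := mul_nonneg ht0 hB
  have hty : t * y ≤ 2 * (t * B) := by
    have : y ≤ 2 * B := by nlinarith
    nlinarith
  rw [hNz, ← mul_sub, abs_mul, abs_of_pos (by positivity : 0 < (1 / M) ^ 2)]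
  rw [show 40 * t * ((1 / M) ^ 2 * B) = (1 / M) ^ 2 * (40 * t * B) by ring]
  have : |z - B| ≤ 40 * t * B := by
    rw [abs_le]
    constructor
    · rcases le_total (1 - 40 * t) 0 with h | h
      · nlinarith
      · have hty' : t * y ≤ t * (B + 8 * t * B) := mul_le_mul_of_nonneg_left hyB ht0
        nlinarith [mul_nonneg ht0 htB]
    · nlinarith
  gcongr

lemma card_pairings_insert (e : List (P × P)) :
    (#(pairings (insert e F) []) : ℝ) = #(pairings F []) - #(pairings F e) := by
  have h : pairings (insert e F) [] = pairings F [] \ pairings F e := by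
    ext σ
    simp only [mem_pairings, mem_sdiff, mem_insert]
    have : Hits σ [] := by simp [Hits]
    grind
  have hsub : pairings F e ⊆ pairings F [] := by
    intro σ
    simp only [mem_pairings]
    have : Hits σ [] := by simp [Hits]
    grind
  rw [h, card_sdiff_of_subset hsub, Nat.cast_sub (card_le_card hsub)]

lemma abs_log_sub_add_le {B N w t : ℝ} (hB : 0 < B) (hN : 0 ≤ N) (hw0 : 0 ≤ w) (hwt : 9 * w ≤ t)
    (ht9 : 9 * t ≤ 1) (h : |N - w * B| ≤ 40 * t * (w * B)) :
    0 < B - N ∧ |Real.log (B - N) - Real.log B + w| ≤ 100 * t * w := by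
  obtain ⟨x, hx⟩ : ∃ x, x = N / B := ⟨_, rfl⟩
  have hNx : N = x * B := by rw [hx]; field_simp
  have hx0 : 0 ≤ x := by rw [hx]; positivity
  have hxw : |x - w| ≤ 40 * t * w := by
    rw [hNx, ← sub_mul, abs_mul, abs_of_pos hB, ← mul_assoc] at h
    exact le_of_mul_le_mul_right h hB
  rw [abs_le] at hxw
  have ht0 : 0 ≤ t := by linarith
  have htw := mul_nonneg ht0 hw0
  have hx6 : x ≤ 6 * w := by nlinarith
  have hx1 : x ≤ 1 / 2 := by linarith
  have hBN : B - N = (1 - x) * B := by rw [hNx]; ring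
  have h1x : 0 < 1 - x := by linarith
  refine ⟨by rw [hBN]; positivity, ?_⟩
  rw [hBN, Real.log_mul h1x.ne' hB.ne', add_sub_cancel_right]
  have l1 := Real.log_le_sub_one_of_pos h1x
  have l2 := Real.one_sub_inv_le_log_of_pos h1x
  have l3 : (1 - x)⁻¹ ≤ 1 + x + 2 * x ^ 2 := by
    rw [inv_le_iff_one_le_mul₀ h1x]
    nlinarith [mul_nonneg (sq_nonneg x) (by linarith : 0 ≤ 1 - 2 * x)]
  have l4 : x ^ 2 ≤ 4 * (t * w) := by nlinarith
  rw [abs_le]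
  constructor <;> linarith

end Product

section CanonicalEvents

variable {P V : Type*} [Fintype P]
variable {π : P → V} {X : SimpleGraph V} {Δ : ℕ} {F : Finset (List (P × P))} {r : P → ℕ}

/-- One representative of each loop or `X`-edge event. -/
noncomputable def singles (π : P → V) (X : SimpleGraph V) (r : P → ℕ) : Finset (List (P × P)) :=
  (univ.filter fun x : P × P => r x.1 < r x.2 ∧ Illegal π X x.1 x.2).image fun x => [x]

lemma mem_singles {e : List (P × P)} : e ∈ singles π X r ↔
    ∃ p q, e = [(p, q)] ∧ r p < r q ∧ Illegal π X p q := by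
  simp only [singles, mem_image, mem_filter, mem_univ, true_and, Prod.exists]
  grind

variable [LinearOrder V]

/-- One representative of each double-edge event outside `X`. -/
noncomputable def doubles (π : P → V) (X : SimpleGraph V) (r : P → ℕ) : Finset (List (P × P)) :=
  (univ.filter fun x : (P × P) × (P × P) => r x.1.1 < r x.2.1 ∧ x.1.2 ≠ x.2.2 ∧
    π x.1.1 = π x.2.1 ∧ π x.1.2 = π x.2.2 ∧ π x.1.1 < π x.1.2 ∧
    ¬ Illegal π X x.1.1 x.1.2).image fun x => [x.1, x.2]

lemma mem_doubles {e : List (P × P)} : e ∈ doubles π X r ↔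
    ∃ p q p' q', e = [(p, q), (p', q')] ∧ r p < r p' ∧ q ≠ q' ∧ π p = π p' ∧ π q = π q' ∧
      π p < π q ∧ ¬ Illegal π X p q := by
  simp only [doubles, mem_image, mem_filter, mem_univ, true_and, Prod.exists]
  constructor
  · rintro ⟨a, b, c, d, h, rfl⟩; exact ⟨a, b, c, d, rfl, h⟩
  · rintro ⟨a, b, c, d, rfl, h⟩; exact ⟨a, b, c, d, h, rfl⟩

lemma isSingle_of_mem {e : List (P × P)} (h : e ∈ singles π X r) : IsSingle π X e := by
  obtain ⟨p, q, rfl, h1, h2⟩ := mem_singles.1 h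
  exact ⟨p, q, rfl, by rintro rfl; simp at h1, h2⟩

lemma isDouble_of_mem {e : List (P × P)} (h : e ∈ doubles π X r) : IsDouble π X e := by
  obtain ⟨p, q, p', q', rfl, h1, h2, h3, h4, h5, h6⟩ := mem_doubles.1 h
  exact ⟨p, q, p', q', rfl, by rintro rfl; simp at h1, h2, h3, h4, h6⟩

lemma admissible_of_subset_singles (h : F ⊆ singles π X r) : Admissible π X F :=
  ⟨fun _ he => Or.inl (isSingle_of_mem (h he)), Or.inl fun _ he => isSingle_of_mem (h he)⟩

lemma admissible_union {D : Finset (List (P × P))} (hr : r.Injective) (h : D ⊆ doubles π X r) :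
    Admissible π X (singles π X r ∪ D) := by
  refine ⟨fun e he => ?_, Or.inr fun p q hpq hπ => ?_⟩
  · rcases mem_union.1 he with he | he
    · exact Or.inl (isSingle_of_mem he)
    · exact Or.inr (isDouble_of_mem (h he))
  · rcases lt_or_gt_of_ne (hr.ne hpq) with h | h
    · exact Or.inl (mem_union_left _ (mem_singles.2 ⟨p, q, rfl, h, Or.inl hπ⟩))
    · exact Or.inr (mem_union_left _ (mem_singles.2 ⟨q, p, rfl, h, Or.inl hπ.symm⟩))

/-- Distinct canonical events are not contained in one another, even up to orientation. -/
lemma exists_mem_not_mem_of_ne {e f : List (P × P)}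
    (he : e ∈ singles π X r ∪ doubles π X r) (hf : f ∈ singles π X r ∪ doubles π X r)
    (hne : f ≠ e) : ∃ x ∈ f, x ∉ e ∧ x.swap ∉ e := by
  by_contra! hcon
  rw [mem_union, mem_singles, mem_doubles] at he hf
  rcases he with ⟨p, q, rfl, h1, h2⟩ | ⟨p, q, p', q', rfl, h1, h2, h3, h4, h5, h6⟩ <;>
  rcases hf with ⟨x, y, rfl, k1, k2⟩ | ⟨x, y, x', y', rfl, k1, k2, k3, k4, k5, k6⟩
  · have := hcon (x, y) (by simp)
    simp only [List.mem_singleton, Prod.swap, Prod.mk.injEq] at this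
    rcases or_iff_not_imp_left.2 this with ⟨rfl, rfl⟩ | ⟨rfl, rfl⟩
    · exact hne rfl
    · exact lt_asymm h1 k1
  · have := hcon (x, y) (by simp)
    simp only [List.mem_singleton, Prod.swap, Prod.mk.injEq] at this
    rcases or_iff_not_imp_left.2 this with ⟨rfl, rfl⟩ | ⟨rfl, rfl⟩
    · exact k6 h2
    · exact k6 (illegal_comm.1 h2)
  · have := hcon (x, y) (by simp)
    have h7 : ¬ Illegal π X p' q' := by unfold Illegal at h6 ⊢; rwa [← h3, ← h4]
    simp only [List.mem_cons, List.not_mem_nil, or_false, Prod.swap, Prod.mk.injEq] at this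
    rcases or_iff_not_imp_left.2 this with (⟨rfl, rfl⟩ | ⟨rfl, rfl⟩) | (⟨rfl, rfl⟩ | ⟨rfl, rfl⟩)
    · exact h6 k2
    · exact h7 k2
    · exact h6 (illegal_comm.1 k2)
    · exact h7 (illegal_comm.1 k2)
  · have c1 := or_iff_not_imp_left.2 (hcon (x, y) (by simp))
    have c2 := or_iff_not_imp_left.2 (hcon (x', y') (by simp))
    clear hcon
    simp only [List.mem_cons, List.not_mem_nil, or_false, Prod.swap, Prod.mk.injEq] at c1 c2
    have n1 : ¬ (y = p ∧ x = q) := by rintro ⟨rfl, rfl⟩; exact lt_asymm h5 k5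
    have n2 : ¬ (y = p' ∧ x = q') := by
      rintro ⟨rfl, rfl⟩; rw [h3, h4] at h5; exact lt_asymm h5 k5
    have n3 : ¬ (y' = p ∧ x' = q) := by
      rintro ⟨rfl, rfl⟩; rw [k3, k4] at k5; exact lt_asymm h5 k5
    have n4 : ¬ (y' = p' ∧ x' = q') := by
      rintro ⟨rfl, rfl⟩; rw [k3, k4] at k5; rw [h3, h4] at h5; exact lt_asymm h5 k5
    simp only [n1, n2, or_false] at c1
    simp only [n3, n4, or_false] at c2
    rcases c1 with ⟨rfl, rfl⟩ | ⟨rfl, rfl⟩ <;> rcases c2 with ⟨rfl, rfl⟩ | ⟨rfl, rfl⟩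
    · exact k2 rfl
    · exact hne rfl
    · exact lt_asymm h1 k1
    · exact k2 rfl

/-- The heuristic probability of an event. -/
noncomputable def weight (e : List (P × P)) : ℝ := (1 / (Fintype.card P : ℝ)) ^ e.length

variable [Fintype V]

lemma log_card_pairings_insert (hS : Sparse π X Δ) (hF : Admissible π X F)
    (hFsub : F ⊆ singles π X r ∪ doubles π X r) {e : List (P × P)}
    (he : e ∈ singles π X r ∪ doubles π X r) (heF : e ∉ F) (hpos : (pairings F []).Nonempty) :
    (pairings (insert e F) []).Nonempty ∧
    |Real.log #(pairings (insert e F) []) - Real.log #(pairings F []) + weight e| ≤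
      100 * ((Δ : ℝ) ^ 2 / Fintype.card P) * weight e := by
  have hnew : ∀ f ∈ F, ∃ x ∈ f, x ∉ e ∧ x.swap ∉ e := fun f hf =>
    exists_mem_not_mem_of_ne he (hFsub hf) (by rintro rfl; exact heF hf)
  have hM := hS.card_pos
  have hd := hS.sq_le
  have h3 : (3 : ℝ) ≤ Δ := by exact_mod_cast hS.three
  have hB : (0 : ℝ) < #(pairings F []) := by exact_mod_cast hpos.card_pos
  have hMpos : (0 : ℝ) < Fintype.card P := by linarith
  have hest : |(#(pairings F e) : ℝ) - weight e * #(pairings F [])| ≤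
      40 * ((Δ : ℝ) ^ 2 / Fintype.card P) * (weight e * #(pairings F [])) := by
    rcases mem_union.1 he with h | h
    · obtain ⟨p, q, rfl, h1, h2⟩ := mem_singles.1 h
      simpa [weight] using card_pairings_single_bounds hS hF (by rintro rfl; simp at h1) hnew
    · obtain ⟨p, q, p', q', rfl, h1, h2, h3, h4, h5, h6⟩ := mem_doubles.1 h
      simpa [weight] using card_pairings_double_bounds hS hF (by rintro rfl; simp at h1) h2 h3 h4
        h5.ne hnew
  have hlen : e.length ≠ 0 := by
    rcases mem_union.1 he with h | h
    · obtain ⟨p, q, rfl, -⟩ := mem_singles.1 h; simp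
    · obtain ⟨p, q, p', q', rfl, -⟩ := mem_doubles.1 h; simp
  have hw : weight e ≤ 1 / Fintype.card P := by
    refine pow_le_of_le_one (by positivity) ?_ hlen
    rw [div_le_one hMpos]; linarith
  have hfin := abs_log_sub_add_le hB (Nat.cast_nonneg _) (by unfold weight; positivity)
    (t := (Δ : ℝ) ^ 2 / Fintype.card P) (w := weight e) (N := #(pairings F e)) ?_ ?_ hest
  · rw [← card_pairings_insert] at hfin
    refine ⟨card_pos.1 (by exact_mod_cast hfin.1), hfin.2⟩
  · calc 9 * weight e ≤ 9 * (1 / Fintype.card P) := by gcongr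
      _ = 9 / Fintype.card P := by ring
      _ ≤ _ := by gcongr; nlinarith
  · rw [← mul_div_assoc, div_le_one hMpos]; exact hd

lemma log_card_pairings_union {F₀ G : Finset (List (P × P))} {c : ℝ}
    (hpos : (pairings F₀ []).Nonempty)
    (hstep : ∀ D ⊆ G, ∀ e ∈ G, e ∉ D → (pairings (F₀ ∪ D) []).Nonempty →
      (pairings (insert e (F₀ ∪ D)) []).Nonempty ∧
      |Real.log #(pairings (insert e (F₀ ∪ D)) []) - Real.log #(pairings (F₀ ∪ D) []) + weight e|
        ≤ c * weight e) :
    (pairings (F₀ ∪ G) []).Nonempty ∧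
      |Real.log #(pairings (F₀ ∪ G) []) - Real.log #(pairings F₀ []) + ∑ e ∈ G, weight e| ≤
        c * ∑ e ∈ G, weight e := by
  induction G using Finset.induction_on with
  | empty => simpa using hpos
  | insert e D heD ih =>
    obtain ⟨ih1, ih2⟩ := ih fun D' hD' e' he' => hstep D' (hD'.trans (subset_insert _ _)) e'
      (mem_insert_of_mem he')
    obtain ⟨h1, h2⟩ := hstep D (subset_insert _ _) e (mem_insert_self _ _) heD ih1
    rw [union_insert, sum_insert heD]
    refine ⟨h1, ?_⟩
    rw [abs_le] at *
    constructor <;> linarith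

lemma disjoint_singles_doubles : Disjoint (singles π X r) (doubles π X r) := by
  rw [disjoint_left]
  intro e h1 h2
  obtain ⟨p, q, rfl, -⟩ := mem_singles.1 h1
  obtain ⟨p, q, p', q', h, -⟩ := mem_doubles.1 h2
  simp at h

/-- The logarithm of the proportion of pairings that are simple and avoid `X`. -/
lemma log_card_simple_pairings (hS : Sparse π X Δ) (hr : r.Injective)
    (hpos : (pairings (∅ : Finset (List (P × P))) []).Nonempty) :
    (pairings (singles π X r ∪ doubles π X r) []).Nonempty ∧
    |Real.log #(pairings (singles π X r ∪ doubles π X r) []) -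
      Real.log #(pairings (∅ : Finset (List (P × P))) []) +
      ∑ e ∈ singles π X r ∪ doubles π X r, weight e| ≤
      100 * ((Δ : ℝ) ^ 2 / Fintype.card P) *
        ∑ e ∈ singles π X r ∪ doubles π X r, weight e := by
  obtain ⟨h1, h2⟩ := log_card_pairings_union (F₀ := ∅) (G := singles π X r)
    (c := 100 * ((Δ : ℝ) ^ 2 / Fintype.card P)) hpos (by
      intro D hD e he heD hp
      rw [empty_union] at *
      exact log_card_pairings_insert hS (admissible_of_subset_singles hD)
        (hD.trans subset_union_left) (mem_union_left _ he) heD hp)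
  rw [empty_union] at h1 h2
  obtain ⟨h3, h4⟩ := log_card_pairings_union (F₀ := singles π X r) (G := doubles π X r)
    (c := 100 * ((Δ : ℝ) ^ 2 / Fintype.card P)) h1 (by
      intro D hD e he heD hp
      refine log_card_pairings_insert hS (admissible_union hr hD)
        (union_subset_union_right hD) (mem_union_right _ he) ?_ hp
      rw [mem_union, not_or]
      exact ⟨fun h => disjoint_left.1 disjoint_singles_doubles h he, heD⟩)
  refine ⟨h3, ?_⟩
  rw [sum_union disjoint_singles_doubles]
  rw [abs_le] at *
  constructor <;> linarith

end CanonicalEvents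

section Total

variable {P : Type*} [Fintype P]

lemma isPairing_iff_cycleType {k : ℕ} (hk : Fintype.card P = 2 * k) (σ : Perm P) :
    IsPairing σ ↔ σ.cycleType = Multiset.replicate k 2 := by
  have hsum := σ.sum_cycleType
  constructor
  · intro h
    have h2 : σ ^ 2 = 1 := by ext p; simp [pow_two, h.1]
    have hsupp : σ.support = univ := by ext p; simp [h.2]
    have hrep := Perm.cycleType_of_pow_prime_eq_one h2
    rw [hrep, hsupp, card_univ, hk, Multiset.sum_replicate, smul_eq_mul] at hsum
    rw [hrep]
    congr 1
    omega
  · intro h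
    have h2 : σ ^ 2 = 1 := by
      rw [← orderOf_dvd_iff_pow_eq_one, ← Perm.lcm_cycleType, Multiset.lcm_dvd, h]
      intro b hb
      rw [Multiset.eq_of_mem_replicate hb]
    rw [h, Multiset.sum_replicate, smul_eq_mul] at hsum
    have hsupp : σ.support = univ := by
      rw [← card_eq_iff_eq_univ]; omega
    refine ⟨fun p => by simpa [pow_two] using congrArg (fun τ : Perm P => τ p) h2, fun p => ?_⟩
    rw [← Perm.mem_support, hsupp]
    exact mem_univ p

lemma card_pairings_empty {k : ℕ} (hk : Fintype.card P = 2 * k) :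
    #(pairings (∅ : Finset (List (P × P))) []) * (k.factorial * 2 ^ k) = (2 * k).factorial := by
  have h := Perm.card_of_cycleType_mul_eq (α := P) (Multiset.replicate k 2)
  have hset : pairings (∅ : Finset (List (P × P))) [] =
      univ.filter fun σ : Perm P => σ.cycleType = Multiset.replicate k 2 := by
    ext σ
    simp [mem_pairings, Hits, isPairing_iff_cycleType hk]
  rw [hset]
  rw [if_pos] at h
  · rw [← hk, ← h]
    congr 1
    rcases Nat.eq_zero_or_pos k with rfl | hpos
    · simp [hk]
    · rw [Multiset.toFinset_replicate, if_neg hpos.ne']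
      simp [hk]
      rw [mul_comm k 2]
      simp
      ring
  · constructor
    · simp [hk, mul_comm]
    · intro a ha
      rw [Multiset.eq_of_mem_replicate ha]

end Total

section Events

lemma card_filter_eq_two_mul {α : Type*} [Fintype α] (e : α → α) (he : Function.Involutive e)
    {Q R : α → Prop} [DecidablePred Q] [DecidablePred R] (hQ : ∀ x, Q x ↔ R x ∨ R (e x)) (hR : ∀ x, R x → ¬ R (e x)) :
    #(univ.filter Q) = 2 * #(univ.filter R) := by
  have h1 : univ.filter Q = univ.filter R ∪ (univ.filter R).image e := by
    ext x
    simp only [mem_filter, mem_univ, true_and, mem_union, mem_image, hQ]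
    refine or_congr_right ⟨fun h => ⟨e x, h, he x⟩, ?_⟩
    rintro ⟨z, hz, rfl⟩
    rwa [he z]
  have h2 : Disjoint (univ.filter R) ((univ.filter R).image e) := by
    rw [disjoint_left]
    intro x hx hx'
    simp only [mem_filter, mem_univ, true_and, mem_image] at hx hx'
    obtain ⟨z, hz, rfl⟩ := hx'
    exact hR z hz hx
  rw [h1, card_union_of_disjoint h2, card_image_of_injective _ he.injective, two_mul]

variable {P V : Type*} [Fintype P] [Fintype V]
variable {π : P → V} {X : SimpleGraph V} {Δ : ℕ} {r : P → ℕ}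

/-- The number of points above the vertex `v`. -/
noncomputable def fiberCard (π : P → V) (v : V) : ℕ := #(univ.filter fun p => π p = v)

lemma sum_comp_proj (g : V → ℝ) : ∑ p, g (π p) = ∑ v, (fiberCard π v : ℝ) * g v := by
  rw [← sum_fiberwise univ π]
  refine sum_congr rfl fun v _ => ?_
  rw [sum_congr rfl (g := fun _ => g v) (by intro p hp; rw [(mem_filter.1 hp).2])]
  simp [fiberCard]

lemma sum_fiberCard : ∑ v, (fiberCard π v : ℝ) = Fintype.card P := by
  simpa using (sum_comp_proj (π := π) fun _ => 1).symm

/-- Ordered pairs of distinct points above a common vertex. -/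
noncomputable def parallelPairs (π : P → V) : Finset (P × P) :=
  univ.filter fun x => x.1 ≠ x.2 ∧ π x.1 = π x.2

lemma sum_parallelPairs (g : V → ℝ) :
    ∑ x ∈ parallelPairs π, g (π x.1) = ∑ v, ((fiberCard π v).descFactorial 2 : ℝ) * g v := by
  rw [← sum_fiberwise (parallelPairs π) (fun x => π x.1)]
  refine sum_congr rfl fun v _ => ?_
  have hset : (parallelPairs π).filter (fun x => π x.1 = v) =
      (univ.filter fun p => π p = v).offDiag := by
    ext x
    simp only [parallelPairs, mem_filter, mem_univ, true_and, mem_offDiag]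
    grind
  rw [sum_congr rfl (g := fun _ => g v) (by intro p hp; rw [(mem_filter.1 hp).2]), sum_const,
    hset, offDiag_card, nsmul_eq_mul]
  congr 2
  simp only [fiberCard, Nat.descFactorial_succ, Nat.descFactorial_zero, mul_one, Nat.sub_zero]
  rw [Nat.sub_mul, one_mul]

lemma two_mul_card_singles (hr : r.Injective) : 2 * (#(singles π X r) : ℝ) =
    ∑ v, ((fiberCard π v).descFactorial 2 : ℝ) +
    ∑ v, ∑ w, if X.Adj v w then (fiberCard π v : ℝ) * fiberCard π w else 0 := by
  have h1 : #(singles π X r) =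
      #(univ.filter fun x : P × P => r x.1 < r x.2 ∧ Illegal π X x.1 x.2) :=
    card_image_of_injective _ fun x y h => by simpa using h
  have h2 : #(univ.filter fun x : P × P => x.1 ≠ x.2 ∧ Illegal π X x.1 x.2) =
      2 * #(singles π X r) := by
    rw [h1]
    refine card_filter_eq_two_mul (α := P × P) Prod.swap Prod.swap_swap (fun x => ?_) (fun x hx hx' => ?_)
    · have := illegal_comm (π := π) (X := X) (p := x.1) (q := x.2)
      have := hr.ne_iff (x := x.1) (y := x.2)
      simp only [Prod.fst_swap, Prod.snd_swap]
      grind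
    · exact lt_asymm hx.1 hx'.1
  have h3 : (univ.filter fun x : P × P => x.1 ≠ x.2 ∧ Illegal π X x.1 x.2) =
      parallelPairs π ∪ univ.filter fun x : P × P => X.Adj (π x.1) (π x.2) := by
    ext x
    rw [mem_filter, mem_union, mem_filter, parallelPairs, mem_filter]
    simp only [Illegal, mem_univ, true_and]
    have : X.Adj (π x.1) (π x.2) → x.1 ≠ x.2 := fun h h' => X.loopless.irrefl _ (h' ▸ h)
    tauto
  have h4 : Disjoint (parallelPairs π) (univ.filter fun x : P × P => X.Adj (π x.1) (π x.2)) := by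
    rw [disjoint_left]
    intro x hx hx'
    simp only [parallelPairs, mem_filter, mem_univ, true_and] at hx hx'
    exact hx'.ne hx.2
  rw [h3, card_union_of_disjoint h4] at h2
  have h5 : (2 : ℝ) * #(singles π X r) = #(parallelPairs π) +
    #(univ.filter fun x : P × P => X.Adj (π x.1) (π x.2)) := by exact_mod_cast h2.symm
  rw [h5]
  congr 1
  · simpa using sum_parallelPairs (π := π) fun _ => 1
  · rw [card_filter]
    push_cast
    rw [Fintype.sum_prod_type]
    have (p : P) : (∑ q, if X.Adj (π p) (π q) then (1 : ℝ) else 0) =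
        ∑ w, (fiberCard π w : ℝ) * if X.Adj (π p) w then 1 else 0 :=
      sum_comp_proj (π := π) fun w => if X.Adj (π p) w then 1 else 0
    simp only [this]
    rw [sum_comp_proj (π := π) fun v => ∑ w, (fiberCard π w : ℝ) * if X.Adj v w then 1 else 0]
    simp [mul_sum]

variable [LinearOrder V]

lemma four_mul_card_doubles (hr : r.Injective) : 4 * (#(doubles π X r) : ℝ) =
    ∑ v, ∑ w, if v = w ∨ X.Adj v w then 0 else
      ((fiberCard π v).descFactorial 2 : ℝ) * (fiberCard π w).descFactorial 2 := by
  have h1 : #(doubles π X r) =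
      #(univ.filter fun x : (P × P) × (P × P) => r x.1.1 < r x.2.1 ∧ x.1.2 ≠ x.2.2 ∧
        π x.1.1 = π x.2.1 ∧ π x.1.2 = π x.2.2 ∧ π x.1.1 < π x.1.2 ∧
        ¬ Illegal π X x.1.1 x.1.2) := by
    rw [doubles, card_image_of_injective]
    rintro ⟨a, b⟩ ⟨c, d⟩ h
    simpa using h
  have h2 : #(univ.filter fun x : (P × P) × (P × P) => x.1.1 ≠ x.2.1 ∧ x.1.2 ≠ x.2.2 ∧
        π x.1.1 = π x.2.1 ∧ π x.1.2 = π x.2.2 ∧ π x.1.1 < π x.1.2 ∧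
        ¬ Illegal π X x.1.1 x.1.2) = 2 * #(doubles π X r) := by
    rw [h1]
    refine card_filter_eq_two_mul (α := (P × P) × (P × P)) Prod.swap Prod.swap_swap ?_ (fun x hx hx' => ?_)
    · rintro ⟨⟨p, q⟩, p', q'⟩
      have := hr.ne_iff (x := p) (y := p')
      simp only [Prod.fst_swap, Prod.snd_swap, Illegal]
      grind
    · exact lt_asymm hx.1 hx'.1
  have h3 : #(univ.filter fun x : (P × P) × (P × P) => x.1.1 ≠ x.2.1 ∧ x.1.2 ≠ x.2.2 ∧
        π x.1.1 = π x.2.1 ∧ π x.1.2 = π x.2.2 ∧ ¬ Illegal π X x.1.1 x.1.2) =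
      2 * (2 * #(doubles π X r)) := by
    rw [← h2]
    refine card_filter_eq_two_mul (α := (P × P) × (P × P)) (Prod.map Prod.swap Prod.swap)
      (fun x => rfl) ?_
      (fun x hx hx' => ?_)
    · rintro ⟨⟨p, q⟩, p', q'⟩
      have := illegal_comm (π := π) (X := X) (p := p) (q := q)
      have h' : ¬ Illegal π X p q → π p ≠ π q := fun h h' => h (Or.inl h')
      simp only [Prod.map, Prod.fst_swap, Prod.snd_swap]
      have := lt_or_lt_iff_ne (a := π p) (b := π q)
      grind
    · exact lt_asymm hx.2.2.2.2.1 hx'.2.2.2.2.1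
  have h4 : #(univ.filter fun x : (P × P) × (P × P) => x.1.1 ≠ x.2.1 ∧ x.1.2 ≠ x.2.2 ∧
        π x.1.1 = π x.2.1 ∧ π x.1.2 = π x.2.2 ∧ ¬ Illegal π X x.1.1 x.1.2) =
      #((parallelPairs π ×ˢ parallelPairs π).filter fun x => ¬ Illegal π X x.1.1 x.2.1) := by
    refine card_bij' (fun x _ => ((x.1.1, x.2.1), (x.1.2, x.2.2)))
      (fun x _ => ((x.1.1, x.2.1), (x.1.2, x.2.2))) ?_ ?_ (fun _ _ => rfl) (fun _ _ => rfl) <;>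
    · intro x
      simp only [parallelPairs, mem_filter, mem_univ, true_and, mem_product]
      tauto
  have h5 : 4 * (#(doubles π X r) : ℝ) =
      #((parallelPairs π ×ˢ parallelPairs π).filter fun x => ¬ Illegal π X x.1.1 x.2.1) := by
    rw [← h4, h3]; push_cast; ring
  rw [h5, card_filter]
  push_cast
  rw [sum_product]
  have (x : P × P) : (∑ z ∈ parallelPairs π, if Illegal π X x.1 z.1 then (0 : ℝ) else 1) =
      ∑ w, ((fiberCard π w).descFactorial 2 : ℝ) *
        if π x.1 = w ∨ X.Adj (π x.1) w then 0 else 1 := by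
    convert sum_parallelPairs (π := π) fun w => if π x.1 = w ∨ X.Adj (π x.1) w then 0 else 1
    exact Iff.rfl
  simp only [ite_not, this]
  rw [sum_parallelPairs (π := π) fun v => ∑ w, ((fiberCard π w).descFactorial 2 : ℝ) *
        if v = w ∨ X.Adj v w then 0 else 1]
  simp [mul_sum]

lemma sum_weight : ∑ e ∈ singles π X r ∪ doubles π X r, weight e =
    #(singles π X r) / (Fintype.card P : ℝ) + #(doubles π X r) / (Fintype.card P : ℝ) ^ 2 := by
  rw [sum_union disjoint_singles_doubles,
    sum_congr rfl (g := fun _ => 1 / (Fintype.card P : ℝ)),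
    sum_congr (s₁ := doubles π X r) rfl (g := fun _ => (1 / (Fintype.card P : ℝ)) ^ 2)]
  · simp [div_eq_mul_inv]
  · intro e he
    obtain ⟨p, q, p', q', rfl, -⟩ := mem_doubles.1 he
    simp [weight]
  · intro e he
    obtain ⟨p, q, rfl, -⟩ := mem_singles.1 he
    simp [weight]

lemma descFactorial_two_le {y Δ : ℕ} (h : y ≤ Δ) : (y.descFactorial 2 : ℝ) ≤ Δ * y := by
  have : y.descFactorial 2 ≤ Δ * y := by
    simp only [Nat.descFactorial_succ, Nat.descFactorial_zero, mul_one, Nat.sub_zero]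
    exact Nat.mul_le_mul_right _ ((Nat.sub_le _ _).trans h)
  exact_mod_cast this

/-- Main term for the expected number of forbidden events. -/
lemma sum_weight_bounds (hS : Sparse π X Δ) (hr : r.Injective) {M S A : ℝ}
    (hM : M = Fintype.card P) (hSdef : S = ∑ v, ((fiberCard π v).descFactorial 2 : ℝ))
    (hA : A = ∑ v, ∑ w, if X.Adj v w then (fiberCard π v : ℝ) * fiberCard π w else 0) :
    ∑ e ∈ singles π X r ∪ doubles π X r, weight e ≤ 2 * (Δ : ℝ) ^ 2 ∧
    |∑ e ∈ singles π X r ∪ doubles π X r, weight e - (S / (2 * M) + (S / (2 * M)) ^ 2 +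
      A / (2 * M))| ≤ (Δ : ℝ) ^ 4 / M := by
  have h1 := two_mul_card_singles (π := π) (X := X) hr
  have h2 := four_mul_card_doubles (π := π) (X := X) hr
  have hsum := sum_fiberCard (π := π)
  rw [sum_weight]
  have hM0 := hS.card_pos
  rw [← hM] at hM0 hsum ⊢
  rw [← hSdef, ← hA] at h1
  have hMpos : 0 < M := by linarith
  have h3 : (3 : ℝ) ≤ Δ := by exact_mod_cast hS.three
  have hΔ (v : V) : fiberCard π v ≤ Δ := by have := hS.deg v; unfold fiberCard; omega
  have hdeg (v : V) : X.degree v ≤ Δ := by have := hS.deg v; omega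
  have ha (v : V) := descFactorial_two_le (hΔ v)
  have ha' (v : V) : ((fiberCard π v).descFactorial 2 : ℝ) ≤ (Δ : ℝ) ^ 2 := by
    refine (ha v).trans ?_
    rw [pow_two]; gcongr; exact hΔ v
  have hSle : S ≤ Δ * M := by
    rw [hSdef, ← hsum, mul_sum]
    exact sum_le_sum fun v _ => ha v
  have hS0 : 0 ≤ S := by rw [hSdef]; positivity
  have hadj (v : V) (c : ℝ) : (∑ w, if X.Adj v w then c else 0) = X.degree v * c := by
    rw [← sum_filter, sum_const, nsmul_eq_mul]
    congr 2
    rw [← X.card_neighborFinset_eq_degree]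
    congr 1
    ext w; simp
  have hA0 : 0 ≤ A := by
    rw [hA]
    exact sum_nonneg fun v _ => sum_nonneg fun w _ => by positivity
  have hAle : A ≤ (Δ : ℝ) ^ 2 * M := by
    rw [hA, ← hsum, mul_sum]
    refine sum_le_sum fun v _ => ?_
    calc (∑ w, if X.Adj v w then (fiberCard π v : ℝ) * fiberCard π w else 0)
        ≤ ∑ w, if X.Adj v w then (fiberCard π v : ℝ) * Δ else 0 := by
          refine sum_le_sum fun w _ => ?_
          split_ifs
          · gcongr; exact hΔ w
          · exact le_rfl
      _ = X.degree v * (fiberCard π v * Δ) := hadj v _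
      _ ≤ Δ * (fiberCard π v * Δ) := by gcongr; exact hdeg v
      _ = _ := by ring
  obtain ⟨D, hD⟩ : ∃ D : ℝ, D = 4 * (#(doubles π X r) : ℝ) := ⟨_, rfl⟩
  have hsplit : S ^ 2 - D = ∑ v, ∑ w, if v = w ∨ X.Adj v w then
      ((fiberCard π v).descFactorial 2 : ℝ) * (fiberCard π w).descFactorial 2 else 0 := by
    rw [hD, h2, hSdef, pow_two, sum_mul_sum, ← sum_sub_distrib]
    refine sum_congr rfl fun v _ => ?_
    rw [← sum_sub_distrib]
    refine sum_congr rfl fun w _ => ?_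
    split_ifs <;> simp
  have hlow : 0 ≤ S ^ 2 - D := by
    rw [hsplit]
    exact sum_nonneg fun v _ => sum_nonneg fun w _ => by positivity
  have hup : S ^ 2 - D ≤ 2 * (Δ : ℝ) ^ 4 * M := by
    rw [hsplit, ← hsum, mul_sum]
    refine sum_le_sum fun v _ => ?_
    calc (∑ w, if v = w ∨ X.Adj v w then
          ((fiberCard π v).descFactorial 2 : ℝ) * (fiberCard π w).descFactorial 2 else 0)
        ≤ ∑ w, ((if v = w then Δ * fiberCard π v * (Δ : ℝ) ^ 2 else 0) +
            if X.Adj v w then Δ * fiberCard π v * (Δ : ℝ) ^ 2 else 0) := by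
          refine sum_le_sum fun w _ => ?_
          have hb : ((fiberCard π v).descFactorial 2 : ℝ) * (fiberCard π w).descFactorial 2 ≤
            Δ * fiberCard π v * (Δ : ℝ) ^ 2 := by gcongr; exacts [ha v, ha' w]
          have : (0 : ℝ) ≤ Δ * fiberCard π v * (Δ : ℝ) ^ 2 := by positivity
          split_ifs <;> grind
      _ = (1 + X.degree v) * (Δ * fiberCard π v * (Δ : ℝ) ^ 2) := by
          rw [sum_add_distrib, hadj, sum_ite_eq, if_pos (mem_univ _)]; ring
      _ ≤ (Δ + Δ) * (Δ * fiberCard π v * (Δ : ℝ) ^ 2) := by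
          gcongr
          · linarith
          · exact hdeg v
      _ = _ := by ring
  have hs : (#(singles π X r) : ℝ) = (S + A) / 2 := by linarith
  have hd : (#(doubles π X r) : ℝ) = D / 4 := by linarith
  rw [hs, hd]
  have e1 : (S + A) / 2 / M + D / 4 / M ^ 2 - (S / (2 * M) + (S / (2 * M)) ^ 2 + A / (2 * M)) =
      - ((S ^ 2 - D) / (4 * M ^ 2)) := by
    field_simp; ring
  constructor
  · have e2 : (S + A) / 2 / M + D / 4 / M ^ 2 =
        (S / M) / 2 + (A / M) / 2 + (D / M ^ 2) / 4 := by field_simp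
    have b1 : S / M ≤ Δ := by rw [div_le_iff₀ hMpos]; exact hSle
    have b2 : A / M ≤ (Δ : ℝ) ^ 2 := by rw [div_le_iff₀ hMpos]; exact hAle
    have b3 : D / M ^ 2 ≤ (Δ : ℝ) ^ 2 := by
      rw [div_le_iff₀ (by positivity), ← mul_pow]
      calc D ≤ S ^ 2 := by linarith
        _ ≤ _ := by gcongr
    rw [e2]
    nlinarith
  · rw [e1, abs_neg, abs_of_nonneg (by positivity), div_le_div_iff₀ (by positivity) hMpos]
    have : (0 : ℝ) ≤ (Δ : ℝ) ^ 4 := by positivity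
    nlinarith [mul_le_mul_of_nonneg_right hup hMpos.le,
      mul_nonneg this (mul_nonneg hMpos.le hMpos.le)]

end Events

section Graphs

variable {P V : Type*} {π : P → V} {X H : SimpleGraph V} {σ τ : Perm P}

/-- The pairing projects to a simple graph that has no edge of `X`. -/
structure IsSimplePairing (π : P → V) (X : SimpleGraph V) (σ : Perm P) : Prop where
  pairing : IsPairing σ
  legal : ∀ p, ¬ Illegal π X p (σ p)
  inj : ∀ p p', π p = π p' → π (σ p) = π (σ p') → p = p'

/-- The pairing `σ` projects onto the edges of `H`. -/
def Realizes (π : P → V) (σ : Perm P) (H : SimpleGraph V) : Prop :=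
  ∀ v w, H.Adj v w ↔ ∃ p, π p = v ∧ π (σ p) = w

lemma Realizes.unique {H' : SimpleGraph V} (h : Realizes π σ H) (h' : Realizes π σ H') :
    H = H' := by
  ext v w
  rw [h, h']

lemma IsSimplePairing.exists_realizes (h : IsSimplePairing π X σ) :
    ∃ H, Realizes π σ H ∧ ∀ v w, H.Adj v w → ¬ X.Adj v w := by
  refine ⟨⟨fun v w => ∃ p, π p = v ∧ π (σ p) = w, ⟨?_⟩, ⟨?_⟩⟩, fun v w => Iff.rfl, ?_⟩
  · rintro v w ⟨p, rfl, rfl⟩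
    exact ⟨σ p, rfl, by rw [h.pairing.1]⟩
  · rintro v ⟨p, rfl, hp⟩
    exact h.legal p (Or.inl hp.symm)
  · rintro v w ⟨p, rfl, rfl⟩ hX
    exact h.legal p (Or.inr hX)

/-- Relabelling the points above each vertex preserves the projection. -/
lemma IsSimplePairing.conj (h : IsSimplePairing π X σ) {g : Perm P} (hg : π ∘ g = π) :
    IsSimplePairing π X (g * σ * g⁻¹) := by
  have hg' (p : P) : π (g p) = π p := congrFun hg p
  have hg'' (p : P) : π (g⁻¹ p) = π p := by simpa using (hg' (g⁻¹ p)).symm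
  refine ⟨⟨fun p => by simp [h.pairing.1], fun p hp => ?_⟩, fun p => ?_, fun p p' h1 h2 => ?_⟩
  · refine h.pairing.2 (g⁻¹ p) ?_
    apply g.injective
    simpa using hp
  · have := h.legal (g⁻¹ p)
    simpa only [Illegal, Perm.mul_apply, hg', hg''] using this
  · have := h.inj (g⁻¹ p) (g⁻¹ p') (by rw [hg'', hg'', h1])
      (by simpa only [Perm.mul_apply, hg'] using h2)
    exact g⁻¹.injective this

lemma Realizes.conj (h : Realizes π σ H) {g : Perm P} (hg : π ∘ g = π) :
    Realizes π (g * σ * g⁻¹) H := by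
  have hg' (p : P) : π (g p) = π p := congrFun hg p
  intro v w
  rw [h]
  constructor
  · rintro ⟨p, rfl, rfl⟩
    exact ⟨g p, by simp [hg'], by simp [hg']⟩
  · rintro ⟨p, rfl, rfl⟩
    exact ⟨g⁻¹ p, by simpa using (hg' (g⁻¹ p)).symm, by simp [hg']⟩

lemma conj_injective (hσ : IsSimplePairing π X σ) {g g' : Perm P} (hg : π ∘ g = π)
    (hg' : π ∘ g' = π) (h : g * σ * g⁻¹ = g' * σ * g'⁻¹) : g = g' := by
  have h1 (p : P) : π (g p) = π p := congrFun hg p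
  have h2 (p : P) : π (g' p) = π p := congrFun hg' p
  have h3 := hσ.conj hg'
  ext p
  refine h3.inj _ _ (by rw [h1, h2]) ?_
  rw [← congrArg (fun τ : Perm P => τ (g p)) h]
  simp [h1, h2]

variable [Fintype P]

lemma exists_conj (hσ : IsSimplePairing π X σ) (hτ : IsSimplePairing π X τ)
    (hσH : Realizes π σ H) (hτH : Realizes π τ H) :
    ∃ g : Perm P, π ∘ g = π ∧ g * σ * g⁻¹ = τ := by
  have hex (p : P) : ∃ q, π q = π p ∧ π (τ q) = π (σ p) :=
    (hτH _ _).1 ((hσH _ _).2 ⟨p, rfl, rfl⟩)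
  choose f hf1 hf2 using hex
  have hinj : f.Injective := fun p p' hpp' =>
    hσ.inj p p' (by rw [← hf1, hpp', hf1]) (by rw [← hf2, hpp', hf2])
  refine ⟨Equiv.ofBijective f (Finite.injective_iff_bijective.1 hinj), funext hf1, ?_⟩
  rw [mul_inv_eq_iff_eq_mul]
  ext p
  change f (σ p) = τ (f p)
  refine hτ.inj _ _ ?_ ?_
  · rw [hf1, hf2]
  · rw [hf2, hσ.pairing.1, hτ.pairing.1, hf1]

variable [Fintype V]

lemma Realizes.degree_eq (hσ : IsSimplePairing π X σ) (h : Realizes π σ H) (v : V) :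
    H.degree v = fiberCard π v := by
  rw [← H.card_neighborFinset_eq_degree, fiberCard]
  symm
  refine card_bij (fun p _ => π (σ p)) (fun p hp => ?_) (fun p hp p' hp' hpp' => ?_)
    (fun w hw => ?_)
  · rw [SimpleGraph.mem_neighborFinset, h]
    exact ⟨p, (mem_filter.1 hp).2, rfl⟩
  · exact hσ.inj p p' ((mem_filter.1 hp).2.trans (mem_filter.1 hp').2.symm) hpp'
  · rw [SimpleGraph.mem_neighborFinset, h] at hw
    obtain ⟨p, hp, hp'⟩ := hw
    exact ⟨p, by simp [hp], hp'⟩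

lemma exists_simplePairing (hdeg : ∀ v, H.degree v = fiberCard π v)
    (hX : ∀ v w, H.Adj v w → ¬ X.Adj v w) : ∃ σ, IsSimplePairing π X σ ∧ Realizes π σ H := by
  have hex (v : V) : ∃ f : P → V, (∀ p, π p = v → H.Adj v (f p)) ∧
      (∀ p p', π p = v → π p' = v → f p = f p' → p = p') ∧
      ∀ w, H.Adj v w → ∃ p, π p = v ∧ f p = w := by
    have hcard : Nonempty ({p // π p = v} ≃ H.neighborSet v) := by
      rw [← Fintype.card_eq, H.card_neighborSet_eq_degree, hdeg, fiberCard, Fintype.card_subtype]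
    obtain ⟨e⟩ := hcard
    refine ⟨fun p => if h : π p = v then e ⟨p, h⟩ else v, fun p hp => ?_, fun p p' hp hp' h => ?_,
      fun w hw => ⟨e.symm ⟨w, hw⟩, (e.symm ⟨w, hw⟩).2, ?_⟩⟩
    · simp only [hp, dite_true]
      exact (e ⟨p, hp⟩).2
    · simp only [hp, hp', dite_true] at h
      exact congrArg Subtype.val (e.injective (Subtype.ext h))
    · simp only [(e.symm ⟨w, hw⟩).2, dite_true, Subtype.coe_eta, apply_symm_apply]
  choose f hadj hinj hsurj using hex
  choose s hs1 hs2 using fun p : P =>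
    hsurj (f (π p) p) (π p) (hadj (π p) p rfl).symm
  have hs : Function.Involutive s := fun p => by
    have h1 : π (s (s p)) = π p := by rw [hs1, hs1, hs2]
    refine hinj (π p) _ _ h1 rfl ?_
    have h2 := hs2 (s p)
    rwa [hs1, hs2] at h2
  refine ⟨hs.toPerm, ⟨⟨hs, fun p hp => ?_⟩, fun p => ?_, fun p p' h1 h2 => ?_⟩, fun v w => ?_⟩
  · have := hadj (π p) p rfl
    rw [← hs1 p] at this
    exact this.ne (congrArg π hp).symm
  · have := hadj (π p) p rfl
    rw [← hs1 p] at this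
    rintro (h | h)
    · exact this.ne h
    · exact hX _ _ this h
  · change π (s p) = π (s p') at h2
    rw [hs1, hs1, ← h1] at h2
    exact hinj (π p) p p' rfl h1.symm h2
  · constructor
    · intro h
      obtain ⟨p, rfl, hp⟩ := hsurj v w h
      exact ⟨p, rfl, (hs1 p).trans hp⟩
    · rintro ⟨p, rfl, rfl⟩
      change H.Adj (π p) (π (s p))
      rw [hs1]
      exact hadj _ p rfl

lemma mem_pairings_iff_isSimplePairing [LinearOrder V] {r : P → ℕ} (hr : r.Injective) :
    σ ∈ pairings (singles π X r ∪ doubles π X r) [] ↔ IsSimplePairing π X σ := by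
  rw [mem_pairings]
  constructor
  · rintro ⟨h1, h2, -⟩
    have hlegal (p : P) : ¬ Illegal π X p (σ p) := by
      intro h
      rcases lt_or_gt_of_ne (hr.ne (h1.2 p)) with h' | h'
      · exact h2 [(σ p, p)] (mem_union_left _ (mem_singles.2
          ⟨_, _, rfl, h', illegal_comm.1 h⟩)) (by simp [Hits, h1.1])
      · exact h2 [(p, σ p)] (mem_union_left _ (mem_singles.2
          ⟨_, _, rfl, h', h⟩)) (by simp [Hits])
    have key (p p' : P) (hp : π p = π p') (hσ : π (σ p) = π (σ p')) (hlt : π p < π (σ p))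
        (hr' : r p < r p') : False := by
      refine h2 [(p, σ p), (p', σ p')] (mem_union_right _ (mem_doubles.2
        ⟨_, _, _, _, rfl, hr', ?_, hp, hσ, hlt, hlegal p⟩)) (by simp [Hits])
      intro h
      rw [σ.injective h] at hr'
      exact lt_irrefl _ hr'
    have key' (p p' : P) (hne : p ≠ p') (hp : π p = π p') (hσ : π (σ p) = π (σ p'))
        (hlt : π p < π (σ p)) : False := by
      rcases lt_or_gt_of_ne (hr.ne hne) with h | h
      · exact key p p' hp hσ hlt h
      · exact key p' p hp.symm hσ.symm (by rwa [← hp, ← hσ]) h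
    refine ⟨h1, hlegal, fun p p' hp hσ => ?_⟩
    by_contra hne
    rcases lt_trichotomy (π p) (π (σ p)) with h | h | h
    · exact key' p p' hne hp hσ h
    · exact hlegal p (Or.inl h)
    · exact key' (σ p) (σ p') (σ.injective.ne hne) hσ (by rw [h1.1, h1.1, hp]) (by rwa [h1.1])
  · intro h
    refine ⟨h.pairing, fun e he hit => ?_, by simp [Hits]⟩
    rcases mem_union.1 he with he | he
    · obtain ⟨p, q, rfl, -, hI⟩ := mem_singles.1 he
      have : σ p = q := hit (p, q) (by simp)
      exact h.legal p (this ▸ hI)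
    · obtain ⟨p, q, p', q', rfl, hr', -, h3, h4, -⟩ := mem_doubles.1 he
      have e1 : σ p = q := hit (p, q) (by simp)
      have e2 : σ p' = q' := hit (p', q') (by simp)
      rw [h.inj p p' h3 (by rw [e1, e2, h4])] at hr'
      exact lt_irrefl _ hr'

/-- Each simple graph arises from `∏ v, (d v)!` pairings. -/
lemma card_simplePairings : #(univ.filter fun σ : Perm P => IsSimplePairing π X σ) =
    (∏ v, (fiberCard π v).factorial) * #(univ.filter fun H : SimpleGraph V =>
      (∀ v, H.degree v = fiberCard π v) ∧ ∀ v w, H.Adj v w → ¬ X.Adj v w) := by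
  have hstab : ∏ v, (fiberCard π v).factorial = #(univ.filter fun g : Perm P => π ∘ g = π) := by
    rw [← Fintype.card_subtype, DomMulAct.stabilizer_card]
    refine prod_congr rfl fun v _ => ?_
    rw [Fintype.card_subtype, fiberCard]
  rw [hstab, ← card_product]
  have hex (H : SimpleGraph V) : ∃ σ : Perm P, ((∀ v, H.degree v = fiberCard π v) ∧
      ∀ v w, H.Adj v w → ¬ X.Adj v w) → IsSimplePairing π X σ ∧ Realizes π σ H := by
    by_cases h : (∀ v, H.degree v = fiberCard π v) ∧ ∀ v w, H.Adj v w → ¬ X.Adj v w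
    · obtain ⟨σ, hσ⟩ := exists_simplePairing h.1 h.2
      exact ⟨σ, fun _ => hσ⟩
    · exact ⟨1, fun h' => absurd h' h⟩
  choose s hs using hex
  symm
  refine card_bij (fun x _ => x.1 * s x.2 * x.1⁻¹) ?_ ?_ ?_
  · rintro ⟨g, H⟩ h
    simp only [mem_product, mem_filter, mem_univ, true_and] at h ⊢
    exact (hs H h.2).1.conj h.1
  · rintro ⟨g, H⟩ h ⟨g', H'⟩ h' heq
    simp only [mem_product, mem_filter, mem_univ, true_and] at h h' heq
    have hH : H = H' := ((hs H h.2).2.conj h.1).unique (heq ▸ (hs H' h'.2).2.conj h'.1)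
    subst hH
    rw [conj_injective (hs H h.2).1 h.1 h'.1 heq]
  · intro σ hσ
    have hσ := (mem_filter.1 hσ).2
    obtain ⟨H, hH, hHX⟩ := hσ.exists_realizes
    have hdeg := hH.degree_eq hσ
    obtain ⟨h1, h2⟩ := hs H ⟨hdeg, hHX⟩
    obtain ⟨g, hg, hg'⟩ := exists_conj h1 hσ h2 hH
    exact ⟨(g, H), by simp only [mem_product, mem_filter, mem_univ, true_and]; exact
      ⟨hg, hdeg, hHX⟩, hg'⟩

end Graphs

section Enumeration

lemma fiberCard_sigma_fst {n : ℕ} (y : Fin n → ℕ) (v : Fin n) :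
    fiberCard (Sigma.fst : (Σ v, Fin (y v)) → Fin n) v = y v := by
  rw [fiberCard, ← Fintype.card_subtype, Fintype.card_congr (Equiv.sigmaSubtype v), Fintype.card_fin]

lemma card_graphs_avoiding_of_points {P : Type*} [Fintype P] {n k Δ : ℕ} {π : P → Fin n}
    {y : Fin n → ℕ} {X : SimpleGraph (Fin n)} (hfib : ∀ v, fiberCard π v = y v)
    (hdeg : ∀ v, y v + X.degree v ≤ Δ) (h3 : 3 ≤ Δ) (hsum : ∑ v, y v = 2 * k)
    (hΔ : Δ ^ 4 ≤ 2 * k) {M S A : ℝ} (hM : M = ∑ v, (y v : ℝ))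
    (hS : S = ∑ v, ((y v).descFactorial 2 : ℝ))
    (hA : A = ∑ v, ∑ w, if X.Adj v w then (y v : ℝ) * y w else 0) :
    ∃ E : ℝ, |E| ≤ 201 * (Δ : ℝ) ^ 4 / M ∧
      ((∏ v, (y v).factorial : ℕ) : ℝ) * #(univ.filter fun H : SimpleGraph (Fin n) =>
        (∀ v, H.degree v = y v) ∧ ∀ v w, H.Adj v w → ¬ X.Adj v w) * (k.factorial * 2 ^ k) =
      (2 * k).factorial *
        Real.exp (-(S / (2 * M) + (S / (2 * M)) ^ 2 + A / (2 * M)) + E) := by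
  have hcard : Fintype.card P = 2 * k := by
    have := sum_fiberCard (π := π)
    simp only [hfib] at this
    rw [← hsum]
    exact_mod_cast this.symm
  have hMk : M = Fintype.card P := by rw [hM, hcard, ← hsum]; push_cast; rfl
  obtain ⟨r, hr⟩ : ∃ r : P → ℕ, r.Injective :=
    ⟨fun p => Fintype.equivFin _ p, fun p q h => (Fintype.equivFin _).injective (Fin.ext h)⟩
  have hSp : Sparse π X Δ := by
    refine ⟨fun v => ?_, h3, ?_⟩
    · have := hdeg v
      rwa [← hfib v] at this
    · rw [hcard]
      refine le_trans ?_ hΔ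
      nlinarith [Nat.pow_le_pow_left h3 2, Nat.zero_le (Δ ^ 2)]
  have htot := card_pairings_empty hcard
  have hne : (pairings (∅ : Finset (List (P × P))) []).Nonempty := by
    rw [← card_pos]
    exact Nat.pos_of_mul_pos_right (htot ▸ Nat.factorial_pos _)
  obtain ⟨hne', hlog⟩ := log_card_simple_pairings hSp hr hne
  obtain ⟨hW, hmain⟩ := sum_weight_bounds hSp hr hMk (S := S) (A := A) (by simp only [hS, hfib])
    (by simp only [hA, hfib])
  have hsimple : pairings (singles π X r ∪ doubles π X r) [] =
      univ.filter fun σ => IsSimplePairing π X σ := by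
    ext σ
    rw [mem_pairings_iff_isSimplePairing hr]
    simp
  have hgraphs := card_simplePairings (π := π) (X := X)
  simp only [hfib] at hgraphs
  rw [← hsimple] at hgraphs
  rw [← hMk] at hlog
  have hMpos : 0 < M := by rw [hMk]; linarith [hSp.card_pos]
  generalize ∑ e ∈ singles π X r ∪ doubles π X r, weight e = W at *
  have hposS : (0 : ℝ) < #(pairings (singles π X r ∪ doubles π X r) []) := by
    exact_mod_cast hne'.card_pos
  have hposT : (0 : ℝ) < #(pairings (∅ : Finset (List (P × P))) []) := by exact_mod_cast hne.card_pos
  obtain ⟨E, hE⟩ : ∃ E, E = Real.log #(pairings (singles π X r ∪ doubles π X r) []) -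
      Real.log #(pairings (∅ : Finset (List (P × P))) []) +
      (S / (2 * M) + (S / (2 * M)) ^ 2 + A / (2 * M)) := ⟨_, rfl⟩
  refine ⟨E, ?_, ?_⟩
  · have h1 : 100 * ((Δ : ℝ) ^ 2 / M) * W ≤ 200 * (Δ : ℝ) ^ 4 / M := by
      calc 100 * ((Δ : ℝ) ^ 2 / M) * W ≤ 100 * ((Δ : ℝ) ^ 2 / M) * (2 * (Δ : ℝ) ^ 2) := by gcongr
        _ = _ := by ring
    have h2 : 201 * (Δ : ℝ) ^ 4 / M = 200 * (Δ : ℝ) ^ 4 / M + (Δ : ℝ) ^ 4 / M := by ring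
    rw [h2, hE]
    rw [abs_le] at *
    constructor <;> linarith
  · have hexp : (#(pairings (singles π X r ∪ doubles π X r) []) : ℝ) =
        #(pairings (∅ : Finset (List (P × P))) []) *
        Real.exp (-(S / (2 * M) + (S / (2 * M)) ^ 2 + A / (2 * M)) + E) := by
      rw [hE]
      conv_lhs => rw [← Real.exp_log hposS]
      conv_rhs => rw [← Real.exp_log hposT]
      rw [← Real.exp_add]
      simp only [Real.exp_log hposT]
      congr 1
      ring
    have hg : ((∏ v, (y v).factorial : ℕ) : ℝ) * #(univ.filter fun H : SimpleGraph (Fin n) =>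
        (∀ v, H.degree v = y v) ∧ ∀ v w, H.Adj v w → ¬ X.Adj v w) =
        #(pairings (singles π X r ∪ doubles π X r) []) := by
      rw [hgraphs, Nat.cast_mul]
      congr!
    rw [hg, hexp, ← htot]
    push_cast
    ring

/-- Asymptotic number of graphs with degrees `y` and no edge in common with `X`. -/
theorem card_graphs_avoiding {n k Δ : ℕ} (y : Fin n → ℕ) (X : SimpleGraph (Fin n))
    (hdeg : ∀ v, y v + X.degree v ≤ Δ) (h3 : 3 ≤ Δ) (hsum : ∑ v, y v = 2 * k)
    (hΔ : Δ ^ 4 ≤ 2 * k) {M S A : ℝ} (hM : M = ∑ v, (y v : ℝ))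
    (hS : S = ∑ v, ((y v).descFactorial 2 : ℝ))
    (hA : A = ∑ v, ∑ w, if X.Adj v w then (y v : ℝ) * y w else 0) :
    ∃ E : ℝ, |E| ≤ 201 * (Δ : ℝ) ^ 4 / M ∧
      ((∏ v, (y v).factorial : ℕ) : ℝ) * #(univ.filter fun H : SimpleGraph (Fin n) =>
        (∀ v, H.degree v = y v) ∧ ∀ v w, H.Adj v w → ¬ X.Adj v w) * (k.factorial * 2 ^ k) =
      (2 * k).factorial *
        Real.exp (-(S / (2 * M) + (S / (2 * M)) ^ 2 + A / (2 * M)) + E) :=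
  card_graphs_avoiding_of_points (fiberCard_sigma_fst y) hdeg h3 hsum hΔ hM hS hA

end Enumeration

section Assembly

variable {V : Type*} [Fintype V]

lemma sum_adj_eq_two_mul_sum_edges (T : SimpleGraph V) (f : V → V → ℝ)
    (hf : ∀ v w, f v w = f w v) :
    (∑ v, ∑ w, if T.Adj v w then f v w else 0) =
      2 * ∑ e ∈ T.edgeFinset, Sym2.lift ⟨f, hf⟩ e := by
  rw [← Fintype.sum_prod_type' (f := fun v w => if T.Adj v w then f v w else 0), ← sum_filter,
    ← sum_fiberwise_of_maps_to (t := T.edgeFinset) (g := fun x => s(x.1, x.2)), mul_sum]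
  · refine sum_congr rfl fun e he => ?_
    induction e using Sym2.ind with
    | h v w =>
      rw [SimpleGraph.mem_edgeFinset, SimpleGraph.mem_edgeSet] at he
      have hset : (univ.filter fun x : V × V => T.Adj x.1 x.2).filter
          (fun x => s(x.1, x.2) = s(v, w)) = {(v, w), (w, v)} := by
        ext ⟨a, b⟩
        simp only [mem_filter, mem_univ, true_and, Sym2.eq_iff, mem_insert, mem_singleton,
          Prod.mk.injEq]
        have := he.symm
        grind
      rw [hset, sum_pair (by simp [he.ne])]
      simp only [Sym2.lift_mk, hf w v]
      ring
  · intro x hx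
    rw [SimpleGraph.mem_edgeFinset, SimpleGraph.mem_edgeSet]
    exact (mem_filter.1 hx).2

lemma degree_eq_add_of_disjoint {G H T : SimpleGraph V} (hG : G = H ⊔ T)
    (h : ∀ v w, H.Adj v w → ¬ T.Adj v w) (v : V) : G.degree v = H.degree v + T.degree v := by
  simp only [← SimpleGraph.card_neighborFinset_eq_degree]
  rw [← card_union_of_disjoint]
  · congr 1
    ext w
    simp [hG]
  · rw [disjoint_left]
    intro w
    simpa using h v w

lemma card_graphs_containing {n : ℕ} {d x : Fin n → ℕ} (T : SimpleGraph (Fin n)) (hle : ∀ v, x v ≤ d v)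
    (hT : ∀ v, T.degree v = x v) :
    #(univ.filter fun G : SimpleGraph (Fin n) => (∀ v, G.degree v = d v) ∧ T ≤ G) =
      #(univ.filter fun H : SimpleGraph (Fin n) =>
        (∀ v, H.degree v = d v - x v) ∧ ∀ v w, H.Adj v w → ¬ T.Adj v w) := by
  refine card_bij' (fun G _ => G \ T) (fun H _ => H ⊔ T) ?_ ?_ ?_ ?_
  · intro G hG
    rw [mem_filter] at hG ⊢
    have hdisj : ∀ v w, (G \ T).Adj v w → ¬ T.Adj v w := fun v w h => h.2
    refine ⟨mem_univ _, fun v => ?_, hdisj⟩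
    have := degree_eq_add_of_disjoint (sdiff_sup_cancel hG.2.2).symm hdisj v
    rw [hG.2.1, hT] at this
    omega
  · intro H hH
    rw [mem_filter] at hH ⊢
    refine ⟨mem_univ _, fun v => ?_, le_sup_right⟩
    rw [degree_eq_add_of_disjoint rfl hH.2.2, hH.2.1, hT, Nat.sub_add_cancel (hle v)]
  · intro G hG
    exact sdiff_sup_cancel (mem_filter.1 hG).2.2
  · intro H hH
    have := (mem_filter.1 hH).2.2
    ext v w
    simp only [SimpleGraph.sdiff_adj, SimpleGraph.sup_adj]
    have := this v w
    tauto

end Assembly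

section Ratio

/-- Dividing the two factorial formulas. -/
lemma div_eq_of_factorial_formulas {n k₀ k₁ : ℕ} {d x : Fin n → ℕ} (hle : ∀ j, x j ≤ d j)
    {m : ℕ} (hk : k₀ = k₁ + m) {N₀ N₁ a b : ℝ}
    (h₀ : ((∏ v, (d v).factorial : ℕ) : ℝ) * N₀ * (k₀.factorial * 2 ^ k₀) =
      (2 * k₀).factorial * Real.exp a)
    (h₁ : ((∏ v, (d v - x v).factorial : ℕ) : ℝ) * N₁ * (k₁.factorial * 2 ^ k₁) =
      (2 * k₁).factorial * Real.exp b) :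
    N₁ / N₀ = ((k₀.descFactorial m : ℝ) * 2 ^ m / ((2 * k₀).descFactorial (2 * m) : ℝ)) *
      (∏ j, ((d j).descFactorial (x j) : ℝ)) * Real.exp (b - a) := by
  have e1 : ((∏ v, (d v).factorial : ℕ) : ℝ) =
      ((∏ v, (d v - x v).factorial : ℕ) : ℝ) * ∏ j, ((d j).descFactorial (x j) : ℝ) := by
    push_cast
    rw [← prod_mul_distrib]
    refine prod_congr rfl fun j _ => ?_
    exact_mod_cast (Nat.factorial_mul_descFactorial (hle j)).symm
  have e2 : (k₀.factorial : ℝ) = k₁.factorial * k₀.descFactorial m := by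
    have := Nat.factorial_mul_descFactorial (show m ≤ k₀ by omega)
    rw [show k₀ - m = k₁ by omega] at this
    exact_mod_cast this.symm
  have e3 : ((2 * k₀).factorial : ℝ) = (2 * k₁).factorial * (2 * k₀).descFactorial (2 * m) := by
    have := Nat.factorial_mul_descFactorial (show 2 * m ≤ 2 * k₀ by omega)
    rw [show 2 * k₀ - 2 * m = 2 * k₁ by omega] at this
    exact_mod_cast this.symm
  have p1 : ((∏ v, (d v - x v).factorial : ℕ) : ℝ) ≠ 0 := by
    exact_mod_cast (prod_pos fun j _ => Nat.factorial_pos _).ne'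
  have p2 : (k₁.factorial : ℝ) ≠ 0 := by exact_mod_cast Nat.factorial_ne_zero _
  have p3 : ((2 * k₁).factorial : ℝ) ≠ 0 := by exact_mod_cast Nat.factorial_ne_zero _
  have p4 : ((2 * k₀).descFactorial (2 * m) : ℝ) ≠ 0 := by
    exact_mod_cast fun h => absurd (Nat.descFactorial_eq_zero_iff_lt.1 h) (by omega)
  have p5 : (2 : ℝ) ^ k₁ ≠ 0 := by positivity
  have p6 := (Real.exp_pos a).ne'
  rw [e1, e2, e3] at h₀
  have hN₀ : N₀ ≠ 0 := by
    rintro rfl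
    rw [mul_zero, zero_mul] at h₀
    exact mul_ne_zero (mul_ne_zero p3 p4) p6 h₀.symm
  rw [Real.exp_sub, hk, pow_add] at *
  generalize ((∏ v, (d v - x v).factorial : ℕ) : ℝ) = p at *
  generalize (∏ j, ((d j).descFactorial (x j) : ℝ)) = q at *
  generalize Real.exp a = u at *
  generalize Real.exp b = w at *
  generalize ((2 * (k₁ + m)).descFactorial (2 * m) : ℝ) = D at *
  generalize (((k₁ + m)).descFactorial m : ℝ) = f at *
  generalize (k₁.factorial : ℝ) = g at *
  generalize ((2 * k₁).factorial : ℝ) = G at *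
  generalize (2 : ℝ) ^ k₁ = t at *
  generalize (2 : ℝ) ^ m = s at *
  rw [div_eq_iff hN₀]
  have key : (p * g * t) * (G * D * u * N₁) = (p * g * t) * (f * s * q * w * N₀ * G) := by
    linear_combination (G * D * u) * h₁ - (G * w) * h₀
  have key' := mul_left_cancel₀ (mul_ne_zero (mul_ne_zero p1 p2) p5) key
  field_simp
  apply mul_left_cancel₀ p3
  linear_combination key'

end Ratio

end TreeProb

theorem prob_contains_given_tree :
    ∃ C : ℝ, 0 < C ∧ ∃ N₀ : ℕ, ∀ n : ℕ, N₀ ≤ n →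
    ∀ dseq xseq : Fin n → ℕ, ∀ T : SimpleGraph (Fin n),
      (∀ j, 1 ≤ dseq j) → Even (∑ j, dseq j) →
      -- `xseq` is a suitable degree sequence
      (∀ j, 1 ≤ xseq j) → (∀ j, xseq j ≤ dseq j) → (∑ j, xseq j) + 2 = 2 * n →
      -- `T` is a tree with degree sequence `xseq`
      T.IsTree → (∀ j, T.degree j = xseq j) →
      ∀ dmax davg lam0 lamx muT : ℝ,
      dmax = (Finset.univ.sup dseq : ℕ) →
      davg = (∑ j, (dseq j : ℝ)) / n →
      lam0 = (∑ j, (Nat.descFactorial (dseq j) 2 : ℝ)) / (2 * ∑ j, (dseq j : ℝ)) →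
      lamx = (∑ j, (Nat.descFactorial (dseq j - xseq j) 2 : ℝ)) /
          (2 * ((davg - 2) * n) + 4) →
      muT = (∑ e ∈ T.edgeFinset,
          Sym2.lift ⟨fun i j => ((dseq i - xseq i : ℕ) : ℝ) * ((dseq j - xseq j : ℕ) : ℝ),
            fun i j => by ring⟩ e) / ((davg - 2) * n + 2) →
      dmax ^ 4 ≤ (davg - 2) * n →
      ∃ E : ℝ,
        |E| ≤ C * dmax ^ 4 / ((davg - 2) * n) ∧
        ((Finset.univ.filter (fun G : SimpleGraph (Fin n) =>
              (∀ j, G.degree j = dseq j) ∧ T ≤ G)).card : ℝ) /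
          ((Finset.univ.filter (fun G : SimpleGraph (Fin n) =>
              ∀ j, G.degree j = dseq j)).card : ℝ)
        = ((Nat.descFactorial ((∑ j, dseq j) / 2) (n - 1) : ℝ) * 2 ^ (n - 1) /
              (Nat.descFactorial (∑ j, dseq j) (2 * n - 2) : ℝ)) *
            (∏ j, (Nat.descFactorial (dseq j) (xseq j) : ℝ)) *
            Real.exp (lam0 + lam0 ^ 2 - lamx - lamx ^ 2 - muT + E) := by
  refine ⟨402, by norm_num, 1, fun n hn d x T hd hev hx hle hxsum _ hTdeg dmax davg lam0 lamx muT
    hdmax hdavg hlam0 hlamx hmuT hbound => ?_⟩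
  have hn0 : (n : ℝ) ≠ 0 := by exact_mod_cast (by omega : n ≠ 0)
  have hsplit : ∑ j, (d j - x j) + ∑ j, x j = ∑ j, d j := by
    rw [← Finset.sum_add_distrib]
    exact Finset.sum_congr rfl fun j _ => Nat.sub_add_cancel (hle j)
  obtain ⟨k₀, hk₀⟩ : ∃ k₀, ∑ j, d j = 2 * k₀ := hev.two_dvd
  obtain ⟨k₁, hk₁⟩ : ∃ k₁, ∑ j, (d j - x j) = 2 * k₁ := ⟨k₀ - (n - 1), by omega⟩
  have hk : k₀ = k₁ + (n - 1) := by omega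
  have hexcess : (davg - 2) * n = 2 * k₁ - 2 := by
    have : (∑ j, (d j : ℝ)) = 2 * k₀ := by exact_mod_cast hk₀
    rw [hdavg, this, sub_mul, div_mul_cancel₀ _ hn0, hk]
    push_cast [Nat.cast_sub hn]
    ring
  have hsup (j : Fin n) : d j ≤ Finset.univ.sup d := Finset.le_sup (Finset.mem_univ j)
  obtain ⟨Δ, hΔ⟩ : ∃ Δ, Δ = Finset.univ.sup d := ⟨_, rfl⟩
  rw [← hΔ] at hdmax hsup
  rw [hexcess] at hlamx hmuT hbound ⊢
  rw [hdmax] at hbound ⊢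
  have hbound' : Δ ^ 4 + 2 ≤ 2 * k₁ := by
    have : (Δ : ℝ) ^ 4 + 2 ≤ 2 * k₁ := by linarith
    exact_mod_cast this
  have hΔ1 : 1 ≤ Δ := (hd ⟨0, hn⟩).trans (hsup _)
  have h3 : 3 ≤ Δ := by
    by_contra hlt
    have h4 : ∑ j, d j ≤ ∑ _j : Fin n, 2 :=
      Finset.sum_le_sum fun j _ => (hsup j).trans (by omega)
    have h5 : 1 ≤ Δ ^ 4 := Nat.one_le_pow _ _ hΔ1
    simp at h4
    omega
  obtain ⟨E₀, hE₀, hN₀⟩ := TreeProb.card_graphs_avoiding (k := k₀) (Δ := Δ) d ⊥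
    (by simpa using hsup) h3 hk₀ (by omega) rfl rfl rfl
  obtain ⟨E₁, hE₁, hN₁⟩ := TreeProb.card_graphs_avoiding (k := k₁) (Δ := Δ) (fun j => d j - x j) T
    (fun v => by rw [hTdeg, Nat.sub_add_cancel (hle v)]; exact hsup v) h3 hk₁ (by omega)
    rfl rfl rfl
  have hsum₀ : (∑ j, (d j : ℝ)) = 2 * k₀ := by exact_mod_cast hk₀
  have hsum₁ : (∑ j, ((d j - x j : ℕ) : ℝ)) = 2 * k₁ := by exact_mod_cast hk₁
  have hcontain := TreeProb.card_graphs_containing T hle hTdeg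
  have hratio := TreeProb.div_eq_of_factorial_formulas hle hk hN₀ hN₁
  refine ⟨E₁ - E₀, ?_, ?_⟩
  · have hpos : (0 : ℝ) < 2 * k₁ - 2 := by
      have : (0 : ℝ) < (Δ : ℝ) ^ 4 := by positivity
      linarith
    have hkk : (k₁ : ℝ) ≤ k₀ := by exact_mod_cast (by omega : k₁ ≤ k₀)
    rw [hsum₀] at hE₀
    rw [hsum₁] at hE₁
    have b₀ : 201 * (Δ : ℝ) ^ 4 / (2 * k₀) ≤ 201 * (Δ : ℝ) ^ 4 / (2 * k₁ - 2) :=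
      div_le_div_of_nonneg_left (by positivity) hpos (by linarith)
    have b₁ : 201 * (Δ : ℝ) ^ 4 / (2 * k₁) ≤ 201 * (Δ : ℝ) ^ 4 / (2 * k₁ - 2) :=
      div_le_div_of_nonneg_left (by positivity) hpos (by linarith)
    calc |E₁ - E₀| ≤ |E₁| + |E₀| := abs_sub _ _
      _ ≤ 201 * (Δ : ℝ) ^ 4 / (2 * k₁ - 2) + 201 * (Δ : ℝ) ^ 4 / (2 * k₁ - 2) := by linarith
      _ = _ := by ring
  · have hedges := TreeProb.sum_adj_eq_two_mul_sum_edges T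
      (fun i j => ((d i - x i : ℕ) : ℝ) * ((d j - x j : ℕ) : ℝ)) (fun i j => by ring)
    have hlamx' : lamx = (∑ j, ((d j - x j).descFactorial 2 : ℝ)) / (2 * (2 * k₁)) := by
      rw [hlamx]; congr 1; ring
    have hmuT' : muT = (∑ i, ∑ j, if T.Adj i j then
        ((d i - x i : ℕ) : ℝ) * ((d j - x j : ℕ) : ℝ) else 0) / (2 * (2 * k₁)) := by
      rw [hedges, hmuT, mul_div_mul_left _ _ two_ne_zero, sub_add_cancel]
    rw [hsum₁, ← hlamx', ← hmuT', ← hlam0] at hratio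
    simp only [SimpleGraph.bot_adj, if_false, Finset.sum_const_zero, zero_div, add_zero,
      not_false_eq_true, implies_true, and_true] at hratio
    rw [hk₀, Nat.mul_div_cancel_left _ two_pos, show 2 * n - 2 = 2 * (n - 1) by omega]
    rw [hcontain, hratio]
    congr 2
    ring
end
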